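/- (Third link) Let X ⊂ ℙ³ be a smooth cubic surface and a a positive integer. Assume that the ideal I_{Z_{o(a)},X} of a general set of o(a) = (3/2)a(a−1) + a + 1 points on X has graded minimal free resolution over R given by 0 → R(−a−3)^{a} → R(−a−1)^{3a−3} ⊕ R(−a−2)^{3} → R(−a)^{2a} → I_{Z_{o(a)},X} → 0. Then the ideal I_{Z_{p(a)},X} of a general set of p(a) = (3/2)a(a−1) + 2a + 1 points on X has graded minimal free resolution over R given by 0 → R(−a−3)^{2a} → R(−a−2)^{3a+3} → R(−a)^{a} ⊕ R(−a−1)^{3} → I_{Z_{p(a)},X} → 0. -/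

import Mathlib

/-!
Common definitions for formalizing "The minimal resolution conjecture for points
on the cubic surface" (arXiv:math/0611137).

We work with `R = k[x₀,x₁,x₂,x₃]`, closed points of `ℙ³` modeled by
`Projectivization k (Fin 4 → k)`, saturated ideals of sets of points as vanishing
ideals, genericity expressed by a nonempty basic open subset of the configuration
space, and graded minimal free resolutions expressed by explicit homogeneous
matrices whose entries have zero constant term (no nonzero scalar entries).
-/

open MvPolynomial

noncomputable section

/-- The polynomial ring `R = k[x₀,x₁,x₂,x₃]` in four variables over `k`. -/
abbrev R4 (k : Type) [Field k] : Type := MvPolynomial (Fin 4) k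

/-- The (closed) points of the projective space `ℙ³` over `k`. -/
abbrev P3 (k : Type) [Field k] : Type := Projectivization k (Fin 4 → k)

variable (k : Type) [Field k]

/-- A polynomial vanishes at a projective point if it vanishes at every
representative vector of that point. -/
def VanishesAt (f : R4 k) (p : P3 k) : Prop :=
  ∀ (v : Fin 4 → k) (hv : v ≠ 0), Projectivization.mk k v hv = p → eval v f = 0

/-- The saturated homogeneous ideal `I_Z ⊆ R` of a set `Z` of (reduced) points of
`ℙ³`: all polynomials vanishing at every point of `Z`. -/
def pointsIdeal (Zs : Set (P3 k)) : Ideal (R4 k) where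
  carrier := {f | ∀ p ∈ Zs, VanishesAt k f p}
  zero_mem' := by
    intro p _ v hv _
    simp
  add_mem' := by
    intro a b ha hb p hp v hv hmk
    have h1 := ha p hp v hv hmk
    have h2 := hb p hp v hv hmk
    simp [h1, h2]
  smul_mem' := by
    intro c a ha p hp v hv hmk
    have h1 := ha p hp v hv hmk
    simp [smul_eq_mul, h1]

/-- An ideal of `R` is homogeneous if it is generated by homogeneous elements. -/
def IsHomogIdeal (I : Ideal (R4 k)) : Prop :=
  ∃ G : Set (R4 k), (∀ g ∈ G, ∃ d : ℕ, g.IsHomogeneous d) ∧ I = Ideal.span G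

/-- Saturation of an ideal with respect to the irrelevant maximal ideal
`(x₀,…,x₃)`. -/
def satIdeal (I : Ideal (R4 k)) : Ideal (R4 k) where
  carrier := {g | ∀ i : Fin 4, ∃ N : ℕ, (X i : R4 k) ^ N * g ∈ I}
  zero_mem' := by
    intro i
    exact ⟨0, by simp⟩
  add_mem' := by
    intro a b ha hb i
    obtain ⟨N, hN⟩ := ha i
    obtain ⟨M, hM⟩ := hb i
    refine ⟨N + M, ?_⟩
    have h1 : (X i : R4 k) ^ (N + M) * (a + b)
        = X i ^ M * (X i ^ N * a) + X i ^ N * (X i ^ M * b) := by ring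
    rw [h1]
    exact Ideal.add_mem _ (Ideal.mul_mem_left _ _ hN) (Ideal.mul_mem_left _ _ hM)
  smul_mem' := by
    intro c a ha i
    obtain ⟨N, hN⟩ := ha i
    refine ⟨N, ?_⟩
    have h1 : (X i : R4 k) ^ N * (c • a) = c * (X i ^ N * a) := by
      rw [smul_eq_mul]; ring
    rw [h1]
    exact Ideal.mul_mem_left _ _ hN

/-- The colon ideal `(I : J) = {r | r·J ⊆ I}`. -/
def icolon (I J : Ideal (R4 k)) : Ideal (R4 k) where
  carrier := {r | ∀ x ∈ J, r * x ∈ I}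
  zero_mem' := by
    intro x hx
    rw [zero_mul]; exact I.zero_mem
  add_mem' := by
    intro a b ha hb x hx
    rw [add_mul]
    exact Ideal.add_mem _ (ha x hx) (hb x hx)
  smul_mem' := by
    intro c a ha x hx
    rw [smul_eq_mul, mul_assoc]
    exact Ideal.mul_mem_left _ _ (ha x hx)

/-- A smooth cubic surface `X ⊂ ℙ³`: an irreducible homogeneous cubic form with
no singular zero (Jacobian criterion). -/
structure SmoothCubicSurface (k : Type) [Field k] : Type where
  f : MvPolynomial (Fin 4) k
  homog : f.IsHomogeneous 3
  irred : Irreducible f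
  smooth : ∀ v : Fin 4 → k, v ≠ 0 → eval v f = 0 →
    ∃ i : Fin 4, eval v (pderiv i f) ≠ 0

/-- A configuration of `t` distinct points lying on `X`. -/
def ConfigOn (S : SmoothCubicSurface k) {t : ℕ} (Z : Fin t → P3 k) : Prop :=
  Function.Injective Z ∧ ∀ i, VanishesAt k S.f (Z i)

/-- A configuration avoids the (closed locus of the) polynomial `g` on the
product of the affine cones: some choice of representatives does not annihilate `g`. -/
def Avoids {t : ℕ} (g : MvPolynomial (Fin t × Fin 4) k) (Z : Fin t → P3 k) : Prop :=
  ∃ v : Fin t → Fin 4 → k,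
    (∀ i, ∃ hv : v i ≠ 0, Projectivization.mk k (v i) hv = Z i) ∧
    eval (fun q : Fin t × Fin 4 => v q.1 q.2) g ≠ 0

/-- `P` holds for a *general* set of `t` points on `X`: it holds on a nonempty
(basic) Zariski-open subset of the family of all sets of `t` points of `X`. -/
def GeneralPointsSatisfy (S : SmoothCubicSurface k) (t : ℕ)
    (P : (Fin t → P3 k) → Prop) : Prop :=
  ∃ g : MvPolynomial (Fin t × Fin 4) k,
    (∃ Z : Fin t → P3 k, ConfigOn k S Z ∧ Avoids k g Z) ∧
    (∀ Z : Fin t → P3 k, ConfigOn k S Z → Avoids k g Z → P Z)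

/-- An admissible entry of a matrix in a graded **minimal** free resolution,
mapping a generator of degree `d` into a generator of degree `e`: the entry is
homogeneous of degree `d - e`, and it is not a nonzero scalar (zero constant
coefficient). -/
def EntryOk (d e : ℕ) (q : R4 k) : Prop :=
  (q = 0 ∨ ∃ c : ℕ, d = e + c ∧ q.IsHomogeneous c) ∧ coeff 0 q = 0

/-- Integer-degree version of `EntryOk` (for modules with generators of
arbitrary integer degrees). -/
def EntryOkZ (d e : ℤ) (q : R4 k) : Prop :=
  (q = 0 ∨ ∃ c : ℕ, d = e + (c : ℤ) ∧ q.IsHomogeneous c) ∧ coeff 0 q = 0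

/-- The body of a graded minimal free resolution of length 2 over `R` of the
`R`-module `I/J`:
`0 → ⊕ R(-d2 i) --M2--> ⊕ R(-d1 j) --g--> I/J → 0`.
The generators `g j ∈ I` are homogeneous of degree `d1 j` and generate `I` mod `J`;
`M2` is a homogeneous matrix with no nonzero scalar entries whose rows generate the
kernel, and which is injective. -/
def Res2Body (J I : Ideal (R4 k)) {n1 n2 : ℕ}
    (d1 : Fin n1 → ℕ) (d2 : Fin n2 → ℕ)
    (g : Fin n1 → R4 k) (M2 : Fin n2 → Fin n1 → R4 k) : Prop :=
  (∀ j, g j ∈ I ∧ (g j).IsHomogeneous (d1 j)) ∧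
  (∀ x ∈ I, ∃ w : Fin n1 → R4 k, x - ∑ j, w j * g j ∈ J) ∧
  (∀ i j, EntryOk k (d2 i) (d1 j) (M2 i j)) ∧
  (∀ w : Fin n1 → R4 k,
    ((∑ j, w j * g j) ∈ J) ↔ ∃ u : Fin n2 → R4 k, ∀ j, w j = ∑ i, u i * M2 i j) ∧
  (∀ u : Fin n2 → R4 k, (∀ j, (∑ i, u i * M2 i j) = 0) → u = 0)

/-- `I/J` has a graded minimal free resolution
`0 → ⊕ R(-d2 i) → ⊕ R(-d1 j) → I/J → 0` over `R`. -/
def HasMinFreeRes2 (J I : Ideal (R4 k)) {n1 n2 : ℕ}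
    (d1 : Fin n1 → ℕ) (d2 : Fin n2 → ℕ) : Prop :=
  ∃ (g : Fin n1 → R4 k) (M2 : Fin n2 → Fin n1 → R4 k), Res2Body k J I d1 d2 g M2

/-- The body of a graded minimal free resolution of length 3 over `R` of the
`R`-module `I/J`:
`0 → ⊕ R(-d3 l) --M3--> ⊕ R(-d2 i) --M2--> ⊕ R(-d1 j) --g--> I/J → 0`. -/
def Res3Body (J I : Ideal (R4 k)) {n1 n2 n3 : ℕ}
    (d1 : Fin n1 → ℕ) (d2 : Fin n2 → ℕ) (d3 : Fin n3 → ℕ)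
    (g : Fin n1 → R4 k) (M2 : Fin n2 → Fin n1 → R4 k)
    (M3 : Fin n3 → Fin n2 → R4 k) : Prop :=
  (∀ j, g j ∈ I ∧ (g j).IsHomogeneous (d1 j)) ∧
  (∀ x ∈ I, ∃ w : Fin n1 → R4 k, x - ∑ j, w j * g j ∈ J) ∧
  (∀ i j, EntryOk k (d2 i) (d1 j) (M2 i j)) ∧
  (∀ i j, EntryOk k (d3 i) (d2 j) (M3 i j)) ∧
  (∀ w : Fin n1 → R4 k,
    ((∑ j, w j * g j) ∈ J) ↔ ∃ u : Fin n2 → R4 k, ∀ j, w j = ∑ i, u i * M2 i j) ∧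
  (∀ u : Fin n2 → R4 k,
    (∀ j, (∑ i, u i * M2 i j) = 0) ↔ ∃ t : Fin n3 → R4 k, ∀ i, u i = ∑ l, t l * M3 l i) ∧
  (∀ t : Fin n3 → R4 k, (∀ i, (∑ l, t l * M3 l i) = 0) → t = 0)

/-- `I/J` has a graded minimal free resolution
`0 → ⊕ R(-d3 l) → ⊕ R(-d2 i) → ⊕ R(-d1 j) → I/J → 0` over `R`.
Taking `J = ⊥` this is a resolution of the ideal `I ⊆ R`; taking `J = (f)` it is a
resolution of `I/(f) ⊆ R_X = R/(f)`; taking `J = I_C` a resolution of `I/I_C`. -/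
def HasMinFreeRes3 (J I : Ideal (R4 k)) {n1 n2 n3 : ℕ}
    (d1 : Fin n1 → ℕ) (d2 : Fin n2 → ℕ) (d3 : Fin n3 → ℕ) : Prop :=
  ∃ (g : Fin n1 → R4 k) (M2 : Fin n2 → Fin n1 → R4 k) (M3 : Fin n3 → Fin n2 → R4 k),
    Res3Body k J I d1 d2 d3 g M2 M3

/-- The Betti numbers read off from a minimal free resolution
`0 → F₃ → F₂ → F₁ → I_Z → 0` of the ideal of `Z` (so that
`F_i = ⊕_j R(-i-j)^{b_{i,j}}` in the resolution of `R/I_Z`, with `F₀ = R`). -/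
def bettiCount {n1 n2 n3 : ℕ} (d1 : Fin n1 → ℕ) (d2 : Fin n2 → ℕ) (d3 : Fin n3 → ℕ)
    (i j : ℕ) : ℕ :=
  if i = 0 then (if j = 0 then 1 else 0)
  else if i = 1 then (Finset.univ.filter fun l => d1 l = 1 + j).card
  else if i = 2 then (Finset.univ.filter fun l => d2 l = 2 + j).card
  else if i = 3 then (Finset.univ.filter fun l => d3 l = 3 + j).card
  else 0

/-- The Hilbert polynomial `P_X(t) = (3/2)t(t+1) + 1` of the cubic surface. -/
def PXcubic (t : ℕ) : ℕ := 3 * (t * (t + 1) / 2) + 1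

/-- The saturated homogeneous ideal of an integral curve lying on `X`. -/
def IsCurveIdealOn (S : SmoothCubicSurface k) (I : Ideal (R4 k)) : Prop :=
  IsHomogIdeal k I ∧ I.IsPrime ∧ S.f ∈ I ∧
    ringKrullDim (R4 k ⧸ I) = ((2 : ℕ∞) : WithBot ℕ∞)

/-- The Jacobian criterion at a point of the cone: some 2×2 minor of the Jacobian
matrix of elements of `I` is nonzero, i.e. the curve is smooth there. -/
def CurveSmoothAt (I : Ideal (R4 k)) (v : Fin 4 → k) : Prop :=
  ∃ g₁ ∈ I, ∃ g₂ ∈ I, ∃ i j : Fin 4,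
    eval v (pderiv i g₁) * eval v (pderiv j g₂)
      - eval v (pderiv j g₁) * eval v (pderiv i g₂) ≠ 0

/-- A smooth (integral) curve on `X`. -/
def IsSmoothCurveIdealOn (S : SmoothCubicSurface k) (I : Ideal (R4 k)) : Prop :=
  IsCurveIdealOn k S I ∧
  ∀ v : Fin 4 → k, v ≠ 0 → (∀ g ∈ I, eval v g = 0) → CurveSmoothAt k I v

/-- The coordinate ring `R/I` of a curve has depth 2 (a regular sequence of two
positive-degree homogeneous elements), i.e. the curve is arithmetically
Cohen–Macaulay. -/
def IsACMIdeal (I : Ideal (R4 k)) : Prop :=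
  ∃ r₁ r₂ : R4 k,
    (∃ d₁ : ℕ, 0 < d₁ ∧ r₁.IsHomogeneous d₁) ∧
    (∃ d₂ : ℕ, 0 < d₂ ∧ r₂.IsHomogeneous d₂) ∧
    (∀ x : R4 k, r₁ * x ∈ I → x ∈ I) ∧
    (∀ x : R4 k, r₂ * x ∈ I ⊔ Ideal.span {r₁} → x ∈ I ⊔ Ideal.span {r₁})

/-- The Hilbert function `t ↦ dim_k (R/I)_t`. -/
def hilbFn (I : Ideal (R4 k)) (t : ℕ) : ℕ :=
  Module.finrank k ↥(homogeneousSubmodule (Fin 4) k t) -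
    Module.finrank k ↥(homogeneousSubmodule (Fin 4) k t ⊓
      Submodule.restrictScalars k I)

/-- The subscheme with saturated ideal `I` has degree `d` and (arithmetic) genus `g`,
read off from the Hilbert polynomial `P(t) = d·t + 1 - g`. -/
def HasDegreeGenus (I : Ideal (R4 k)) (d : ℕ) (g : ℤ) : Prop :=
  ∃ N : ℕ, ∀ t : ℕ, N ≤ t → (hilbFn k I t : ℤ) = d * t + 1 - g

/-- Linear equivalence of divisors on `X`: the divisor with (divisorial) ideal `I`
is linearly equivalent to (divisor of `J`) + `a·H`, where `H` is the hyperplane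
class.  Concretely, there are homogeneous forms `q, p` with `deg p = deg q + a`,
nonzero on `X`, with `q·I = p·J` in `R_X = R/(f)`.  (Taking `J = ⊤` expresses
that the divisor of `I` is linearly equivalent to `aH`.) -/
def LinEquivOnX (S : SmoothCubicSurface k) (I J : Ideal (R4 k)) (a : ℤ) : Prop :=
  ∃ (mq mp : ℕ) (q p : R4 k), (mp : ℤ) = (mq : ℤ) + a ∧
    q.IsHomogeneous mq ∧ p.IsHomogeneous mp ∧
    q ∉ Ideal.span {S.f} ∧ p ∉ Ideal.span {S.f} ∧
    Ideal.span {q} * I ⊔ Ideal.span {S.f} = Ideal.span {p} * J ⊔ Ideal.span {S.f}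

/-- Linear equivalence, on the curve `C` with ideal `IC`, of the divisor with
ideal `IG` to `r·H_C` (`H_C` the hyperplane section of `C`): there are homogeneous
forms `q, p`, nonzero on `C`, with `deg p = deg q + r` and `q·I_{G,C} = (p)` in
`R/I_C`. -/
def DivOnCurveEquivH (IC IG : Ideal (R4 k)) (r : ℤ) : Prop :=
  ∃ (mq mp : ℕ) (q p : R4 k), (mp : ℤ) = (mq : ℤ) + r ∧
    q.IsHomogeneous mq ∧ p.IsHomogeneous mp ∧ q ∉ IC ∧ p ∉ IC ∧
    Ideal.span {q} * IG ⊔ IC = Ideal.span {p} ⊔ IC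

/-- The saturated homogeneous ideal of a zero-dimensional subscheme of `ℙ³`. -/
def IsZeroDimIdeal (I : Ideal (R4 k)) : Prop :=
  IsHomogIdeal k I ∧ satIdeal k I = I ∧
    ringKrullDim (R4 k ⧸ I) = ((1 : ℕ∞) : WithBot ℕ∞)

/-- An arithmetically Gorenstein zero-dimensional subscheme of `ℙ³`: its ideal has a
graded minimal free resolution of length 3 whose last free module has rank one. -/
def IsAGPointsIdeal (I : Ideal (R4 k)) : Prop :=
  IsZeroDimIdeal k I ∧
  ∃ (n1 n2 : ℕ) (d1 : Fin n1 → ℕ) (d2 : Fin n2 → ℕ) (s : ℕ),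
    HasMinFreeRes3 k ⊥ I d1 d2 (fun _ : Fin 1 => s)

/-- `V₁` and `V₂` are directly Gorenstein linked by the arithmetically Gorenstein
scheme with ideal `IG`: `I_G ⊆ I_{V₁} ∩ I_{V₂}`, `I_G : I_{V₁} = I_{V₂}` and
`I_G : I_{V₂} = I_{V₁}`. -/
def IsGLinked (IG I1 I2 : Ideal (R4 k)) : Prop :=
  IG ≤ I1 ⊓ I2 ∧ icolon k IG I1 = I2 ∧ icolon k IG I2 = I1

/-- The divisor `G` (with ideal `IG`) on the curve `C ⊂ X` (with ideal `IC`) is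
linearly equivalent to `m·H_C - K_C`.  By adjunction on the cubic surface
(`K_X = -H`) this says `G + C|_C ∼ (m+1)·H_C` on `C`, where `C|_C` is realized as
the scheme-theoretic intersection `C ∩ C'` with any curve `C' ∼ C`, `C' ≠ C`,
chosen disjoint from `G`. -/
def EquivHminusKC (S : SmoothCubicSurface k) (IC IG : Ideal (R4 k)) (m : ℤ) : Prop :=
  ∃ IC' : Ideal (R4 k), IsCurveIdealOn k S IC' ∧ IC' ≠ IC ∧
    LinEquivOnX k S IC' IC 0 ∧
    satIdeal k (satIdeal k (IC ⊔ IC') ⊔ IG) = ⊤ ∧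
    DivOnCurveEquivH k IC (IG ⊓ satIdeal k (IC ⊔ IC')) (m + 1)

/-- A line on `X`: a smooth integral curve of degree 1, genus 0 on `X`. -/
def IsLineOn (S : SmoothCubicSurface k) (I : Ideal (R4 k)) : Prop :=
  IsSmoothCurveIdealOn k S I ∧ HasDegreeGenus k I 1 0

/-- A smooth conic on `X`: a smooth integral curve of degree 2, genus 0 on `X`. -/
def IsConicOn (S : SmoothCubicSurface k) (I : Ideal (R4 k)) : Prop :=
  IsSmoothCurveIdealOn k S I ∧ HasDegreeGenus k I 2 0

/-- A twisted cubic on `X`: a smooth integral curve of degree 3, genus 0 on `X`. -/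
def IsTwistedCubicOn (S : SmoothCubicSurface k) (I : Ideal (R4 k)) : Prop :=
  IsSmoothCurveIdealOn k S I ∧ HasDegreeGenus k I 3 0

/-- The curve `C ⊂ X` moves in a linear system of (projective) dimension `dim`,
i.e. `h⁰(O_X(C)) = dim + 1`.  Global sections of `O_X(C)` are computed, for any
homogeneous `q ∈ I_C` of degree `s` not divisible by `f`, as the degree-`s` part of
the colon ideal `((q, f) : I_C)` modulo `(f)`. -/
def MovesInLinSysOfDim (S : SmoothCubicSurface k) (IC : Ideal (R4 k)) (dim : ℤ) : Prop :=
  ∀ (s : ℕ) (q : R4 k), q.IsHomogeneous s → q ∈ IC → q ∉ Ideal.span {S.f} →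
    (Module.finrank k ↥(homogeneousSubmodule (Fin 4) k s ⊓
        Submodule.restrictScalars k (icolon k (Ideal.span {q} ⊔ Ideal.span {S.f}) IC)) : ℤ)
      - (Module.finrank k ↥(homogeneousSubmodule (Fin 4) k s ⊓
        Submodule.restrictScalars k (icolon k (Ideal.span {q} ⊔ Ideal.span {S.f}) IC) ⊓
        Submodule.restrictScalars k (Ideal.span {S.f})) : ℤ) = dim + 1

/-- `I/(f₀)` is a maximal Cohen–Macaulay module over `R/(f₀)` (3-dimensional):
it admits a regular sequence of three positive-degree homogeneous elements. -/
def IsMCMQuotient (f0 : R4 k) (I : Ideal (R4 k)) : Prop :=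
  ∃ r₁ r₂ r₃ : R4 k,
    (∃ d : ℕ, 0 < d ∧ r₁.IsHomogeneous d) ∧
    (∃ d : ℕ, 0 < d ∧ r₂.IsHomogeneous d) ∧
    (∃ d : ℕ, 0 < d ∧ r₃.IsHomogeneous d) ∧
    (∀ x ∈ I, r₁ * x ∈ Ideal.span {f0} → x ∈ Ideal.span {f0}) ∧
    (∀ x ∈ I, r₂ * x ∈ Ideal.span {r₁} * I ⊔ Ideal.span {f0} →
      x ∈ Ideal.span {r₁} * I ⊔ Ideal.span {f0}) ∧
    (∀ x ∈ I, r₃ * x ∈ Ideal.span {r₁} * I ⊔ Ideal.span {r₂} * I ⊔ Ideal.span {f0} →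
      x ∈ Ideal.span {r₁} * I ⊔ Ideal.span {r₂} * I ⊔ Ideal.span {f0}) ∧
    (∃ x ∈ I, x ∉ Ideal.span {r₁} * I ⊔ Ideal.span {r₂} * I ⊔ Ideal.span {r₃} * I
      ⊔ Ideal.span {f0})

end

namespace CubicPoints

noncomputable section

section Forms

attribute [local instance] MvPolynomial.gradedAlgebra

variable {k : Type} [Field k]

/-- Forms of degree `d`. -/
abbrev Forms (k : Type) [Field k] (d : ℕ) : Submodule k (R4 k) := homogeneousSubmodule (Fin 4) k d

instance (d : ℕ) : FiniteDimensional k (Forms k d) :=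
  Module.Finite.iff_fg.2 (homogeneousSubmodule_fg (Fin 4) k d)

theorem finrank_forms (d : ℕ) : Module.finrank k (Forms k d) = (d + 3).choose 3 := by
  have h1 : {e : Fin 4 →₀ ℕ | e.degree = d} =
      ((Finset.univ : Finset (Fin 4)).finsuppAntidiag d : Set (Fin 4 →₀ ℕ)) := by
    ext e
    simp [Finset.mem_finsuppAntidiag, Finsupp.degree_eq_sum]
  rw [Forms, homogeneousSubmodule_eq_finsupp_supported, h1,
    (AddMonoidAlgebra.supportedEquivFinsupp _).finrank_eq]
  have h2 := Finset.card_finsuppAntidiag_nat_eq_choose (s := (Finset.univ : Finset (Fin 4))) d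
  rw [Module.finrank_finsupp_self, ← Nat.card_eq_fintype_card, Nat.card_coe_set_eq, Set.ncard_coe_finset, h2]
  simp only [Finset.card_univ, Fintype.card_fin]
  rw [show 4 + d - 1 = d + 3 by omega, ← Nat.choose_symm (by omega : 3 ≤ d + 3)]
  simp

theorem coe_decompose (p : R4 k) (n : ℕ) :
    (DirectSum.decompose (homogeneousSubmodule (Fin 4) k) p n : R4 k) = homogeneousComponent n p :=
  decomposition.decompose'_apply p n

theorem homogeneousComponent_mul_left {m : ℕ} {p : R4 k} (hp : p.IsHomogeneous m) (n : ℕ)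
    (q : R4 k) : homogeneousComponent (m + n) (p * q) = p * homogeneousComponent n q := by
  have := DirectSum.coe_decompose_mul_add_of_left_mem (homogeneousSubmodule (Fin 4) k) (i := m)
    (j := n) (a := p) (b := q) hp
  rwa [coe_decompose, coe_decompose] at this

theorem homogeneousComponent_mul_left_of_lt {m : ℕ} {p : R4 k} (hp : p.IsHomogeneous m) {n : ℕ}
    (hn : n < m) (q : R4 k) : homogeneousComponent n (p * q) = 0 := by
  have := DirectSum.coe_decompose_mul_of_left_mem_of_not_le (homogeneousSubmodule (Fin 4) k)
    (i := m) (n := n) (a := p) (b := q) hp (by omega)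
  rwa [coe_decompose] at this

theorem exists_form_of_dvd {m d : ℕ} {p g : R4 k} (hp : p.IsHomogeneous m)
    (hg : g.IsHomogeneous (m + d)) (h : p ∣ g) : ∃ q : R4 k, q.IsHomogeneous d ∧ g = p * q := by
  obtain ⟨q, rfl⟩ := h
  refine ⟨homogeneousComponent d q, homogeneousComponent_isHomogeneous _ _, ?_⟩
  rw [← homogeneousComponent_mul_left hp, homogeneousComponent_of_mem hg, if_pos rfl]

theorem eq_zero_of_dvd {m d : ℕ} {p g : R4 k} (hp : p.IsHomogeneous m)
    (hg : g.IsHomogeneous d) (hd : d < m) (h : p ∣ g) : g = 0 := by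
  obtain ⟨q, rfl⟩ := h
  have := homogeneousComponent_mul_left_of_lt hp hd q
  rwa [homogeneousComponent_of_mem hg, if_pos rfl] at this

theorem finrank_map_add_inf_ker {V W : Type*} [AddCommGroup V] [Module k V] [AddCommGroup W]
    [Module k W] (φ : V →ₗ[k] W) (U : Submodule k V) [FiniteDimensional k U] :
    Module.finrank k (U.map φ) + Module.finrank k (U ⊓ LinearMap.ker φ : Submodule k V) =
      Module.finrank k U := by
  rw [← LinearMap.finrank_range_add_finrank_ker (φ.domRestrict U), LinearMap.range_domRestrict,
    LinearMap.ker_domRestrict]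
  congr 1
  have : U ⊓ LinearMap.ker φ = ((LinearMap.ker φ).comap U.subtype).map U.subtype := by
    rw [Submodule.map_comap_subtype]
  rw [this]
  exact (Submodule.equivMapOfInjective U.subtype U.injective_subtype _).symm.finrank_eq

/-- Multiplication by a fixed polynomial, as a `k`-linear map. -/
abbrev mulBy (p : R4 k) : R4 k →ₗ[k] R4 k := LinearMap.mulLeft k p

theorem finrank_map_mulBy {p : R4 k} (hp : p ≠ 0) (U : Submodule k (R4 k)) :
    Module.finrank k (U.map (mulBy p)) = Module.finrank k U :=
  (Submodule.equivMapOfInjective (mulBy p) (mul_right_injective₀ hp) U).symm.finrank_eq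

/-- The degree `d` forms in the ideal generated by a form of degree `m`. -/
theorem forms_inf_span {m d : ℕ} {p : R4 k} (hp : p.IsHomogeneous m) :
    Forms k (m + d) ⊓ (Ideal.span {p}).restrictScalars k = (Forms k d).map (mulBy p) := by
  ext g
  simp only [Submodule.mem_inf, Submodule.restrictScalars_mem, Ideal.mem_span_singleton,
    Submodule.mem_map, LinearMap.mulLeft_apply]
  constructor
  · rintro ⟨h1, h2⟩
    obtain ⟨q, hq, rfl⟩ := exists_form_of_dvd hp h1 h2
    exact ⟨q, hq, rfl⟩
  · rintro ⟨q, hq, rfl⟩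
    exact ⟨hp.mul hq, dvd_mul_right _ _⟩

theorem finrank_forms_inf_span_cubic {f : R4 k} (hf : f.IsHomogeneous 3) (hf0 : f ≠ 0) (d : ℕ) :
    Module.finrank k
      (Forms k d ⊓ (Ideal.span {f}).restrictScalars k : Submodule k (R4 k)) = d.choose 3 := by
  rcases le_or_gt 3 d with h | h
  · obtain ⟨e, rfl⟩ := Nat.exists_eq_add_of_le h
    rw [forms_inf_span hf, finrank_map_mulBy hf0, finrank_forms, add_comm]
  · rw [Nat.choose_eq_zero_of_lt h, Submodule.finrank_eq_zero]
    rw [eq_bot_iff]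
    rintro g ⟨h1, h2⟩
    exact eq_zero_of_dvd hf h1 h (Ideal.mem_span_singleton.1 h2)

/-- The quotient map `R → R/(p)`, as a `k`-linear map. -/
abbrev mkq (p : R4 k) : R4 k →ₗ[k] R4 k ⧸ Ideal.span {p} :=
  (Ideal.Quotient.mkₐ k (Ideal.span {p})).toLinearMap

theorem ker_mkq (p : R4 k) : LinearMap.ker (mkq p) = (Ideal.span {p}).restrictScalars k := by
  ext x
  simp [Ideal.Quotient.eq_zero_iff_mem]

theorem mkq_eq_zero {p x : R4 k} : mkq p x = 0 ↔ p ∣ x := by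
  rw [← LinearMap.mem_ker, ker_mkq, Submodule.restrictScalars_mem, Ideal.mem_span_singleton]

/-- The ideal of all polynomials vanishing on a set of vectors. -/
def van (Z : Set (Fin 4 → k)) : Ideal (R4 k) where
  carrier := {q | ∀ z ∈ Z, eval z q = 0}
  zero_mem' := by simp
  add_mem' := by
    intro p q hp hq z hz
    simp [hp z hz, hq z hz]
  smul_mem' := by
    intro c q hq z hz
    simp [hq z hz]

theorem mem_van {Z : Set (Fin 4 → k)} {q : R4 k} : q ∈ van Z ↔ ∀ z ∈ Z, eval z q = 0 := Iff.rfl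

/-- The forms of degree `d` vanishing on a set of vectors. -/
abbrev vanForms (Z : Set (Fin 4 → k)) (d : ℕ) : Submodule k (R4 k) :=
  Forms k d ⊓ (van Z).restrictScalars k

theorem finrank_forms_map_mkq {f : R4 k} (hf : f.IsHomogeneous 3) (hf0 : f ≠ 0) (d : ℕ) :
    Module.finrank k ((Forms k d).map (mkq f)) + d.choose 3 = (d + 3).choose 3 := by
  rw [← finrank_forms (k := k) d, ← finrank_map_add_inf_ker (mkq f) (Forms k d), ker_mkq,
    finrank_forms_inf_span_cubic hf hf0]

theorem finrank_vanForms_map_mkq {f : R4 k} (hf : f.IsHomogeneous 3) (hf0 : f ≠ 0)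
    {Z : Set (Fin 4 → k)} (hZ : ∀ z ∈ Z, eval z f = 0) (d : ℕ) :
    Module.finrank k ((vanForms Z d).map (mkq f)) + d.choose 3 =
      Module.finrank k (vanForms Z d) := by
  rw [← finrank_map_add_inf_ker (mkq f) (vanForms Z d), ker_mkq,
    ← finrank_forms_inf_span_cubic hf hf0 d]
  suffices h : vanForms Z d ⊓ (Ideal.span {f}).restrictScalars k =
      Forms k d ⊓ (Ideal.span {f}).restrictScalars k by rw [h]
  ext x
  simp only [Submodule.mem_inf, Submodule.restrictScalars_mem, Ideal.mem_span_singleton, mem_van]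
  constructor
  · exact fun h => ⟨h.1.1, h.2⟩
  · refine fun h => ⟨⟨h.1, fun z hz => ?_⟩, h.2⟩
    obtain ⟨q, rfl⟩ := h.2
    simp [hZ z hz]

theorem aeval_smul_of_isHomogeneous {A : Type} [CommRing A] [Algebra k A] {d : ℕ} {q : R4 k}
    (hq : q.IsHomogeneous d) (c : A) (v : Fin 4 → A) : aeval (c • v) q = c ^ d * aeval v q := by
  rw [aeval_def, aeval_def, eval₂_eq', eval₂_eq', Finset.mul_sum]
  refine Finset.sum_congr rfl fun e he => ?_
  have h1 : ∑ i, e i = d := by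
    rw [← Finsupp.degree_eq_sum, Finsupp.degree_eq_weight_one]
    exact hq (mem_support_iff.1 he)
  simp only [Pi.smul_apply, smul_eq_mul, mul_pow, Finset.prod_mul_distrib,
    Finset.prod_pow_eq_pow_sum, h1]
  ring

theorem eval_smul_of_isHomogeneous {d : ℕ} {q : R4 k} (hq : q.IsHomogeneous d) (c : k)
    (v : Fin 4 → k) : eval (c • v) q = c ^ d * eval v q := by
  simpa [aeval_eq_eval] using aeval_smul_of_isHomogeneous hq c v

end Forms

section Coordinates

variable {k : Type} [Field k]

/-- The linear form with coefficient vector `c`. -/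
def lin (c : Fin 4 → k) : R4 k := ∑ j, C (c j) * X j

theorem lin_isHomogeneous (c : Fin 4 → k) : (lin c).IsHomogeneous 1 :=
  IsHomogeneous.sum _ _ _ fun j _ => isHomogeneous_C_mul_X (c j) j

theorem eval_lin (c v : Fin 4 → k) : eval v (lin c) = c ⬝ᵥ v := by
  simp [lin, dotProduct]

theorem isHomogeneous_aeval_lin {P : Matrix (Fin 4) (Fin 4) k} {d : ℕ} {q : R4 k}
    (hq : q.IsHomogeneous d) : (aeval (fun i => lin (P i)) q).IsHomogeneous d := by
  simpa using hq.aeval (n := 1) (fun i => lin (P i)) (fun i => lin_isHomogeneous (P i))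

theorem aeval_lin_comp (P Q : Matrix (Fin 4) (Fin 4) k) (h : P * Q = 1) :
    (aeval (fun i => lin (Q i)) : R4 k →ₐ[k] R4 k).comp (aeval fun i => lin (P i)) =
      AlgHom.id k _ := by
  ext1 i
  have h1 : ∀ l, ∑ j, P i j * Q j l = (1 : Matrix (Fin 4) (Fin 4) k) i l := fun l => by
    rw [← h, Matrix.mul_apply]
  simp only [AlgHom.comp_apply, aeval_X, lin, map_sum, map_mul, AlgHom.id_apply, Finset.mul_sum]
  rw [Finset.sum_comm]
  have h2 : ∀ l, ∑ j, (aeval fun i => ∑ j, C (Q i j) * X j) (C (P i j)) * (C (Q j l) * X l) =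
      C ((1 : Matrix (Fin 4) (Fin 4) k) i l) * (X l : R4 k) := fun l => by
    rw [← h1 l, map_sum, Finset.sum_mul]
    refine Finset.sum_congr rfl fun j _ => ?_
    rw [algHom_C, algebraMap_eq, C_mul, mul_assoc]
  simp only [h2, Matrix.one_apply]
  simp

/-- An invertible matrix gives a graded linear change of coordinates. -/
theorem exists_coordinateChange (P Q : Matrix (Fin 4) (Fin 4) k) (h : P * Q = 1) :
    ∃ σ : R4 k ≃ₐ[k] R4 k, (∀ i, σ (X i) = lin (P i)) ∧
      (∀ (q : R4 k) (d : ℕ), q.IsHomogeneous d → (σ q).IsHomogeneous d) ∧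
      (∀ (q : R4 k) (d : ℕ), q.IsHomogeneous d → (σ.symm q).IsHomogeneous d) ∧
      ∀ (v : Fin 4 → k) (q : R4 k), eval v (σ q) = eval (P.mulVec v) q := by
  refine ⟨AlgEquiv.ofAlgHom (aeval fun i => lin (P i)) (aeval fun i => lin (Q i))
    (aeval_lin_comp Q P (mul_eq_one_comm.1 h)) (aeval_lin_comp P Q h),
    fun i => by simp, fun q d hq => isHomogeneous_aeval_lin hq,
    fun q d hq => isHomogeneous_aeval_lin hq, fun v q => ?_⟩
  have h2 : ((aeval v : R4 k →ₐ[k] k).comp (aeval fun i => lin (P i))) =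
      aeval (P.mulVec v) := by
    ext1 i
    simp only [AlgHom.comp_apply, aeval_X, aeval_eq_eval, eval_lin]
    rfl
  have := DFunLike.congr_fun h2 q
  simpa [aeval_eq_eval] using this

/-- The variables, indexed by natural numbers. -/
abbrev var (k : Type) [Field k] (i : ℕ) : R4 k := X (Fin.ofNat 4 i)

/-- Setting the first `i` variables to zero. -/
def kill (i : ℕ) : R4 k →ₐ[k] R4 k := aeval fun n : Fin 4 => if (n : ℕ) < i then 0 else X n

theorem kill_var {i j : ℕ} (hj : j < i) (hi : i ≤ 4) : kill i (var k j) = 0 := by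
  have : j % 4 = j := Nat.mod_eq_of_lt (by omega)
  simp [kill, this, hj]

theorem kill_var_self {i : ℕ} (hi : i < 4) : kill i (var k i) = var k i := by
  have : i % 4 = i := Nat.mod_eq_of_lt (by omega)
  simp [kill, this]

theorem exists_eq_kill_add {i : ℕ} (q : R4 k) :
    ∃ w : ℕ → R4 k, q = kill i q + ∑ j ∈ Finset.range i, var k j * w j := by
  induction q using MvPolynomial.induction_on with
  | C a => exact ⟨0, by simp [kill]⟩
  | add p q hp hq =>
    obtain ⟨w, hw⟩ := hp
    obtain ⟨w', hw'⟩ := hq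
    refine ⟨w + w', ?_⟩
    simp only [map_add, Pi.add_apply, mul_add, Finset.sum_add_distrib]
    linear_combination hw + hw'
  | mul_X p n hp =>
    obtain ⟨w, hw⟩ := hp
    rcases lt_or_ge (n : ℕ) i with h | h
    · refine ⟨Pi.single (n : ℕ) p, ?_⟩
      have h1 : kill i (X n : R4 k) = 0 := by simp [kill, h]
      rw [map_mul, h1, Finset.sum_eq_single (n : ℕ)]
      · simp [mul_comm]
      · intro b _ hb
        simp [Pi.single_eq_of_ne hb]
      · intro h2
        exact absurd (Finset.mem_range.2 h) h2
    · refine ⟨fun j => w j * X n, ?_⟩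
      have h1 : kill i (X n : R4 k) = X n := by simp [kill, not_lt.2 h]
      rw [map_mul, h1]
      conv_lhs => rw [hw]
      rw [add_mul, Finset.sum_mul]
      simp [mul_assoc]

theorem kill_sum {i : ℕ} (hi : i ≤ 4) (w : ℕ → R4 k) :
    kill i (∑ j ∈ Finset.range i, var k j * w j) = 0 := by
  rw [map_sum]
  refine Finset.sum_eq_zero fun j hj => ?_
  rw [map_mul, kill_var (Finset.mem_range.1 hj) hi, zero_mul]

theorem exists_of_kill_eq {i : ℕ} {q r : R4 k} (h : kill i q = kill i r) :
    ∃ w : ℕ → R4 k, q = r + ∑ j ∈ Finset.range i, var k j * w j := by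
  obtain ⟨w, hw⟩ := exists_eq_kill_add (i := i) q
  obtain ⟨w', hw'⟩ := exists_eq_kill_add (i := i) r
  refine ⟨w - w', ?_⟩
  simp only [Pi.sub_apply, mul_sub, Finset.sum_sub_distrib]
  linear_combination hw - hw' + h

theorem var_regular {i : ℕ} (hi : i < 4) {u : R4 k} {w : ℕ → R4 k}
    (h : var k i * u = ∑ j ∈ Finset.range i, var k j * w j) :
    ∃ w' : ℕ → R4 k, u = ∑ j ∈ Finset.range i, var k j * w' j := by
  have h1 := congrArg (kill i) h
  rw [kill_sum hi.le, map_mul, kill_var_self hi] at h1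
  have h2 := (mul_eq_zero.1 h1).resolve_left (X_ne_zero _)
  obtain ⟨w', hw'⟩ := exists_of_kill_eq (i := i) (q := u) (r := 0) (by rw [h2, map_zero])
  exact ⟨w', by rw [hw', zero_add]⟩

theorem kill_three {d : ℕ} {q : R4 k} (hq : q.IsHomogeneous d) :
    kill 3 q = X 3 ^ d * C (eval (Pi.single 3 1) q) := by
  let e : Fin 4 → k := Pi.single 3 1
  have h := aeval_smul_of_isHomogeneous hq (X 3 : R4 k) (fun j => algebraMap k (R4 k) (e j))
  have h1 : (kill 3 : R4 k →ₐ[k] R4 k) =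
      aeval ((X 3 : R4 k) • fun j => algebraMap k (R4 k) (e j)) := by
    apply algHom_ext
    intro j
    rw [kill, aeval_X, aeval_X, Pi.smul_apply, smul_eq_mul]
    fin_cases j <;> simp [e]
  have h2 : aeval (fun j => algebraMap k (R4 k) (e j)) q = C (eval e q) := by
    have h3 : (aeval (fun j => algebraMap k (R4 k) (e j)) : R4 k →ₐ[k] R4 k) =
        (Algebra.ofId k (R4 k)).comp (aeval e) := by
      apply algHom_ext
      intro j
      rw [AlgHom.comp_apply, aeval_X, aeval_X, Algebra.ofId_apply]
    rw [h3, AlgHom.comp_apply, Algebra.ofId_apply, aeval_eq_eval]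
    rfl
  rw [h1, h, h2]

theorem eval_kill {i : ℕ} (hi : i ≤ 3) (q : R4 k) :
    eval (Pi.single 3 1) (kill i q) = eval (Pi.single 3 1) q := by
  have h2 : ((aeval (Pi.single 3 1) : R4 k →ₐ[k] k).comp (kill i)) =
      aeval (Pi.single 3 1) := by
    ext1 j
    simp only [AlgHom.comp_apply, aeval_X, kill]
    split_ifs with h
    · rw [map_zero, Pi.single_eq_of_ne]
      rintro rfl
      simp at h
      omega
    · simp
  have := DFunLike.congr_fun h2 q
  simpa [aeval_eq_eval] using this

theorem var_regular_mod {f : R4 k} (hf : eval (Pi.single 3 1) f ≠ 0) {i : ℕ} (hi : i < 3)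
    {u c : R4 k} {w : ℕ → R4 k}
    (h : var k i * u = ∑ j ∈ Finset.range i, var k j * w j + f * c) :
    ∃ (w' : ℕ → R4 k) (c' : R4 k), u = ∑ j ∈ Finset.range i, var k j * w' j + f * c' := by
  have h1 := congrArg (kill i) h
  rw [map_add, kill_sum (by omega), map_mul, map_mul, kill_var_self (by omega), zero_add] at h1
  have h2 : ¬ var k i ∣ kill i f := by
    rintro ⟨b, hb⟩
    apply hf
    rw [← eval_kill hi.le, hb, map_mul, eval_X, Pi.single_eq_of_ne, zero_mul]
    intro h3
    have := congrArg Fin.val h3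
    simp at this
    omega
  obtain ⟨b, hb⟩ := ((X_prime.dvd_or_dvd ⟨_, h1.symm⟩).resolve_left h2)
  have h3 : kill i u = kill i f * b := by
    apply mul_left_cancel₀ (X_ne_zero (R := k) (Fin.ofNat 4 i))
    linear_combination h1 + kill i f * hb
  have h4 : kill i b = b := by
    have h5 := congrArg (kill i) hb
    have h6 : ∀ q : R4 k, kill i (kill i q) = kill i q := by
      intro q
      obtain ⟨w, hw⟩ := exists_eq_kill_add (i := i) q
      have := congrArg (kill i) hw
      rw [map_add, kill_sum (by omega), add_zero] at this
      exact this.symm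
    rw [h6, map_mul, kill_var_self (by omega), hb] at h5
    exact (mul_left_cancel₀ (X_ne_zero (R := k) (Fin.ofNat 4 i)) h5).symm
  obtain ⟨w', hw'⟩ := exists_of_kill_eq (i := i) (q := u) (r := f * b)
    (by rw [h3, map_mul, h4])
  exact ⟨w', b, by rw [hw', add_comm]⟩

theorem exists_of_three_le {f : R4 k} (hf3 : f.IsHomogeneous 3)
    (hf : eval (Pi.single 3 1) f ≠ 0) {d : ℕ} {u : R4 k} (hu : u.IsHomogeneous (3 + d)) :
    ∃ (w' : ℕ → R4 k) (c' : R4 k), u = ∑ j ∈ Finset.range 3, var k j * w' j + f * c' := by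
  obtain ⟨w, hw⟩ := exists_of_kill_eq (i := 3) (q := u)
    (r := f * (C (eval (Pi.single 3 1) u / eval (Pi.single 3 1) f) * X 3 ^ d)) (by
      rw [map_mul, kill_three hu, kill_three hf3, map_mul, map_pow]
      have h1 : kill 3 (X 3 : R4 k) = X 3 := by simp [kill]
      rw [h1, kill, algHom_C, algebraMap_eq]
      rw [show eval (Pi.single 3 1) u =
        eval (Pi.single 3 1) f * (eval (Pi.single 3 1) u / eval (Pi.single 3 1) f) by
          field_simp, C_mul]
      rw [mul_div_cancel_left₀ _ hf]
      ring)
  exact ⟨w, _, by rw [hw, add_comm]⟩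

theorem exists_sum_var {d : ℕ} {u : R4 k} (hu : u.IsHomogeneous (d + 1)) :
    ∃ w : ℕ → R4 k, u = ∑ j ∈ Finset.range 4, var k j * w j := by
  obtain ⟨w, hw⟩ := exists_of_kill_eq (i := 4) (q := u) (r := 0) (by
    have h1 : (kill 4 : R4 k →ₐ[k] R4 k) = aeval ((0 : R4 k) • (0 : Fin 4 → R4 k)) := by
      ext1 j
      simp [kill]
    rw [map_zero, h1, aeval_smul_of_isHomogeneous hu]
    simp)
  exact ⟨w, by rw [hw, zero_add]⟩

end Coordinates

section Generic

variable {k : Type} [Field k]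

theorem exists_eval_ne_zero [Infinite k] {σ : Type*} {p : MvPolynomial σ k} (hp : p ≠ 0) :
    ∃ v, eval v p ≠ 0 := by
  by_contra! h
  exact hp (MvPolynomial.funext fun v => by rw [h v, map_zero])

theorem exists_forall_eval_ne_zero [Infinite k] {σ ι : Type*} (s : Finset ι)
    (p : ι → MvPolynomial σ k) (h : ∀ i ∈ s, p i ≠ 0) : ∃ v, ∀ i ∈ s, eval v (p i) ≠ 0 := by
  obtain ⟨v, hv⟩ := exists_eval_ne_zero (Finset.prod_ne_zero_iff.2 h)
  rw [map_prod] at hv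
  exact ⟨v, Finset.prod_ne_zero_iff.1 hv⟩

theorem lin_ne_zero {c : Fin 4 → k} (hc : c ≠ 0) : lin c ≠ 0 := by
  obtain ⟨i, hi⟩ := Function.ne_iff.1 hc
  intro h
  have := eval_lin c (Pi.single i 1)
  rw [h] at this
  simp at this
  exact hi this.symm

theorem det_updateRow_one (i : Fin 4) (c : Fin 4 → k) :
    ((1 : Matrix (Fin 4) (Fin 4) k).updateRow i c).det = c i := by
  rw [← Matrix.cramer_transpose_apply, Matrix.transpose_one, Matrix.cramer_one]
  rfl

theorem exists_matrix_row {c : Fin 4 → k} (hc : c ≠ 0) (i : Fin 4) :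
    ∃ P Q : Matrix (Fin 4) (Fin 4) k, P * Q = 1 ∧ P i = c := by
  obtain ⟨l, hl⟩ := Function.ne_iff.1 hc
  let M := (1 : Matrix (Fin 4) (Fin 4) k).updateRow l c
  let P := M.submatrix (Equiv.swap i l) id
  have hP : IsUnit P.det := by
    rw [Matrix.det_permute, det_updateRow_one, isUnit_iff_ne_zero]
    refine mul_ne_zero ?_ hl
    rcases Int.units_eq_one_or (Equiv.Perm.sign (Equiv.swap i l)) with h | h <;> simp [h]
  refine ⟨P, P⁻¹, Matrix.mul_nonsing_inv P hP, ?_⟩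
  ext j
  simp [P, M]

theorem exists_matrix_mulVec {e : Fin 4 → k} (he : e ≠ 0) (i : Fin 4) :
    ∃ P Q : Matrix (Fin 4) (Fin 4) k, P * Q = 1 ∧ P.mulVec e = Pi.single i 1 := by
  obtain ⟨P, Q, h, hP⟩ := exists_matrix_row he i
  have h1 : Q.transpose * P.transpose = 1 := by
    rw [← Matrix.transpose_mul, h, Matrix.transpose_one]
  refine ⟨Q.transpose, P.transpose, h1, ?_⟩
  have h2 : P.transpose.mulVec (Pi.single i 1) = e := by
    ext j
    simp [← hP]
  rw [← h2, Matrix.mulVec_mulVec, h1, Matrix.one_mulVec]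

/-- Linear forms `y₀, …, y₃` forming a regular sequence such that `y₀, y₁, y₂` remains one
modulo the cubic form `f`. -/
structure IsGoodSeq (f : R4 k) (y : ℕ → R4 k) : Prop where
  hom : ∀ i, (y i).IsHomogeneous 1
  regular : ∀ i < 4, ∀ (u : R4 k) (w : ℕ → R4 k), y i * u = ∑ j ∈ Finset.range i, y j * w j →
    ∃ w' : ℕ → R4 k, u = ∑ j ∈ Finset.range i, y j * w' j
  regular_mod : ∀ i < 3, ∀ (u c : R4 k) (w : ℕ → R4 k),
    y i * u = ∑ j ∈ Finset.range i, y j * w j + f * c →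
    ∃ (w' : ℕ → R4 k) (c' : R4 k), u = ∑ j ∈ Finset.range i, y j * w' j + f * c'
  cover_mod : ∀ (d : ℕ) (u : R4 k), u.IsHomogeneous (3 + d) →
    ∃ (w' : ℕ → R4 k) (c' : R4 k), u = ∑ j ∈ Finset.range 3, y j * w' j + f * c'
  cover : ∀ (d : ℕ) (u : R4 k), u.IsHomogeneous (d + 1) →
    ∃ w : ℕ → R4 k, u = ∑ j ∈ Finset.range 4, y j * w j

theorem isGoodSeq_of_coordinates {f : R4 k} (hf : f.IsHomogeneous 3) {e : Fin 4 → k}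
    (he : eval e f ≠ 0) {P Q : Matrix (Fin 4) (Fin 4) k} (h : P * Q = 1)
    (hP : P.mulVec e = Pi.single 3 1) : IsGoodSeq f fun i => lin (P (Fin.ofNat 4 i)) := by
  obtain ⟨σ, h1, h2, h3, h4⟩ := exists_coordinateChange P Q h
  have hf' : eval (Pi.single 3 1) (σ.symm f) ≠ 0 := by
    rw [← hP, ← h4, AlgEquiv.apply_symm_apply]
    exact he
  have key : ∀ i, lin (P (Fin.ofNat 4 i)) = σ (var k i) := fun i => (h1 _).symm
  have key' : ∀ i, σ.symm (lin (P (Fin.ofNat 4 i))) = var k i := fun i => by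
    rw [key, AlgEquiv.symm_apply_apply]
  refine ⟨fun i => lin_isHomogeneous _, fun i hi u w hw => ?_, fun i hi u c w hw => ?_,
    fun d u hu => ?_, fun d u hu => ?_⟩
  · obtain ⟨w', hw'⟩ := var_regular hi (u := σ.symm u) (w := fun j => σ.symm (w j)) (by
      simpa only [map_mul, map_sum, key'] using congrArg σ.symm hw)
    refine ⟨fun j => σ (w' j), ?_⟩
    simpa only [map_mul, map_sum, ← key, AlgEquiv.apply_symm_apply] using congrArg σ hw'
  · obtain ⟨w', c', hw'⟩ := var_regular_mod hf' hi (u := σ.symm u) (c := σ.symm c)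
      (w := fun j => σ.symm (w j)) (by
      simpa only [map_add, map_mul, map_sum, key'] using congrArg σ.symm hw)
    refine ⟨fun j => σ (w' j), σ c', ?_⟩
    simpa only [map_add, map_mul, map_sum, ← key, AlgEquiv.apply_symm_apply] using congrArg σ hw'
  · obtain ⟨w', c', hw'⟩ := exists_of_three_le (h3 f 3 hf) hf' (h3 u _ hu)
    refine ⟨fun j => σ (w' j), σ c', ?_⟩
    simpa only [map_add, map_mul, map_sum, ← key, AlgEquiv.apply_symm_apply] using congrArg σ hw'
  · obtain ⟨w', hw'⟩ := exists_sum_var (h3 u _ hu)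
    refine ⟨fun j => σ (w' j), ?_⟩
    simpa only [map_mul, map_sum, ← key, AlgEquiv.apply_symm_apply] using congrArg σ hw'

theorem exists_isGoodSeq [Infinite k] {f : R4 k} (hf : f.IsHomogeneous 3) (hf0 : f ≠ 0)
    (Z : Finset (Fin 4 → k)) (hZ : ∀ z ∈ Z, z ≠ 0 ∧ eval z f = 0) :
    ∃ y : ℕ → R4 k, IsGoodSeq f y ∧ ∀ z ∈ Z, eval z (y 0) ≠ 0 := by
  obtain ⟨e, he⟩ := exists_eval_ne_zero hf0
  have he0 : e ≠ 0 := by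
    rintro rfl
    have := eval_smul_of_isHomogeneous hf 0 (0 : Fin 4 → k)
    simp at this
    exact he (by simpa using this)
  obtain ⟨P, Q, h, hP⟩ := exists_matrix_mulVec he0 3
  have hQ : Q * P = 1 := mul_eq_one_comm.1 h
  let b : (Fin 4 → k) → Fin 4 → k := fun z => Function.update (P.mulVec z) 3 0
  have hb : ∀ z ∈ Z, b z ≠ 0 := by
    intro z hz h0
    have h1 : P.mulVec z = P.mulVec (P.mulVec z 3 • e) := by
      rw [Matrix.mulVec_smul, hP]
      ext j
      by_cases hj : j = 3
      · subst hj; simp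
      · have := congrFun h0 j
        simpa [b, hj] using this
    have h2 : z = P.mulVec z 3 • e := by
      have := congrArg Q.mulVec h1
      rwa [Matrix.mulVec_mulVec, Matrix.mulVec_mulVec, hQ, Matrix.one_mulVec,
        Matrix.one_mulVec] at this
    have h3 := (hZ z hz).2
    rw [h2, eval_smul_of_isHomogeneous hf] at h3
    have h4 := pow_eq_zero_iff (by norm_num) |>.1 ((mul_eq_zero.1 h3).resolve_right he)
    rw [h4, zero_smul] at h2
    exact (hZ z hz).1 h2
  classical
  obtain ⟨c, hc⟩ := exists_forall_eval_ne_zero (insert (Pi.single 0 1) (Z.image b)) lin (by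
    intro x hx
    apply lin_ne_zero
    rcases Finset.mem_insert.1 hx with rfl | hx
    · intro h0
      simpa using congrFun h0 0
    · obtain ⟨z, hz, rfl⟩ := Finset.mem_image.1 hx
      exact hb z hz)
  have hc0 : c 0 ≠ 0 := by
    simpa [eval_lin] using hc (Pi.single 0 1) (Finset.mem_insert_self _ _)
  let D := (1 : Matrix (Fin 4) (Fin 4) k).updateRow 0 (Function.update c 3 0)
  have hD : IsUnit D.det := by
    rw [det_updateRow_one, isUnit_iff_ne_zero]
    simpa using hc0
  have hDP : (D * P) * (Q * D⁻¹) = 1 := by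
    rw [Matrix.mul_assoc, ← Matrix.mul_assoc P, h, Matrix.one_mul, Matrix.mul_nonsing_inv D hD]
  have hDe : (D * P).mulVec e = Pi.single 3 1 := by
    rw [← Matrix.mulVec_mulVec, hP]
    ext j
    rw [Matrix.mulVec_single_one]
    fin_cases j <;> simp [D]
  refine ⟨_, isGoodSeq_of_coordinates hf he hDP hDe, fun z hz => ?_⟩
  have h5 := hc (b z) (Finset.mem_insert_of_mem (Finset.mem_image_of_mem b hz))
  have h6 : eval z (lin ((D * P) (Fin.ofNat 4 0))) = (D * P).mulVec z 0 := eval_lin _ _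
  rw [h6, ← Matrix.mulVec_mulVec]
  rw [eval_lin] at h5
  convert h5 using 1
  simp [D, b, Matrix.mulVec, dotProduct, Fin.sum_univ_four, mul_comm]

end Generic

section Koszul

variable {k R N N' : Type*} [Field k] [CommRing R] [AddCommGroup N] [Module k N] [Module R N]
  [AddCommGroup N'] [Module k N'] [Module R N']

/-- `y₀, …, y_{n-1}` is a regular sequence on the graded pieces `M`, with elements of degree
`e + 1` written using coefficients of degree `e`. -/
def RegularIn (y : ℕ → R) (n : ℕ) (M : ℕ → Submodule k N) (e : ℕ) : Prop :=
  ∀ i < n, ∀ u ∈ M (e + 1), ∀ w : ℕ → N, (∀ j, w j ∈ M (e + 1)) →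
    y i • u = ∑ j ∈ Finset.range i, y j • w j →
    ∃ w' : ℕ → N, (∀ j, w' j ∈ M e) ∧ u = ∑ j ∈ Finset.range i, y j • w' j

/-- First Koszul homology of `y₀, …, y_{n-1}` vanishes in the given degree. -/
def KoszulExact (y : ℕ → R) (n : ℕ) (M : ℕ → Submodule k N) (e : ℕ) : Prop :=
  ∀ w : ℕ → N, (∀ j, w j ∈ M (e + 1)) → ∑ j ∈ Finset.range n, y j • w j = 0 →
    ∃ s : ℕ → ℕ → N, (∀ j l, s j l ∈ M e) ∧ (∀ j l, s j l = -s l j) ∧ (∀ j, s j j = 0) ∧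
      ∀ j < n, w j = ∑ l ∈ Finset.range n, y l • s j l

theorem RegularIn.koszulExact {y : ℕ → R} {n : ℕ} {M : ℕ → Submodule k N} {e : ℕ}
    (hy : ∀ i x, x ∈ M e → y i • x ∈ M (e + 1))
    (h : RegularIn y n M e) : ∀ i ≤ n, KoszulExact y i M e := by
  intro i
  induction i with
  | zero => exact fun _ w _ _ => ⟨0, by simp, by simp, by simp, by simp⟩
  | succ i ih =>
    intro hi w hw h0
    rw [Finset.sum_range_succ] at h0
    obtain ⟨w', hw', hwi⟩ := h i hi (w i) (hw i) (fun j => -w j) (fun j => neg_mem (hw j)) (by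
      simp only [smul_neg, Finset.sum_neg_distrib]
      exact eq_neg_of_add_eq_zero_right h0)
    obtain ⟨s, hs, hskew, hdiag, hws⟩ := ih (by omega) (fun j => w j + y i • w' j)
      (fun j => add_mem (hw j) (hy _ _ (hw' j))) (by
        rw [hwi, Finset.smul_sum, ← Finset.sum_add_distrib] at h0
        rw [← h0]
        refine Finset.sum_congr rfl fun j _ => ?_
        rw [smul_add, smul_comm])
    refine ⟨fun j l => if j < i ∧ l < i then s j l else if j = i ∧ l < i then w' l else
      if l = i ∧ j < i then -w' j else 0, fun j l => ?_, fun j l => ?_, fun j => ?_,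
      fun j hj => ?_⟩
    · dsimp only
      split_ifs
      exacts [hs j l, hw' l, neg_mem (hw' j), zero_mem _]
    · dsimp only
      split_ifs <;> first | omega | simp | exact hskew j l
    · dsimp only
      split_ifs <;> first | omega | rfl | exact hdiag j
    · rw [Finset.sum_range_succ]
      rcases Nat.lt_succ_iff_lt_or_eq.1 hj with hj | rfl
      · rw [Finset.sum_congr rfl (g := fun l => y l • s j l) fun l hl => by
          dsimp only
          rw [if_pos ⟨hj, Finset.mem_range.1 hl⟩], ← hws j hj]
        simp [hj, hj.ne]
      · rw [Finset.sum_congr rfl (g := fun l => y l • w' l) fun l hl => by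
          dsimp only
          rw [if_neg (by omega), if_pos ⟨rfl, Finset.mem_range.1 hl⟩]]
        simp [hwi]

theorem sum_skew_eq_zero (y : ℕ → R) (n : ℕ) (s : ℕ → ℕ → N) (hs : ∀ j l, s j l = -s l j)
    (hd : ∀ j, s j j = 0) :
    ∑ j ∈ Finset.range n, y j • ∑ l ∈ Finset.range n, y l • s j l = 0 := by
  induction n with
  | zero => simp
  | succ n ih =>
    simp only [Finset.sum_range_succ, smul_add, Finset.sum_add_distrib, ih, hd, smul_zero,
      add_zero, zero_add]
    rw [Finset.smul_sum, ← Finset.sum_add_distrib]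
    refine Finset.sum_eq_zero fun j _ => ?_
    rw [hs n j, smul_comm (y n), smul_neg, smul_neg]
    simp

theorem exists_mem_ker_of_koszulExact {y : ℕ → R} {n : ℕ} {F : ℕ → Submodule k N'}
    {M : ℕ → Submodule k N} {e : ℕ} (φ : N' →ₗ[R] N)
    (hy : ∀ i x, x ∈ F e → y i • x ∈ F (e + 1)) (hφ : ∀ x ∈ F (e + 1), φ x ∈ M (e + 1))
    (hsurj : ∀ x ∈ M e, ∃ p ∈ F e, φ p = x) (h : KoszulExact y n M e) {w : ℕ → N'}
    (hw : ∀ j, w j ∈ F (e + 1)) (h0 : φ (∑ j ∈ Finset.range n, y j • w j) = 0) :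
    ∃ w' : ℕ → N', (∀ j < n, w' j ∈ F (e + 1) ∧ φ (w' j) = 0) ∧
      ∑ j ∈ Finset.range n, y j • w j = ∑ j ∈ Finset.range n, y j • w' j := by
  obtain ⟨s, hs, hskew, hdiag, hws⟩ := h (fun j => φ (w j)) (fun j => hφ _ (hw j)) (by
    simpa only [map_sum, map_smul] using h0)
  choose p hp hps using fun j l => hsurj (s j l) (hs j l)
  let T : ℕ → ℕ → N' := fun j l => if j < l then p j l else if l < j then -p l j else 0
  have hT : ∀ j l, T j l ∈ F e := by
    intro j l
    dsimp only [T]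
    split_ifs
    exacts [hp j l, neg_mem (hp l j), zero_mem _]
  have hφT : ∀ j l, φ (T j l) = s j l := by
    intro j l
    dsimp only [T]
    split_ifs with h1 h2
    · exact hps j l
    · rw [map_neg, hps, ← hskew]
    · rw [map_zero, show l = j by omega, hdiag]
  refine ⟨fun j => w j - ∑ l ∈ Finset.range n, y l • T j l, fun j hj =>
    ⟨sub_mem (hw j) (sum_mem fun l _ => hy _ _ (hT j l)), ?_⟩, ?_⟩
  · simp only [map_sub, map_sum, map_smul, hφT, ← hws j hj, sub_self]
  · simp only [smul_sub, Finset.sum_sub_distrib]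
    rw [sum_skew_eq_zero y n T, sub_zero]
    · intro j l
      dsimp only [T]
      split_ifs <;> first | omega | simp
    · intro j
      simp [T]

/-- Graded pieces of a kernel. -/
def kerPieces [SMul k R] [IsScalarTower k R N] [IsScalarTower k R N'] (F : ℕ → Submodule k N')
    (φ : N' →ₗ[R] N) (e : ℕ) : Submodule k N' := F e ⊓ (LinearMap.ker φ).restrictScalars k

section

variable [SMul k R] [IsScalarTower k R N] [IsScalarTower k R N'] {y : ℕ → R} {n : ℕ}
  {F : ℕ → Submodule k N'} {M : ℕ → Submodule k N} {e : ℕ} (φ : N' →ₗ[R] N)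
  (hyF : ∀ e i x, x ∈ F e → y i • x ∈ F (e + 1)) (hyM : ∀ e i x, x ∈ M e → y i • x ∈ M (e + 1))
  (hφ : ∀ x ∈ F (e + 1), φ x ∈ M (e + 1)) (hsurj : ∀ x ∈ M e, ∃ p ∈ F e, φ p = x)
  (hM : RegularIn y n M e)

include hyF hyM hφ hsurj hM

theorem RegularIn.kerPieces (hF : RegularIn y n F (e + 1)) :
    RegularIn y n (kerPieces F φ) (e + 1) := by
  intro i hi u hu w hw huw
  obtain ⟨w', hw', rfl⟩ := hF i hi u hu.1 w (fun j => (hw j).1) huw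
  obtain ⟨w'', hw'', h⟩ := exists_mem_ker_of_koszulExact φ (hyF e) hφ hsurj
    (hM.koszulExact (hyM e) i hi.le) hw' hu.2
  refine ⟨fun j => if j < i then w'' j else 0, fun j => ?_, ?_⟩
  · dsimp only
    split_ifs with hj
    exacts [hw'' j hj, zero_mem _]
  · rw [h]
    refine Finset.sum_congr rfl fun j hj => ?_
    dsimp only
    rw [if_pos (Finset.mem_range.1 hj)]

theorem kerPieces_generated (hgen : ∀ u ∈ F (e + 2), ∃ w : ℕ → N', (∀ j, w j ∈ F (e + 1)) ∧
      u = ∑ j ∈ Finset.range n, y j • w j) {u : N'} (hu : u ∈ CubicPoints.kerPieces F φ (e + 2)) :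
    ∃ w : ℕ → N', (∀ j, w j ∈ CubicPoints.kerPieces F φ (e + 1)) ∧
      u = ∑ j ∈ Finset.range n, y j • w j := by
  obtain ⟨w', hw', rfl⟩ := hgen u hu.1
  obtain ⟨w'', hw'', h⟩ := exists_mem_ker_of_koszulExact φ (hyF e) hφ hsurj
    (hM.koszulExact (hyM e) n le_rfl) hw' hu.2
  refine ⟨fun j => if j < n then w'' j else 0, fun j => ?_, ?_⟩
  · dsimp only
    split_ifs with hj
    exacts [hw'' j hj, zero_mem _]
  · rw [h]
    refine Finset.sum_congr rfl fun j hj => ?_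
    dsimp only
    rw [if_pos (Finset.mem_range.1 hj)]

end

end Koszul

section Free

variable {k : Type} [Field k]

/-- The degree `e` piece of `R(-d)`. -/
def shiftedForms (k : Type) [Field k] (d e : ℕ) : Submodule k (R4 k) :=
  if d ≤ e then Forms k (e - d) else ⊥

theorem mem_shiftedForms {d e : ℕ} {q : R4 k} :
    q ∈ shiftedForms k d e ↔ q = 0 ∨ ∃ c, e = d + c ∧ q.IsHomogeneous c := by
  unfold shiftedForms
  split_ifs with h
  · constructor
    · intro hq
      exact Or.inr ⟨e - d, by omega, hq⟩
    · rintro (rfl | ⟨c, rfl, hq⟩)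
      · exact zero_mem _
      · rwa [Nat.add_sub_cancel_left]
  · rw [Submodule.mem_bot]
    constructor
    · exact Or.inl
    · rintro (rfl | ⟨c, rfl, -⟩)
      · rfl
      · omega

theorem mem_shiftedForms_add {d c : ℕ} {q : R4 k} :
    q ∈ shiftedForms k d (d + c) ↔ q.IsHomogeneous c := by
  rw [shiftedForms, if_pos (by omega), Nat.add_sub_cancel_left]
  rfl

theorem eq_zero_of_mem_shiftedForms {d e : ℕ} (h : e < d) {q : R4 k}
    (hq : q ∈ shiftedForms k d e) : q = 0 := by
  rwa [shiftedForms, if_neg (by omega)] at hq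

theorem finrank_shiftedForms_add (d c : ℕ) :
    Module.finrank k (shiftedForms k d (d + c)) = (c + 3).choose 3 := by
  rw [shiftedForms, if_pos (by omega), Nat.add_sub_cancel_left, finrank_forms]

instance (d e : ℕ) : FiniteDimensional k (shiftedForms k d e) := by
  by_cases h : d ≤ e
  · rw [shiftedForms, if_pos h]
    infer_instance
  · rw [shiftedForms, if_neg h]
    infer_instance

theorem mul_mem_shiftedForms {y : R4 k} (hy : y.IsHomogeneous 1) {d e : ℕ} {q : R4 k}
    (hq : q ∈ shiftedForms k d e) : y * q ∈ shiftedForms k d (e + 1) := by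
  rw [mem_shiftedForms] at hq ⊢
  rcases hq with rfl | ⟨c, rfl, hq⟩
  · exact Or.inl (mul_zero _)
  · exact Or.inr ⟨1 + c, by omega, hy.mul hq⟩

/-- The graded pieces of the free module `⊕ R(-d j)`. -/
def freePieces (k : Type) [Field k] {n : ℕ} (d : Fin n → ℕ) (e : ℕ) : Submodule k (Fin n → R4 k) :=
  Submodule.pi Set.univ fun j => shiftedForms k (d j) e

variable {n : ℕ} {d : Fin n → ℕ}

theorem mem_freePieces {e : ℕ} {w : Fin n → R4 k} :
    w ∈ freePieces k d e ↔ ∀ j, w j ∈ shiftedForms k (d j) e := by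
  simp [freePieces, Submodule.mem_pi]

/-- The pieces of a free module as products. -/
def freePiecesEquiv (d : Fin n → ℕ) (e : ℕ) :
    freePieces k d e ≃ₗ[k] (∀ j, shiftedForms k (d j) e) where
  toFun w j := ⟨w.1 j, mem_freePieces.1 w.2 j⟩
  map_add' _ _ := rfl
  map_smul' _ _ := rfl
  invFun w := ⟨fun j => (w j).1, mem_freePieces.2 fun j => (w j).2⟩
  left_inv _ := rfl
  right_inv _ := rfl

instance (e : ℕ) : FiniteDimensional k (freePieces k d e) :=
  (freePiecesEquiv d e).symm.finiteDimensional

theorem finrank_freePieces (d : Fin n → ℕ) (e : ℕ) : Module.finrank k (freePieces k d e) =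
    ∑ j, Module.finrank k (shiftedForms k (d j) e) := by
  rw [(freePiecesEquiv d e).finrank_eq, Module.finrank_pi_fintype]

theorem finrank_freePieces_const (n m c : ℕ) :
    Module.finrank k (freePieces k (fun _ : Fin n => m) (m + c)) = n * (c + 3).choose 3 := by
  simp [finrank_freePieces, finrank_shiftedForms_add]

theorem smul_mem_freePieces {y : R4 k} (hy : y.IsHomogeneous 1) {e : ℕ} {w : Fin n → R4 k}
    (hw : w ∈ freePieces k d e) : y • w ∈ freePieces k d (e + 1) :=
  mem_freePieces.2 fun j => mul_mem_shiftedForms hy (mem_freePieces.1 hw j)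

/-- Taking the degree `e` part. -/
theorem homogeneousComponent_sum_mul {i : ℕ} {y : ℕ → R4 k} (hy : ∀ j, (y j).IsHomogeneous 1)
    (w : ℕ → R4 k) (e : ℕ) :
    homogeneousComponent (e + 1) (∑ j ∈ Finset.range i, y j * w j) =
      ∑ j ∈ Finset.range i, y j * homogeneousComponent e (w j) := by
  rw [map_sum]
  refine Finset.sum_congr rfl fun j _ => ?_
  rw [add_comm, homogeneousComponent_mul_left (hy j)]

theorem IsGoodSeq.exists_shiftedForms {f : R4 k} {y : ℕ → R4 k} (hy : IsGoodSeq f y) {i : ℕ}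
    (hi : i < 4) {d e : ℕ} {u : R4 k} (hu : u ∈ shiftedForms k d (e + 1)) {w : ℕ → R4 k}
    (h : y i * u = ∑ j ∈ Finset.range i, y j * w j) :
    ∃ w' : ℕ → R4 k, (∀ j, w' j ∈ shiftedForms k d e) ∧
      u = ∑ j ∈ Finset.range i, y j * w' j := by
  rcases mem_shiftedForms.1 hu with rfl | ⟨c, hc, huc⟩
  · exact ⟨0, fun j => zero_mem _, by simp⟩
  · obtain ⟨w', hw'⟩ := hy.regular i hi u w h
    rcases c with _ | c
    · refine ⟨0, fun j => zero_mem _, ?_⟩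
      have h1 : homogeneousComponent 0 u = u := by rw [homogeneousComponent_of_mem huc, if_pos rfl]
      rw [← h1, hw', map_sum]
      simp only [Pi.zero_apply, mul_zero, Finset.sum_const_zero]
      exact Finset.sum_eq_zero fun j _ =>
        homogeneousComponent_mul_left_of_lt (hy.hom j) Nat.zero_lt_one _
    · obtain rfl : e = d + c := by omega
      refine ⟨fun j => homogeneousComponent c (w' j), fun j =>
        mem_shiftedForms_add.2 (homogeneousComponent_isHomogeneous _ _), ?_⟩
      rw [← homogeneousComponent_sum_mul hy.hom, ← hw', homogeneousComponent_of_mem huc, if_pos rfl]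

theorem IsGoodSeq.regularIn_freePieces {f : R4 k} {y : ℕ → R4 k} (hy : IsGoodSeq f y)
    (d : Fin n → ℕ) (e : ℕ) : RegularIn y 4 (freePieces k d) e := by
  intro i hi u hu w hw h
  have h1 : ∀ l, y i * u l = ∑ j ∈ Finset.range i, y j * w j l := fun l => by
    have := congrFun h l
    simpa [Finset.sum_apply] using this
  choose w' hw' hu' using fun l =>
    hy.exists_shiftedForms hi (mem_freePieces.1 hu l) (h1 l)
  refine ⟨fun j l => w' l j, fun j => mem_freePieces.2 fun l => hw' l j, ?_⟩
  ext1 l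
  rw [hu' l]
  simp [Finset.sum_apply]

theorem IsGoodSeq.exists_freePieces {f : R4 k} {y : ℕ → R4 k} (hy : IsGoodSeq f y)
    {e : ℕ} (hd : ∀ j, d j ≤ e) {u : Fin n → R4 k} (hu : u ∈ freePieces k d (e + 1)) :
    ∃ w : ℕ → Fin n → R4 k, (∀ j, w j ∈ freePieces k d e) ∧
      u = ∑ j ∈ Finset.range 4, y j • w j := by
  have h1 : ∀ l, ∃ w' : ℕ → R4 k, (∀ j, w' j ∈ shiftedForms k (d l) e) ∧
      u l = ∑ j ∈ Finset.range 4, y j * w' j := by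
    intro l
    obtain ⟨c, rfl⟩ := Nat.exists_eq_add_of_le (hd l)
    have hul : (u l).IsHomogeneous (c + 1) :=
      mem_shiftedForms_add.1 (by simpa [add_assoc] using mem_freePieces.1 hu l)
    obtain ⟨w', hw'⟩ := hy.cover c (u l) hul
    refine ⟨fun j => homogeneousComponent c (w' j), fun j =>
      mem_shiftedForms_add.2 (homogeneousComponent_isHomogeneous _ _), ?_⟩
    rw [← homogeneousComponent_sum_mul hy.hom, ← hw', homogeneousComponent_of_mem hul, if_pos rfl]
  choose w' hw' hu' using h1
  refine ⟨fun j l => w' l j, fun j => mem_freePieces.2 fun l => hw' l j, ?_⟩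
  ext1 l
  rw [hu' l]
  simp [Finset.sum_apply]

/-- The degree `e` component of an element of `⊕ R(-d j)`. -/
def freeComponent (d : Fin n → ℕ) (e : ℕ) (w : Fin n → R4 k) : Fin n → R4 k :=
  fun j => if d j ≤ e then homogeneousComponent (e - d j) (w j) else 0

theorem freeComponent_mem (d : Fin n → ℕ) (e : ℕ) (w : Fin n → R4 k) :
    freeComponent d e w ∈ freePieces k d e := by
  refine mem_freePieces.2 fun j => mem_shiftedForms.2 ?_
  unfold freeComponent
  split_ifs with h
  · exact Or.inr ⟨e - d j, by omega, homogeneousComponent_isHomogeneous _ _⟩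
  · exact Or.inl rfl

theorem exists_sum_freeComponent (d : Fin n → ℕ) (w : Fin n → R4 k) :
    ∃ N, w = ∑ e ∈ Finset.range N, freeComponent d e w := by
  have h1 : ∀ j, ∃ N, ∀ N' ≥ N, w j = ∑ e ∈ Finset.range N', freeComponent d e w j := by
    intro j
    refine ⟨d j + ((w j).totalDegree + 1), fun N' hN' => ?_⟩
    obtain ⟨m, rfl⟩ := Nat.exists_eq_add_of_le hN'
    rw [Finset.sum_range_add, Finset.sum_range_add]
    rw [Finset.sum_eq_zero (s := Finset.range (d j))]
    · rw [Finset.sum_eq_zero (s := Finset.range m)]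
      · conv_lhs => rw [← sum_homogeneousComponent (w j)]
        rw [zero_add, add_zero]
        refine Finset.sum_congr rfl fun e _ => ?_
        simp [freeComponent]
      · intro e _
        rw [freeComponent, if_pos (by omega), homogeneousComponent_eq_zero]
        omega
    · intro e he
      rw [freeComponent, if_neg]
      have := Finset.mem_range.1 he
      omega
  choose N hN using h1
  refine ⟨∑ j, N j, ?_⟩
  ext1 j
  rw [Finset.sum_apply]
  exact hN j _ (Finset.single_le_sum (f := N) (fun _ _ => Nat.zero_le _) (Finset.mem_univ j))

theorem sum_freeComponent_mul {δ : ℕ} {g : Fin n → R4 k}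
    (hg : ∀ j, g j ∈ shiftedForms k δ (d j)) (e : ℕ) (w : Fin n → R4 k) :
    ∑ j, freeComponent d e w j * g j =
      if δ ≤ e then homogeneousComponent (e - δ) (∑ j, w j * g j) else 0 := by
  have h1 : ∀ j, freeComponent d e w j * g j =
      if δ ≤ e then homogeneousComponent (e - δ) (w j * g j) else 0 := by
    intro j
    rcases mem_shiftedForms.1 (hg j) with h | ⟨c, hc, hgc⟩
    · simp [h]
    · unfold freeComponent
      rw [hc]
      by_cases he : δ + c ≤ e
      · rw [if_pos he, if_pos (by omega), show e - δ = c + (e - (δ + c)) by omega, mul_comm (w j),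
          homogeneousComponent_mul_left hgc, mul_comm]
      · rw [if_neg he, zero_mul]
        split_ifs with hδ
        · rw [mul_comm, homogeneousComponent_mul_left_of_lt hgc (by omega)]
        · rfl
  rw [Finset.sum_congr rfl fun j _ => h1 j]
  split_ifs
  · rw [map_sum]
  · simp

variable {N : Type*} [AddCommGroup N] [Module (R4 k) N]

/-- The map `⊕ R(-d j) → N` determined by the images of the generators. -/
abbrev comb (r : Fin n → N) : (Fin n → R4 k) →ₗ[R4 k] N := Fintype.linearCombination (R4 k) r

theorem comb_apply (r : Fin n → N) (w : Fin n → R4 k) : comb r w = ∑ j, w j • r j := rfl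

variable [Module k N] [IsScalarTower k (R4 k) N]

theorem C_smul (c : k) (x : N) : (C c : R4 k) • x = c • x := by
  rw [← algebraMap_eq, algebraMap_smul]

/-- A graded family generated in degree `m`, where its dimension is `n`, is the image of
`R(-m)^n`. -/
theorem exists_generators {y : ℕ → R4 k} (hy : ∀ i, (y i).IsHomogeneous 1)
    (K : ℕ → Submodule k N) (m n : ℕ) (hfin : FiniteDimensional k (K m))
    (hn : Module.finrank k (K m) = n) (h0 : ∀ e < m, K e = ⊥)
    (hgen : ∀ e ≥ m, ∀ u ∈ K (e + 1), ∃ w : ℕ → N, (∀ j, w j ∈ K e) ∧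
      u = ∑ j ∈ Finset.range 4, y j • w j) :
    ∃ r : Fin n → N, (∀ i, r i ∈ K m) ∧
      (∀ e, ∀ x ∈ K e, ∃ p ∈ freePieces k (fun _ : Fin n => m) e, comb r p = x) ∧
      (∀ e ≤ m, ∀ p ∈ freePieces k (fun _ : Fin n => m) e, comb r p = 0 → p = 0) := by
  let b := Module.finBasisOfFinrankEq k (K m) hn
  refine ⟨fun i => b i, fun i => (b i).2, fun e => ?_, fun e he p hp h => ?_⟩
  · rcases lt_or_ge e m with h | h
    · intro x hx
      rw [h0 e h, Submodule.mem_bot] at hx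
      exact ⟨0, zero_mem _, by rw [map_zero, hx]⟩
    · induction e, h using Nat.le_induction with
      | base =>
        intro x hx
        refine ⟨fun i => C (b.repr ⟨x, hx⟩ i), mem_freePieces.2 fun i =>
          mem_shiftedForms.2 (Or.inr ⟨0, rfl, isHomogeneous_C _ _⟩), ?_⟩
        have h2 := congrArg Subtype.val (b.sum_repr ⟨x, hx⟩)
        rw [comb_apply]
        simpa only [C_smul, Submodule.coe_sum, Submodule.coe_smul] using h2
      | succ e h ih =>
        intro x hx
        obtain ⟨w, hw, rfl⟩ := hgen e h x hx
        choose p hp hpw using fun j => ih (w j) (hw j)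
        refine ⟨∑ j ∈ Finset.range 4, y j • p j, sum_mem fun j _ =>
          smul_mem_freePieces (hy j) (hp j), ?_⟩
        simp only [map_sum, map_smul, hpw]
  · rcases he.lt_or_eq with he | rfl
    · ext1 i
      exact eq_zero_of_mem_shiftedForms he (mem_freePieces.1 hp i)
    · have h1 : ∀ i, p i = C (coeff 0 (p i)) := fun i => by
        have := (mem_shiftedForms_add (k := k) (d := e) (c := 0)).1 (mem_freePieces.1 hp i)
        rw [← totalDegree_zero_iff_isHomogeneous] at this
        exact totalDegree_eq_zero_iff_eq_C.1 this
      have h2 : ∑ i, coeff 0 (p i) • b i = 0 := by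
        apply Subtype.ext
        rw [comb_apply, Finset.sum_congr rfl fun i _ => by rw [h1 i]] at h
        simpa only [C_smul, Submodule.coe_sum, Submodule.coe_smul, ZeroMemClass.coe_zero] using h
      ext1 i
      rw [h1 i, Fintype.linearIndependent_iff.1 b.linearIndependent _ h2 i]
      simp

/-- If the kernel of a map from a graded free module is graded and its pieces are spanned by
`r`, then the kernel is spanned by `r`. -/
theorem exists_eq_comb_of_ker {φ : (Fin n → R4 k) →ₗ[R4 k] N}
    (hφ : ∀ w, φ w = 0 → ∀ e, φ (freeComponent d e w) = 0) {n' : ℕ} {r : Fin n' → Fin n → R4 k}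
    (hr : ∀ e, ∀ x ∈ kerPieces (freePieces k d) φ e, ∃ p : Fin n' → R4 k, comb r p = x) {w : Fin n → R4 k}
    (hw : φ w = 0) : ∃ p : Fin n' → R4 k, comb r p = w := by
  choose p hp using fun e => hr e (freeComponent d e w) ⟨freeComponent_mem d e w, hφ w hw e⟩
  obtain ⟨N, hN⟩ := exists_sum_freeComponent d w
  refine ⟨∑ e ∈ Finset.range N, p e, ?_⟩
  rw [map_sum]
  exact (Finset.sum_congr rfl fun e _ => hp e).trans hN.symm

theorem finrank_kerPieces {φ : (Fin n → R4 k) →ₗ[R4 k] N} {M : ℕ → Submodule k N} {e : ℕ}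
    (hφ : ∀ x ∈ freePieces k d e, φ x ∈ M e) (hs : ∀ x ∈ M e, ∃ p ∈ freePieces k d e, φ p = x) :
    Module.finrank k (M e) + Module.finrank k (kerPieces (freePieces k d) φ e) =
      Module.finrank k (freePieces k d e) := by
  rw [← finrank_map_add_inf_ker (φ.restrictScalars k) (freePieces k d e)]
  have : (freePieces k d e).map (φ.restrictScalars k) = M e := by
    ext x
    constructor
    · rintro ⟨p, hp, rfl⟩
      exact hφ p hp
    · intro hx
      obtain ⟨p, hp, rfl⟩ := hs x hx
      exact ⟨p, hp, rfl⟩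
  rw [this]
  rfl

end Free

section Pieces

variable {k : Type} [Field k]

theorem mkq_mul (f y u : R4 k) : mkq f (y * u) = y • mkq f u := by
  rw [← smul_eq_mul]
  rfl

theorem mkq_eq_mkq {f u w : R4 k} : mkq f u = mkq f w ↔ f ∣ u - w := by
  rw [← mkq_eq_zero, map_sub, sub_eq_zero]

theorem mkq_sum_mul {ι : Type*} (f : R4 k) (s : Finset ι) (y u : ι → R4 k) :
    mkq f (∑ j ∈ s, y j * u j) = ∑ j ∈ s, y j • mkq f (u j) := by
  rw [map_sum]
  exact Finset.sum_congr rfl fun j _ => mkq_mul f _ _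

theorem pow_mul_mem_vanForms {Z : Set (Fin 4 → k)} {y u : R4 k} (hy : y.IsHomogeneous 1) {e : ℕ}
    (hu : u ∈ vanForms Z e) (c : ℕ) : y ^ c * u ∈ vanForms Z (e + c) := by
  refine ⟨?_, Ideal.mul_mem_left _ _ hu.2⟩
  have := (hy.pow c).mul hu.1
  rwa [one_mul, add_comm] at this

/-- The graded pieces of the ideal of `Z` in the coordinate ring of the surface `f = 0`. -/
abbrev pieces (f : R4 k) (Z : Set (Fin 4 → k)) (d : ℕ) : Submodule k (R4 k ⧸ Ideal.span {f}) :=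
  (vanForms Z d).map (mkq f)

theorem mul_mem_vanForms {Z : Set (Fin 4 → k)} {y u : R4 k} (hy : y.IsHomogeneous 1) {e : ℕ}
    (hu : u ∈ vanForms Z e) : y * u ∈ vanForms Z (e + 1) := by
  refine ⟨?_, Ideal.mul_mem_left _ _ hu.2⟩
  rw [add_comm]
  exact hy.mul hu.1

theorem smul_mem_pieces {f : R4 k} {Z : Set (Fin 4 → k)} {y : R4 k} (hy : y.IsHomogeneous 1)
    {e : ℕ} {x : R4 k ⧸ Ideal.span {f}} (hx : x ∈ pieces f Z e) : y • x ∈ pieces f Z (e + 1) := by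
  obtain ⟨u, hu, rfl⟩ := hx
  exact ⟨y * u, mul_mem_vanForms hy hu, mkq_mul _ _ _⟩

/-- A collection of points on the cubic surface `f = 0` which imposes independent conditions on
forms of degree `a` and whose ideal has no linear syzygies in degree `a`. -/
structure IsGenericConfig (f : R4 k) (y : ℕ → R4 k) {p : ℕ} (v : Fin p → Fin 4 → k) (a : ℕ) :
    Prop where
  homog : f.IsHomogeneous 3
  prime : Prime f
  good : IsGoodSeq f y
  on : ∀ i, eval (v i) f = 0
  y0 : ∀ i, eval (v i) (y 0) ≠ 0
  surj : ∀ c : Fin p → k, ∃ q ∈ Forms k a, ∀ i, eval (v i) q = c i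
  inj : ∀ g : Fin 4 → R4 k, (∀ i, g i ∈ vanForms (Set.range v) a) → f ∣ ∑ i, X i * g i →
    ∀ i, f ∣ g i

variable {f : R4 k} {y : ℕ → R4 k} {p : ℕ} {v : Fin p → Fin 4 → k} {a : ℕ}

namespace IsGenericConfig

variable (h : IsGenericConfig f y v a)

include h

theorem exists_form_eval {d : ℕ} (hd : a ≤ d) (c : Fin p → k) :
    ∃ q ∈ Forms k d, ∀ i, eval (v i) q = c i := by
  induction d, hd using Nat.le_induction generalizing c with
  | base => exact h.surj c
  | succ d hd ih =>
    obtain ⟨q, hq, hqc⟩ := ih fun i => (eval (v i) (y 0))⁻¹ * c i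
    refine ⟨y 0 * q, ?_, fun i => ?_⟩
    · rw [add_comm]
      exact (h.good.hom 0).mul hq
    · rw [map_mul, hqc, mul_inv_cancel_left₀ (h.y0 i)]

theorem finrank_vanForms {d : ℕ} (hd : a ≤ d) :
    Module.finrank k (vanForms (Set.range v) d) + p = (d + 3).choose 3 := by
  let ev : R4 k →ₗ[k] Fin p → k := LinearMap.pi fun i => (aeval (v i)).toLinearMap
  have hev : ∀ q i, ev q i = eval (v i) q := fun q i => by simp [ev, aeval_eq_eval]
  have h1 := finrank_map_add_inf_ker ev (Forms k d)
  rw [finrank_forms] at h1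
  have h2 : (Forms k d).map ev = ⊤ := by
    rw [eq_top_iff]
    rintro c -
    obtain ⟨q, hq, hqc⟩ := h.exists_form_eval hd c
    exact ⟨q, hq, funext fun i => by rw [hev, hqc]⟩
  have h3 : Forms k d ⊓ LinearMap.ker ev = vanForms (Set.range v) d := by
    ext q
    refine and_congr Iff.rfl ?_
    rw [SetLike.mem_coe, SetLike.mem_coe, LinearMap.mem_ker, funext_iff, Submodule.restrictScalars_mem, mem_van, Set.forall_mem_range]
    simp only [hev, Pi.zero_apply]
  rw [h2, h3, finrank_top, Module.finrank_fin_fun] at h1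
  omega

theorem finrank_pieces {d : ℕ} (hd : a ≤ d) :
    Module.finrank k (pieces f (Set.range v) d) + p = 3 * (d + 1).choose 2 + 1 := by
  have h1 := h.finrank_vanForms hd
  have h2 : Module.finrank k (pieces f (Set.range v) d) + _ = _ := finrank_vanForms_map_mkq h.homog h.prime.ne_zero (Z := Set.range v)
    (by rintro _ ⟨i, rfl⟩; exact h.on i) d
  have h3 : (d + 3).choose 3 = d.choose 3 + 3 * (d + 1).choose 2 + 1 := by
    simp only [Nat.choose_succ_succ', Nat.choose_zero_right]
    ring
  omega

theorem not_dvd_of_linear {l : R4 k} (hl : l.IsHomogeneous 1) (hl0 : l ≠ 0) : ¬ f ∣ l :=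
  fun hd => hl0 (eq_zero_of_dvd h.homog hl (by omega) hd)

theorem y_zero_ne_zero : y 0 ≠ 0 := by
  intro h0
  obtain ⟨w, hw⟩ := h.good.regular 0 (by omega) 1 0 (by simp [h0])
  simp at hw

theorem pieces_eq_bot {d : ℕ} (hd : d < a) : pieces f (Set.range v) d = ⊥ := by
  rw [eq_bot_iff]
  rintro _ ⟨u, hu, rfl⟩
  rw [Submodule.mem_bot, mkq_eq_zero]
  obtain ⟨c, rfl⟩ := Nat.exists_eq_add_of_lt hd
  have hu' : y 0 ^ c * u ∈ vanForms (Set.range v) (d + c) :=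
    pow_mul_mem_vanForms (h.good.hom 0) hu c
  have hX : ∀ i, X i * (y 0 ^ c * u) ∈ vanForms (Set.range v) (d + c + 1) := fun i =>
    mul_mem_vanForms (isHomogeneous_X _ _) hu'
  have h1 := h.inj ![X 1 * (y 0 ^ c * u), -(X 0 * (y 0 ^ c * u)), 0, 0] (by
    intro i
    fin_cases i
    exacts [hX 1, neg_mem (hX 0), zero_mem _, zero_mem _]) (by
    simp only [Fin.sum_univ_four, Matrix.cons_val]
    ring_nf
    exact dvd_zero _) 0
  rcases h.prime.dvd_or_dvd h1 with h2 | h2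
  · exact absurd h2 (h.not_dvd_of_linear (isHomogeneous_X _ _) (X_ne_zero _))
  · rcases h.prime.dvd_or_dvd h2 with h3 | h3
    · exact absurd (h.prime.dvd_of_dvd_pow h3)
        (h.not_dvd_of_linear (h.good.hom 0) h.y_zero_ne_zero)
    · exact h3

theorem exists_eq_add_y_zero_mul {d : ℕ} (hd : a ≤ d) {u : R4 k} (hu : u.IsHomogeneous (d + 1)) :
    ∃ i ∈ vanForms (Set.range v) (d + 1), ∃ s ∈ Forms k d, u = i + y 0 * s := by
  obtain ⟨s, hs, hsu⟩ := h.exists_form_eval hd fun i => (eval (v i) (y 0))⁻¹ * eval (v i) u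
  have hys : (y 0 * s).IsHomogeneous (d + 1) := by
    rw [add_comm]
    exact (h.good.hom 0).mul hs
  refine ⟨u - y 0 * s, ⟨hu.sub hys, ?_⟩, s, hs, by ring⟩
  rintro _ ⟨i, rfl⟩
  rw [map_sub, map_mul, hsu, mul_inv_cancel_left₀ (h.y0 i), sub_self]

theorem exists_van_coeffs {e i : ℕ} (he : a ≤ e) (hi : 1 ≤ i) {u : R4 k}
    (hu : u ∈ vanForms (Set.range v) (e + 2)) {w : ℕ → R4 k} {c : R4 k}
    (huw : u = ∑ j ∈ Finset.range i, y j * w j + f * c) :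
    ∃ w' : ℕ → R4 k, (∀ j, w' j ∈ vanForms (Set.range v) (e + 1)) ∧
      f ∣ u - ∑ j ∈ Finset.range i, y j * w' j := by
  obtain ⟨c', hc'⟩ : f ∣ homogeneousComponent (e + 1 + 1) (f * c) := by
    rcases le_or_gt 3 (e + 1 + 1) with h3 | h3
    · rw [← Nat.add_sub_cancel' h3, homogeneousComponent_mul_left h.homog]
      exact dvd_mul_right _ _
    · rw [homogeneousComponent_mul_left_of_lt h.homog h3]
      exact dvd_zero _
  have h1 : u = ∑ j ∈ Finset.range i, y j * homogeneousComponent (e + 1) (w j) + f * c' := by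
    rw [← homogeneousComponent_sum_mul h.good.hom, ← hc', ← map_add, ← huw,
      homogeneousComponent_of_mem hu.1, if_pos rfl]
  choose t ht s hs hts using fun j => h.exists_eq_add_y_zero_mul he
    (homogeneousComponent_isHomogeneous (e + 1) (w j))
  simp only [hts] at h1
  have h0 : 0 ∈ Finset.range i := Finset.mem_range.2 hi
  have hsum : ∑ j ∈ Finset.range i, y j * (t j + if j = 0 then ∑ l ∈ Finset.range i, y l * s l else 0)
      = ∑ j ∈ Finset.range i, y j * (t j + y 0 * s j) := by
    simp only [mul_add, Finset.sum_add_distrib, mul_ite, mul_zero, Finset.sum_ite_eq', h0, if_true]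
    rw [Finset.mul_sum]
    congr 1
    exact Finset.sum_congr rfl fun j _ => by ring
  refine ⟨fun j => t j + if j = 0 then ∑ l ∈ Finset.range i, y l * s l else 0, fun j => ?_, ?_⟩
  · refine add_mem (ht j) ?_
    split_ifs
    · refine ⟨sum_mem fun l _ => ?_, ?_⟩
      · rw [add_comm]
        exact (h.good.hom l).mul (hs l)
      · rintro _ ⟨m, rfl⟩
        have h2 := congrArg (eval (v m)) h1
        have h3 : ∀ l, eval (v m) (t l) = 0 := fun l => (ht l).2 _ ⟨m, rfl⟩
        rw [← hsum, hu.2 _ ⟨m, rfl⟩, map_add, map_mul, h.on, zero_mul, add_zero, map_sum] at h2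
        simp only [map_mul, map_add, h3, zero_add] at h2
        rw [Finset.sum_eq_single_of_mem 0 h0 (fun j _ hj => by simp [hj]), if_pos rfl] at h2
        exact (mul_eq_zero.1 h2.symm).resolve_left (h.y0 m)
    · exact zero_mem _
  · rw [hsum]
    nth_rewrite 1 [h1]
    rw [add_sub_cancel_left]
    exact dvd_mul_right _ _

theorem pieces_generated {e : ℕ} (he : a ≤ e) {x : R4 k ⧸ Ideal.span {f}}
    (hx : x ∈ pieces f (Set.range v) (e + 2)) :
    ∃ w : ℕ → R4 k ⧸ Ideal.span {f}, (∀ j, w j ∈ pieces f (Set.range v) (e + 1)) ∧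
      x = ∑ j ∈ Finset.range 4, y j • w j := by
  obtain ⟨u, hu, rfl⟩ := hx
  obtain ⟨w, hw⟩ := h.good.cover _ u hu.1
  obtain ⟨w', hw', hd⟩ := h.exists_van_coeffs he (i := 4) (by omega) hu (c := 0)
    (by rw [hw, mul_zero, add_zero])
  refine ⟨fun j => mkq f (w' j), fun j => ⟨w' j, hw' j, rfl⟩, ?_⟩
  rw [← mkq_sum_mul, mkq_eq_mkq]
  exact hd

theorem regularIn_pieces (ha : 1 ≤ a) {e : ℕ} (he : a ≤ e) :
    RegularIn y 4 (pieces f (Set.range v)) (e + 1) := by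
  intro i hi x hx w hw hxw
  obtain ⟨u, hu, rfl⟩ := hx
  choose w0 hw0 hww using hw
  obtain rfl : w = fun j => mkq f (w0 j) := funext fun j => (hww j).symm
  rw [← mkq_sum_mul, ← mkq_mul, mkq_eq_mkq] at hxw
  rcases Nat.eq_zero_or_pos i with rfl | hi0
  · refine ⟨0, fun j => zero_mem _, ?_⟩
    rw [Finset.range_zero, Finset.sum_empty, sub_zero] at hxw
    rw [Finset.range_zero, Finset.sum_empty, mkq_eq_zero]
    exact (h.prime.dvd_or_dvd hxw).resolve_left
      (h.not_dvd_of_linear (h.good.hom 0) h.y_zero_ne_zero)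
  · obtain ⟨w1, c1, h1⟩ : ∃ (w' : ℕ → R4 k) (c' : R4 k),
        u = ∑ j ∈ Finset.range i, y j * w' j + f * c' := by
      rcases Nat.lt_succ_iff_lt_or_eq.1 hi with hi3 | rfl
      · obtain ⟨c, hc⟩ := hxw
        exact h.good.regular_mod i hi3 u c w0 (by rw [← hc]; ring)
      · obtain ⟨d, hd⟩ := Nat.exists_eq_add_of_le (show 3 ≤ e + 1 + 1 by omega)
        exact h.good.cover_mod d u (hd ▸ hu.1)
    obtain ⟨w', hw', hd⟩ := h.exists_van_coeffs he hi0 hu h1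
    refine ⟨fun j => mkq f (w' j), fun j => ⟨w' j, hw' j, rfl⟩, ?_⟩
    rw [← mkq_sum_mul, mkq_eq_mkq]
    exact hd

end IsGenericConfig

end Pieces

section Resolution

variable {k : Type} [Field k]

/-- The degrees of the generators. -/
abbrev genDegrees (a : ℕ) : Fin (a + 3) → ℕ :=
  Fin.append (fun _ : Fin a => a) (fun _ : Fin 3 => a + 1)

theorem finrank_freePieces_genDegrees (a c : ℕ) :
    Module.finrank k (freePieces k (genDegrees a) (a + 1 + c)) =
      a * (c + 4).choose 3 + 3 * (c + 3).choose 3 := by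
  have h1 : ∀ i : Fin a, Module.finrank k
      (shiftedForms k (genDegrees a (Fin.castAdd 3 i)) (a + 1 + c)) = (c + 4).choose 3 := fun i => by
    rw [genDegrees, Fin.append_left, add_assoc, add_comm 1 c, finrank_shiftedForms_add]
  have h2 : ∀ i : Fin 3, Module.finrank k
      (shiftedForms k (genDegrees a (Fin.natAdd a i)) (a + 1 + c)) = (c + 3).choose 3 := fun i => by
    rw [genDegrees, Fin.append_right, finrank_shiftedForms_add]
  rw [finrank_freePieces, Fin.sum_univ_add, Finset.sum_congr rfl fun i _ => h1 i,
    Finset.sum_congr rfl fun i _ => h2 i]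
  simp

theorem choose_two_succ (n : ℕ) : (n + 1).choose 2 = n + n.choose 2 := by
  rw [Nat.choose_succ_succ', Nat.choose_one_right]

theorem finrank_shiftedForms_of_lt {d e : ℕ} (h : e < d) :
    Module.finrank k (shiftedForms k d e) = 0 := by
  rw [shiftedForms, if_neg (by omega), finrank_bot]

variable {f : R4 k} {y : ℕ → R4 k} {p : ℕ} {v : Fin p → Fin 4 → k} {a : ℕ}

theorem comb_mem_pieces {n : ℕ} {d : Fin n → ℕ} {g : Fin n → R4 k}
    (hg : ∀ j, g j ∈ vanForms (Set.range v) (d j)) {e : ℕ} {w : Fin n → R4 k}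
    (hw : w ∈ freePieces k d e) : comb (fun j => mkq f (g j)) w ∈ pieces f (Set.range v) e := by
  rw [comb_apply, ← mkq_sum_mul]
  refine ⟨_, sum_mem fun j _ => ?_, rfl⟩
  rcases mem_shiftedForms.1 (mem_freePieces.1 hw j) with h0 | ⟨c, rfl, hc⟩
  · rw [h0, zero_mul]
    exact zero_mem _
  · refine ⟨?_, Ideal.mul_mem_left _ _ (hg j).2⟩
    rw [add_comm]
    exact hc.mul (hg j).1

theorem exists_eq_lin {q : R4 k} (hq : q.IsHomogeneous 1) : ∃ c, q = lin c := by
  have h1 : q ∈ homogeneousSubmodule (Fin 4) k 1 := hq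
  rw [homogeneousSubmodule_one_eq_span_X, Submodule.mem_span_range_iff_exists_fun] at h1
  obtain ⟨c, rfl⟩ := h1
  exact ⟨c, Finset.sum_congr rfl fun i _ => smul_eq_C_mul _ _⟩

namespace IsGenericConfig

variable (h : IsGenericConfig f y v a) (hp : p = 3 * (a * (a - 1) / 2) + 2 * a + 1)

include h hp

theorem finrank_pieces_add (c : ℕ) :
    Module.finrank k (pieces f (Set.range v) (a + c)) + (3 * a.choose 2 + 2 * a + 1) =
      3 * (a + c + 1).choose 2 + 1 := by
  have h1 := h.finrank_pieces (d := a + c) (by omega)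
  rw [← h1, Nat.choose_two_right]
  omega

theorem finrank_pieces_self : Module.finrank k (pieces f (Set.range v) a) = a := by
  have : Module.finrank k (pieces f (Set.range v) a) + (3 * a.choose 2 + 2 * a + 1) =
    3 * (a + 1).choose 2 + 1 := h.finrank_pieces_add hp 0
  simp only [choose_two_succ] at this
  omega

theorem finrank_pieces_one : Module.finrank k (pieces f (Set.range v) (a + 1)) = 4 * a + 3 := by
  have := h.finrank_pieces_add hp 1
  simp only [choose_two_succ] at this
  omega

theorem finrank_pieces_two : Module.finrank k (pieces f (Set.range v) (a + 2)) = 7 * a + 9 := by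
  have := h.finrank_pieces_add hp 2
  simp only [show a + 2 + 1 = a + 1 + 1 + 1 by rfl, choose_two_succ] at this
  omega

theorem finrank_pieces_three :
    Module.finrank k (pieces f (Set.range v) (a + 3)) = 10 * a + 18 := by
  have := h.finrank_pieces_add hp 3
  simp only [show a + 3 + 1 = a + 1 + 1 + 1 + 1 by rfl, choose_two_succ] at this
  omega

theorem finrank_pieces_four :
    Module.finrank k (pieces f (Set.range v) (a + 4)) = 13 * a + 30 := by
  have := h.finrank_pieces_add hp 4
  simp only [show a + 4 + 1 = a + 1 + 1 + 1 + 1 + 1 by rfl, choose_two_succ] at this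
  omega

theorem exists_generators : ∃ g : Fin (a + 3) → R4 k,
    (∀ j, g j ∈ vanForms (Set.range v) (genDegrees a j)) ∧
    ∀ e, ∀ x ∈ pieces f (Set.range v) e, ∃ w ∈ freePieces k (genDegrees a) e,
      comb (fun j => mkq f (g j)) w = x := by
  let b := Module.finBasisOfFinrankEq k _ (h.finrank_pieces_self hp)
  choose g1 hg1 hgb using fun j => (b j).2
  replace hg1 : ∀ j, g1 j ∈ vanForms (Set.range v) a := hg1
  let φ : (Fin a → R4 k) →ₗ[R4 k] R4 k ⧸ Ideal.span {f} := comb fun j => mkq f (g1 j)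
  let F := freePieces k (fun _ : Fin a => a)
  have hφM : ∀ e, ∀ w ∈ F e, φ w ∈ pieces f (Set.range v) e := fun e w hw =>
    comb_mem_pieces hg1 hw
  have hF : Module.finrank k (F (a + 1)) = a * 4 := finrank_freePieces_const a a 1
  have hker : F (a + 1) ⊓ LinearMap.ker (φ.restrictScalars k) = ⊥ := by
    rw [eq_bot_iff]
    rintro w ⟨hw, hw0⟩
    choose c hc using fun j =>
      exists_eq_lin ((mem_shiftedForms_add (k := k) (d := a) (c := 1)).1 (mem_freePieces.1 hw j))
    have h1 : f ∣ ∑ i, X i * ∑ j, c j i • g1 j := by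
      have h2 : comb (fun j => mkq f (g1 j)) w = 0 := hw0
      rw [comb_apply, ← mkq_sum_mul, mkq_eq_zero] at h2
      convert h2 using 1
      simp only [hc, lin, Finset.mul_sum, Finset.sum_mul]
      rw [Finset.sum_comm]
      refine Finset.sum_congr rfl fun j _ => Finset.sum_congr rfl fun i _ => ?_
      rw [smul_eq_C_mul]
      ring
    have h2 : ∀ i j, c j i = 0 := fun i => by
      refine Fintype.linearIndependent_iff.1 b.linearIndependent (fun j => c j i) ?_
      have h3 := h.inj _ (fun i => sum_mem fun j _ => Submodule.smul_mem _ _ (hg1 j)) h1 i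
      rw [← mkq_eq_zero, map_sum] at h3
      apply Subtype.ext
      simpa only [map_smul, hgb, Submodule.coe_sum, Submodule.coe_smul, ZeroMemClass.coe_zero]
        using h3
    rw [Submodule.mem_bot]
    ext1 j
    rw [hc, lin]
    simp [h2]
  have hN := finrank_map_add_inf_ker (φ.restrictScalars k) (F (a + 1))
  rw [hker, finrank_bot, hF, add_zero] at hN
  set N : Submodule k (R4 k ⧸ Ideal.span {f}) := (F (a + 1)).map (φ.restrictScalars k) with hNdef
  have hNle : N ≤ pieces f (Set.range v) (a + 1) := by
    rintro _ ⟨w, hw, rfl⟩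
    exact hφM _ w hw
  obtain ⟨D, hD⟩ := Submodule.exists_isCompl (N.comap (pieces f (Set.range v) (a + 1)).subtype)
  have hDr : Module.finrank k D = 3 := by
    have h1 := Submodule.finrank_add_eq_of_isCompl hD
    rw [(Submodule.comapSubtypeEquivOfLe hNle).finrank_eq, hN, h.finrank_pieces_one hp] at h1
    omega
  have : Module.Free k D := Module.Free.of_divisionRing k D
  let b2 := Module.finBasisOfFinrankEq k D hDr
  choose g2 hg2 hgb2 using fun j => (b2 j).1.2
  replace hg2 : ∀ j, g2 j ∈ vanForms (Set.range v) (a + 1) := hg2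
  refine ⟨Fin.append g1 g2, fun j => ?_, fun e => ?_⟩
  · refine Fin.addCases (fun i => ?_) (fun i => ?_) j
    · simpa only [genDegrees, Fin.append_left] using hg1 i
    · simpa only [genDegrees, Fin.append_right] using hg2 i
  have hF1 : ∀ e, ∀ w ∈ F e, Fin.append w 0 ∈ freePieces k (genDegrees a) e := by
    intro e w hw
    rw [mem_freePieces]
    intro j
    refine Fin.addCases (fun i => ?_) (fun i => ?_) j
    · simpa only [genDegrees, Fin.append_left] using mem_freePieces.1 hw i
    · simp only [genDegrees, Fin.append_right]
      exact zero_mem _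
  have hφ1 : ∀ w, comb (fun j => mkq f (Fin.append g1 g2 j)) (Fin.append w 0) = φ w := by
    intro w
    rw [comb_apply, Fin.sum_univ_add]
    simp [φ, comb_apply]
  rcases Nat.lt_trichotomy e a with he | rfl | he
  · intro x hx
    rw [h.pieces_eq_bot he, Submodule.mem_bot] at hx
    exact ⟨0, zero_mem _, by rw [map_zero, hx]⟩
  · intro x hx
    refine ⟨Fin.append (fun i => C (b.repr ⟨x, hx⟩ i)) 0, hF1 _ _ (mem_freePieces.2 fun i =>
      mem_shiftedForms.2 (Or.inr ⟨0, rfl, isHomogeneous_C _ _⟩)), ?_⟩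
    have h2 := congrArg Subtype.val (b.sum_repr ⟨x, hx⟩)
    rw [hφ1]
    simp only [φ, comb_apply, hgb]
    simpa only [C_smul, Submodule.coe_sum, Submodule.coe_smul] using h2
  · induction e, he using Nat.le_induction with
    | base =>
      intro x hx
      obtain ⟨⟨n1, hn1⟩, m, hn, hm, hnm⟩ := Submodule.codisjoint_iff_exists_add_eq.1 hD.codisjoint
        ⟨x, hx⟩
      obtain ⟨w, hw, hwn⟩ := hn
      refine ⟨Fin.append w fun i => C (b2.repr ⟨m, hm⟩ i), ?_, ?_⟩
      · rw [mem_freePieces]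
        intro j
        refine Fin.addCases (fun i => ?_) (fun i => ?_) j
        · simpa only [genDegrees, Fin.append_left] using mem_freePieces.1 hw i
        · simp only [genDegrees, Fin.append_right]
          exact mem_shiftedForms.2 (Or.inr ⟨0, rfl, isHomogeneous_C _ _⟩)
      · have h2 := congrArg (fun z => z.1.1) (b2.sum_repr ⟨m, hm⟩)
        have h3 := congrArg Subtype.val hnm
        rw [comb_apply, Fin.sum_univ_add]
        simp only [Fin.append_left, Fin.append_right, hgb2, C_smul]
        simp only [Submodule.coe_sum, Submodule.coe_smul, Submodule.coe_add] at h2 h3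
        rw [h2, ← h3]
        exact congrArg (· + _) hwn
    | succ e he ih =>
      intro x hx
      obtain ⟨e, rfl⟩ := Nat.exists_eq_add_of_lt he
      obtain ⟨w, hw, rfl⟩ := h.pieces_generated (e := a + e) (by omega) hx
      choose q hq hqw using fun j => ih (w j) (hw j)
      refine ⟨∑ j ∈ Finset.range 4, y j • q j, sum_mem fun j _ =>
        smul_mem_freePieces (h.good.hom j) (hq j), ?_⟩
      simp only [map_sum, map_smul, hqw]

end IsGenericConfig

end Resolution

section Syzygies

variable {k : Type} [Field k]

theorem mul_mem_shiftedForms_add {d m c : ℕ} {p q : R4 k} (hp : p.IsHomogeneous c)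
    (hq : q ∈ shiftedForms k d m) : p * q ∈ shiftedForms k d (m + c) := by
  rw [mem_shiftedForms] at hq ⊢
  rcases hq with rfl | ⟨c', rfl, hq⟩
  · exact Or.inl (mul_zero _)
  · exact Or.inr ⟨c + c', by omega, hp.mul hq⟩

theorem comb_pi_apply {n n' : ℕ} (r : Fin n' → Fin n → R4 k) (w : Fin n' → R4 k) (j : Fin n) :
    comb r w j = ∑ i, w i * r i j := by
  rw [comb_apply, Finset.sum_apply]
  rfl

theorem comb_mem_freePieces {n n' m : ℕ} {d : Fin n → ℕ} {r : Fin n' → Fin n → R4 k}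
    (hr : ∀ i, r i ∈ freePieces k d m) {e : ℕ} {w : Fin n' → R4 k}
    (hw : w ∈ freePieces k (fun _ => m) e) : comb r w ∈ freePieces k d e := by
  refine mem_freePieces.2 fun j => ?_
  rw [comb_pi_apply]
  refine sum_mem fun i _ => ?_
  rcases mem_shiftedForms.1 (mem_freePieces.1 hw i) with h0 | ⟨c, rfl, hc⟩
  · rw [h0, zero_mul]
    exact zero_mem _
  · exact mul_mem_shiftedForms_add hc (mem_freePieces.1 (hr i) j)

variable {N : Type*} [AddCommGroup N] [Module (R4 k) N] [Module k N] [IsScalarTower k (R4 k) N]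

/-- The syzygies of a graded module which is regular in large degrees are again regular in
large degrees, and generated in a single degree as soon as they vanish below it. -/
theorem exists_syzygies {f : R4 k} {y : ℕ → R4 k} (hy : IsGoodSeq f y) {n : ℕ} {d : Fin n → ℕ}
    {φ : (Fin n → R4 k) →ₗ[R4 k] N} {M : ℕ → Submodule k N} (m n' : ℕ)
    (hyM : ∀ e i x, x ∈ M e → y i • x ∈ M (e + 1))
    (hφ : ∀ e, ∀ x ∈ freePieces k d e, φ x ∈ M e)
    (hs : ∀ e, ∀ x ∈ M e, ∃ p ∈ freePieces k d e, φ p = x)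
    (hreg : ∀ e ≥ m, RegularIn y 4 M e) (hd : ∀ j, d j ≤ m)
    (hbot : ∀ e ≤ m, kerPieces (freePieces k d) φ e = ⊥)
    (hn' : Module.finrank k (kerPieces (freePieces k d) φ (m + 1)) = n') :
    (∀ e ≥ m + 1, RegularIn y 4 (kerPieces (freePieces k d) φ) e) ∧
    ∃ r : Fin n' → Fin n → R4 k, (∀ i, r i ∈ kerPieces (freePieces k d) φ (m + 1)) ∧
      (∀ e, ∀ x ∈ freePieces k (fun _ : Fin n' => m + 1) e,
        comb r x ∈ kerPieces (freePieces k d) φ e) ∧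
      (∀ e, ∀ x ∈ kerPieces (freePieces k d) φ e,
        ∃ p ∈ freePieces k (fun _ : Fin n' => m + 1) e, comb r p = x) ∧
      (∀ e ≤ m + 1, kerPieces (freePieces k fun _ : Fin n' => m + 1) (comb r) e = ⊥) := by
  have hyF : ∀ e i x, x ∈ freePieces k d e → y i • x ∈ freePieces k d (e + 1) :=
    fun e i x hx => smul_mem_freePieces (hy.hom i) hx
  constructor
  · intro e he
    obtain ⟨e, rfl⟩ : ∃ e', e = e' + 1 := ⟨e - 1, by omega⟩
    exact RegularIn.kerPieces φ hyF hyM (hφ _) (hs _) (hreg e (by omega))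
      (hy.regularIn_freePieces d _)
  · obtain ⟨r, hr, hsr, hir⟩ := CubicPoints.exists_generators (k := k) hy.hom
      (kerPieces (freePieces k d) φ) (m + 1) n'
      (Submodule.finiteDimensional_inf_left _ _) hn' (fun e he => hbot e (by omega))
      (fun e he u hu => by
        obtain ⟨e, rfl⟩ : ∃ e', e = e' + 1 := ⟨e - 1, by omega⟩
        exact kerPieces_generated φ hyF hyM (hφ _) (hs _) (hreg e (by omega))
          (fun u hu => hy.exists_freePieces (fun j => (hd j).trans (by omega)) hu) hu)
    refine ⟨r, hr, fun e x hx => ⟨comb_mem_freePieces (fun i => (hr i).1) hx, ?_⟩, hsr,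
      fun e he => ?_⟩
    · change φ _ = 0
      rw [comb_apply, map_sum]
      refine Finset.sum_eq_zero fun i _ => ?_
      rw [map_smul, (hr i).2, smul_zero]
    · rw [eq_bot_iff]
      rintro x ⟨hx, hx0⟩
      exact hir e he x hx hx0

theorem kerPieces_eq_bot_of_finrank_le {n : ℕ} {d : Fin n → ℕ}
    {φ : (Fin n → R4 k) →ₗ[R4 k] N} {M : ℕ → Submodule k N} {e : ℕ}
    (hφ : ∀ x ∈ freePieces k d e, φ x ∈ M e) (hs : ∀ x ∈ M e, ∃ p ∈ freePieces k d e, φ p = x)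
    (h : Module.finrank k (freePieces k d e) ≤ Module.finrank k (M e)) :
    kerPieces (freePieces k d) φ e = ⊥ := by
  have := finrank_kerPieces hφ hs
  have : FiniteDimensional k (kerPieces (freePieces k d) φ e) :=
    Submodule.finiteDimensional_inf_left _ _
  rw [← Submodule.finrank_eq_zero (R := k)]
  omega

theorem dvd_homogeneousComponent {f p : R4 k} {m : ℕ} (hf : f.IsHomogeneous m) (h : f ∣ p)
    (e : ℕ) : f ∣ homogeneousComponent e p := by
  obtain ⟨c, rfl⟩ := h
  rcases le_or_gt m e with hm | hm
  · rw [← Nat.add_sub_cancel' hm, homogeneousComponent_mul_left hf]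
    exact dvd_mul_right _ _
  · rw [homogeneousComponent_mul_left_of_lt hf hm]
    exact dvd_zero _

theorem entryOk_of_mem_shiftedForms {d e : ℕ} (h : e < d) {q : R4 k}
    (hq : q ∈ shiftedForms k e d) : EntryOk k d e q := by
  rw [mem_shiftedForms] at hq
  refine ⟨hq, ?_⟩
  rcases hq with rfl | ⟨c, rfl, hc⟩
  · simp
  · exact hc.coeff_eq_zero (by simp; omega)

/-- The components of a polynomial vanishing at all points of a set in projective space. -/
theorem homogeneousComponent_mem_vanForms [Infinite k] {p : ℕ} {v : Fin p → Fin 4 → k}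
    (hv : ∀ i, v i ≠ 0) {x : R4 k}
    (hx : x ∈ pointsIdeal k (Set.range fun i => Projectivization.mk k (v i) (hv i))) (e : ℕ) :
    homogeneousComponent e x ∈ vanForms (Set.range v) e := by
  refine ⟨homogeneousComponent_isHomogeneous _ _, ?_⟩
  rintro _ ⟨i, rfl⟩
  let P : Polynomial k := ∑ j ∈ Finset.range (x.totalDegree + 1),
    Polynomial.C (eval (v i) (homogeneousComponent j x)) * Polynomial.X ^ j
  have hP : P = 0 := by
    have h1 : ∀ c : k, c ≠ 0 → P.eval c = 0 := by
      intro c hc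
      have h2 := hx _ ⟨i, rfl⟩ (c • v i) (smul_ne_zero hc (hv i))
        ((Projectivization.mk_eq_mk_iff' k _ _ _ _).2 ⟨c, rfl⟩)
      rw [← sum_homogeneousComponent x, map_sum] at h2
      rw [Polynomial.eval_finsetSum, ← h2]
      refine Finset.sum_congr rfl fun j _ => ?_
      rw [eval_smul_of_isHomogeneous (homogeneousComponent_isHomogeneous j x)]
      rw [Polynomial.eval_mul, Polynomial.eval_C, Polynomial.eval_pow, Polynomial.eval_X, mul_comm]
    refine Polynomial.eq_zero_of_infinite_isRoot _ (Set.Infinite.mono (s := {0}ᶜ) h1 ?_)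
    exact (Set.finite_singleton 0).infinite_compl
  rcases lt_or_ge e (x.totalDegree + 1) with he | he
  · have h1 : P.coeff e = 0 := by rw [hP, Polynomial.coeff_zero]
    simpa [P, Polynomial.finsetSum_coeff, Polynomial.coeff_X_pow, he] using h1
  · rw [homogeneousComponent_eq_zero _ _ (by omega), map_zero]

theorem mem_pointsIdeal_of_mem_vanForms {p : ℕ} {v : Fin p → Fin 4 → k} (hv : ∀ i, v i ≠ 0)
    {e : ℕ} {x : R4 k} (hx : x ∈ vanForms (Set.range v) e) :
    x ∈ pointsIdeal k (Set.range fun i => Projectivization.mk k (v i) (hv i)) := by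
  rintro _ ⟨i, rfl⟩ u hu hui
  obtain ⟨c, rfl⟩ := (Projectivization.mk_eq_mk_iff' k _ _ _ _).1 hui
  rw [eval_smul_of_isHomogeneous hx.1, hx.2 _ ⟨i, rfl⟩, mul_zero]

end Syzygies

section Assembly

variable {k : Type} [Field k] {f : R4 k} {y : ℕ → R4 k} {p : ℕ} {v : Fin p → Fin 4 → k} {a : ℕ}

/-- The resolution of the ideal of a generic configuration. -/
theorem IsGenericConfig.hasMinFreeRes [Infinite k] (h : IsGenericConfig f y v a) (ha : 1 ≤ a)
    (hp : p = 3 * (a * (a - 1) / 2) + 2 * a + 1) (hv : ∀ i, v i ≠ 0) :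
    HasMinFreeRes3 k (Ideal.span {f})
      (pointsIdeal k (Set.range fun i => Projectivization.mk k (v i) (hv i)))
      (genDegrees a) (fun _ : Fin (3 * a + 3) => a + 2) (fun _ : Fin (2 * a) => a + 3) := by
  obtain ⟨g, hg, hsg⟩ := h.exists_generators hp
  have hdeg : ∀ j, genDegrees a j ≤ a + 1 := by
    intro j
    refine Fin.addCases (fun i => ?_) (fun i => ?_) j <;> simp [genDegrees]
  let φ : (Fin (a + 3) → R4 k) →ₗ[R4 k] R4 k ⧸ Ideal.span {f} := comb fun j => mkq f (g j)
  have hφ0 : ∀ w, φ w = 0 ↔ f ∣ ∑ j, w j * g j := fun w => by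
    rw [← mkq_eq_zero, mkq_sum_mul]
    rfl
  let K := kerPieces (freePieces k (genDegrees a)) φ
  have hφ : ∀ e, ∀ x ∈ freePieces k (genDegrees a) e, φ x ∈ pieces f (Set.range v) e :=
    fun e x hx => comb_mem_pieces hg hx
  have hKbot : ∀ e ≤ a + 1, K e = ⊥ := by
    intro e he
    refine kerPieces_eq_bot_of_finrank_le (hφ e) (hsg e) ?_
    rcases Nat.lt_trichotomy e a with h1 | rfl | h1
    · rw [finrank_freePieces, Finset.sum_eq_zero fun j _ => finrank_shiftedForms_of_lt ?_]
      · exact Nat.zero_le _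
      · refine Fin.addCases (fun i => ?_) (fun i => ?_) j <;> simp [genDegrees] <;> omega
    · rw [h.finrank_pieces_self hp]
      have h1 : ∀ i : Fin e, Module.finrank k
          (shiftedForms k (genDegrees e (Fin.castAdd 3 i)) e) = 1 := fun i => by
        rw [genDegrees, Fin.append_left]
        exact (finrank_shiftedForms_add e 0).trans (by simp)
      have h2 : ∀ i : Fin 3, Module.finrank k
          (shiftedForms k (genDegrees e (Fin.natAdd e i)) e) = 0 := fun i => by
        rw [genDegrees, Fin.append_right, finrank_shiftedForms_of_lt (Nat.lt_succ_self e)]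
      rw [finrank_freePieces, Fin.sum_univ_add, Finset.sum_congr rfl fun i _ => h1 i,
        Finset.sum_congr rfl fun i _ => h2 i]
      simp
    · obtain rfl : e = a + 1 := by omega
      rw [h.finrank_pieces_one hp]
      have h0 : Module.finrank k (freePieces k (genDegrees a) (a + 1)) = _ :=
        finrank_freePieces_genDegrees a 0
      rw [h0]
      simp only [Nat.choose]
      omega
  have hdim : ∀ e, _ := fun e => finrank_kerPieces (hφ e) (hsg e)
  have hK2 : Module.finrank k (K (a + 1 + 1)) = 3 * a + 3 := by
    have h1 := hdim (a + 1 + 1)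
    rw [finrank_freePieces_genDegrees, h.finrank_pieces_two hp] at h1
    simp only [Nat.choose] at h1
    change _ + Module.finrank k (K (a + 1 + 1)) = _ at h1
    omega
  have hK3 : Module.finrank k (K (a + 3)) = 10 * a + 12 := by
    have h1 := hdim (a + 3)
    have h0 : Module.finrank k (freePieces k (genDegrees a) (a + 3)) = _ :=
      finrank_freePieces_genDegrees a 2
    rw [h0, h.finrank_pieces_three hp] at h1
    simp only [Nat.choose] at h1
    change _ + Module.finrank k (K (a + 3)) = _ at h1
    omega
  have hK4 : Module.finrank k (K (a + 4)) = 22 * a + 30 := by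
    have h1 := hdim (a + 4)
    have h0 : Module.finrank k (freePieces k (genDegrees a) (a + 4)) = _ :=
      finrank_freePieces_genDegrees a 3
    rw [h0, h.finrank_pieces_four hp] at h1
    simp only [Nat.choose] at h1
    change _ + Module.finrank k (K (a + 4)) = _ at h1
    omega
  obtain ⟨hKreg, M2, hM2, hφ2, hs2, hbot2⟩ := exists_syzygies h.good (a + 1) (3 * a + 3)
    (fun e i x hx => smul_mem_pieces (h.good.hom i) hx) hφ hsg (fun e he => by
      obtain ⟨e, rfl⟩ : ∃ e', e = e' + 1 := ⟨e - 1, by omega⟩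
      exact h.regularIn_pieces ha (by omega)) hdeg hKbot hK2
  let K2 := kerPieces (freePieces k fun _ : Fin (3 * a + 3) => a + 1 + 1) (comb M2)
  have hdim2 : ∀ e, _ := fun e => finrank_kerPieces (hφ2 e) (hs2 e)
  have hK23 : Module.finrank k (K2 (a + 1 + 1 + 1)) = 2 * a := by
    have h1 := hdim2 (a + 1 + 1 + 1)
    rw [finrank_freePieces_const] at h1
    simp only [Nat.choose] at h1
    change Module.finrank k (K (a + 3)) + Module.finrank k (K2 (a + 1 + 1 + 1)) = _ at h1
    omega
  have hK24 : Module.finrank k (K2 (a + 4)) = 8 * a := by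
    have h1 := hdim2 (a + 1 + 1 + 2)
    rw [finrank_freePieces_const] at h1
    simp only [Nat.choose] at h1
    change Module.finrank k (K (a + 4)) + Module.finrank k (K2 (a + 4)) = _ at h1
    omega
  have hyK : ∀ e i x, x ∈ K e → y i • x ∈ K (e + 1) := fun e i x hx =>
    ⟨smul_mem_freePieces (h.good.hom i) hx.1, by
      change φ _ = 0
      rw [map_smul, hx.2, smul_zero]⟩
  obtain ⟨hK2reg, M3, hM3, hφ3, hs3, hbot3⟩ := exists_syzygies h.good (a + 1 + 1) (2 * a)
    hyK hφ2 hs2 hKreg (fun _ => le_rfl) hbot2 hK23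
  let K3 := kerPieces (freePieces k fun _ : Fin (2 * a) => a + 1 + 1 + 1) (comb M3)
  have hdim3 : ∀ e, _ := fun e => finrank_kerPieces (hφ3 e) (hs3 e)
  have hK34 : Module.finrank k (K3 (a + 1 + 1 + 1 + 1)) = 0 := by
    have h1 := hdim3 (a + 1 + 1 + 1 + 1)
    rw [finrank_freePieces_const] at h1
    simp only [Nat.choose] at h1
    change Module.finrank k (K2 (a + 4)) + Module.finrank k (K3 (a + 1 + 1 + 1 + 1)) = _ at h1
    omega
  have hyK2 : ∀ e i x, x ∈ K2 e → y i • x ∈ K2 (e + 1) := fun e i x hx =>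
    ⟨smul_mem_freePieces (h.good.hom i) hx.1, by
      change comb M2 _ = 0
      rw [map_smul, hx.2, smul_zero]⟩
  obtain ⟨-, M4, -, -, hs4, -⟩ := exists_syzygies h.good (a + 1 + 1 + 1) 0
    hyK2 hφ3 hs3 hK2reg (fun _ => le_rfl) hbot3 hK34
  have hcomp : ∀ (n n' m : ℕ) (d : Fin n → ℕ) (r : Fin n' → Fin n → R4 k)
      (hr : ∀ i, r i ∈ freePieces k d m) (w : Fin n' → R4 k), comb r w = 0 → ∀ e,
      comb r (freeComponent (fun _ => m) e w) = 0 := by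
    intro n n' m d r hr w hw e
    ext1 j
    rw [comb_pi_apply, sum_freeComponent_mul (δ := d j) (fun i => mem_freePieces.1 (hr i) j),
      ← comb_pi_apply, hw]
    simp
  refine ⟨g, M2, M3, fun j => ⟨mem_pointsIdeal_of_mem_vanForms hv (hg j), (hg j).1⟩,
    fun x hx => ?_, fun i j => ?_, fun i j => ?_, fun w => ?_, fun u => ?_, fun t ht => ?_⟩
  · choose w hw hwx using fun e => hsg e (mkq f (homogeneousComponent e x))
      ⟨_, homogeneousComponent_mem_vanForms hv hx e, rfl⟩
    refine ⟨∑ e ∈ Finset.range (x.totalDegree + 1), w e, ?_⟩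
    rw [Ideal.mem_span_singleton, ← mkq_eq_mkq, mkq_sum_mul]
    change _ = φ (∑ e ∈ Finset.range (x.totalDegree + 1), w e)
    rw [map_sum]
    conv_lhs => rw [← sum_homogeneousComponent x, map_sum]
    exact Finset.sum_congr rfl fun e _ => (hwx e).symm
  · exact entryOk_of_mem_shiftedForms (Nat.lt_succ_of_le (hdeg j)) (mem_freePieces.1 (hM2 i).1 j)
  · exact entryOk_of_mem_shiftedForms (Nat.lt_succ_self (a + 2)) (mem_freePieces.1 (hM3 i).1 j)
  · rw [Ideal.mem_span_singleton, ← hφ0]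
    constructor
    · intro hw
      obtain ⟨u, rfl⟩ := exists_eq_comb_of_ker (d := genDegrees a) (φ := φ) (fun w hw e => by
        rw [hφ0] at hw ⊢
        rw [sum_freeComponent_mul (δ := 0) fun j => mem_shiftedForms.2
          (Or.inr ⟨genDegrees a j, by omega, (hg j).1⟩), if_pos (by omega)]
        exact dvd_homogeneousComponent h.homog hw _) (fun e x hx => by
          obtain ⟨q, -, hq⟩ := hs2 e x hx
          exact ⟨q, hq⟩) hw
      exact ⟨u, fun j => comb_pi_apply M2 u j⟩
    · rintro ⟨u, hu⟩
      obtain rfl : w = comb M2 u := funext fun j => by rw [hu, comb_pi_apply]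
      rw [comb_apply M2, map_sum]
      exact Finset.sum_eq_zero fun i _ => by rw [map_smul, (hM2 i).2, smul_zero]
  · have h1 : (∀ j, ∑ i, u i * M2 i j = 0) ↔ comb M2 u = 0 := by
      simp only [_root_.funext_iff, comb_pi_apply, Pi.zero_apply]
    rw [h1]
    constructor
    · intro hu
      obtain ⟨t, rfl⟩ := exists_eq_comb_of_ker (d := fun _ => a + 1 + 1) (φ := comb M2)
        (fun w hw e => hcomp _ _ _ _ M2 (fun i => (hM2 i).1) w hw e) (fun e x hx => by
          obtain ⟨q, -, hq⟩ := hs3 e x hx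
          exact ⟨q, hq⟩) hu
      exact ⟨t, fun j => comb_pi_apply M3 t j⟩
    · rintro ⟨t, ht⟩
      obtain rfl : u = comb M3 t := funext fun j => by rw [ht, comb_pi_apply]
      rw [comb_apply M3, map_sum]
      exact Finset.sum_eq_zero fun i _ => by rw [map_smul, (hM3 i).2, smul_zero]
  · have ht0 : comb M3 t = 0 := by
      ext1 i
      rw [comb_pi_apply, ht, Pi.zero_apply]
    obtain ⟨s, rfl⟩ := exists_eq_comb_of_ker (d := fun _ => a + 1 + 1 + 1) (φ := comb M3)
      (fun w hw e => hcomp _ _ _ _ M3 (fun i => (hM3 i).1) w hw e) (fun e x hx => by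
        obtain ⟨q, -, hq⟩ := hs4 e x hx
        exact ⟨q, hq⟩) ht0
    rw [comb_apply, Finset.univ_eq_empty, Finset.sum_empty]

end Assembly

section PlaneSection

variable {k : Type} [Field k]

theorem isHomogeneous_kill {d : ℕ} {q : R4 k} (hq : q.IsHomogeneous d) (i : ℕ) :
    (kill i q).IsHomogeneous d := by
  have := hq.aeval (n := 1) (fun n : Fin 4 => if (n : ℕ) < i then 0 else (X n : R4 k))
    fun n => by
      split_ifs
      · exact isHomogeneous_zero _ _ _
      · exact isHomogeneous_X _ _
  simpa [kill] using this

/-- A cubic form that is a product of two non-units has a linear factor. -/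
theorem exists_linear_factor {c a b : R4 k} (hc : c.IsHomogeneous 3) (hc0 : c ≠ 0) (hab : c = a * b)
    (ha : ¬ IsUnit a) (hb : ¬ IsUnit b) : ∃ (m : Fin 4 → k) (q : R4 k), c = lin m * q := by
  wlog hle : a.totalDegree ≤ 1 generalizing a b
  · refine this (by rw [hab, mul_comm]) hb ha ?_
    have h1 := totalDegree_mul_of_isDomain (left_ne_zero_of_mul (hab ▸ hc0))
      (right_ne_zero_of_mul (hab ▸ hc0))
    rw [← hab, hc.totalDegree hc0] at h1
    omega
  have ha0 := left_ne_zero_of_mul (hab ▸ hc0)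
  have h1 := totalDegree_mul_of_isDomain ha0 (right_ne_zero_of_mul (hab ▸ hc0))
  rw [← hab, hc.totalDegree hc0] at h1
  rcases Nat.le_one_iff_eq_zero_or_eq_one.1 hle with h0 | h0
  · refine absurd ?_ ha
    rw [totalDegree_eq_zero_iff_eq_C] at h0
    rw [h0] at ha0 ⊢
    exact (IsUnit.mk0 _ fun h => ha0 (by rw [h, C_0])).map C
  · obtain ⟨m, hm⟩ := exists_eq_lin (homogeneousComponent_isHomogeneous 1 a)
    refine ⟨m, homogeneousComponent 2 b, ?_⟩
    have h2 := sum_homogeneousComponent a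
    rw [h0, Finset.sum_range_succ, Finset.sum_range_one] at h2
    have h3 : homogeneousComponent 3 b = 0 := homogeneousComponent_eq_zero _ _ (by omega)
    have h4 : homogeneousComponent 3 c = c := homogeneousComponent_of_mem hc |>.trans (if_pos rfl)
    rw [← h4, hab, ← h2, add_mul, map_add]
    have h5 := homogeneousComponent_mul_left (homogeneousComponent_isHomogeneous 0 a) 3 b
    have h6 := homogeneousComponent_mul_left (homogeneousComponent_isHomogeneous 1 a) 2 b
    rw [zero_add] at h5
    rw [h5, h6, h3, mul_zero, zero_add, hm]

/-- A plane section of a cubic surface without a linear component is integral. -/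
theorem isPrime_span_pair {f : R4 k} (hf : f.IsHomogeneous 3) {c : Fin 4 → k} (hc : c ≠ 0)
    (H : ∀ (m : Fin 4 → k) (q' q : R4 k), f ≠ lin c * q' + lin m * q) :
    (Ideal.span {lin c, f}).IsPrime := by
  obtain ⟨P, Q, hPQ, hP⟩ := exists_matrix_row hc 0
  obtain ⟨σ, h1, h2, h3, h4⟩ := exists_coordinateChange P Q hPQ
  have hσ0 : σ (X 0) = lin c := by rw [h1, hP]
  have hσ0' : σ.symm (lin c) = X 0 := by rw [← hσ0, AlgEquiv.symm_apply_apply]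
  let θ : R4 k →ₐ[k] R4 k := (kill 1).comp σ.symm.toAlgHom
  have hθ : ∀ u, θ u = kill 1 (σ.symm u) := fun u => rfl
  have hv0 : (var k 0) = X 0 := rfl
  have hker : ∀ u v, kill 1 (σ.symm u) = kill 1 v → ∃ w, u = σ v + lin c * w := fun u v hu => by
    obtain ⟨w, hw⟩ := exists_of_kill_eq hu
    refine ⟨σ (w 0), ?_⟩
    have := congrArg σ hw
    rw [AlgEquiv.apply_symm_apply, Finset.sum_range_one, map_add, map_mul, hv0, hσ0] at this
    exact this
  have hidem : ∀ u : R4 k, kill 1 (kill 1 u) = kill 1 u := fun u => by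
    obtain ⟨w, hw⟩ := exists_eq_kill_add (i := 1) u
    conv_rhs => rw [hw, map_add, kill_sum (by omega), add_zero]
  have hch : (θ f).IsHomogeneous 3 := isHomogeneous_kill (h3 _ _ hf) 1
  have hc0 : θ f ≠ 0 := fun h0 => by
    obtain ⟨w, hw⟩ := hker f 0 (by rw [← hθ, h0, map_zero])
    exact H 0 w 0 (by rw [hw]; simp)
  have hirr : Irreducible (θ f) := by
    refine ⟨fun hu => ?_, fun a b hab => ?_⟩
    · have h5 := eval_smul_of_isHomogeneous hch 0 (0 : Fin 4 → k)
      rw [zero_pow (by norm_num), zero_mul] at h5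
      exact (hu.map (eval _)).ne_zero h5
    · by_contra! hn
      obtain ⟨m, q, hq⟩ := exists_linear_factor hch hc0 hab hn.1 hn.2
      obtain ⟨w, hw⟩ := hker f (lin m * q) (by rw [← hq, ← hθ, hθ f, hidem])
      obtain ⟨m', hm'⟩ := exists_eq_lin (h2 _ _ (lin_isHomogeneous m))
      exact H m' w (σ q) (by rw [← hm', add_comm, ← map_mul, ← hw])
  have hprime : (Ideal.span {θ f}).IsPrime :=
    (Ideal.span_singleton_prime hc0).2 hirr.prime
  have heq : Ideal.span {lin c, f} = (Ideal.span {θ f}).comap θ := by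
    ext u
    rw [Ideal.mem_comap, Ideal.mem_span_singleton, Ideal.mem_span_pair]
    constructor
    · rintro ⟨s, t, rfl⟩
      refine ⟨θ t, ?_⟩
      have h5 : θ (lin c) = 0 := by
        rw [hθ, hσ0', ← hv0, kill_var (by omega) (by omega)]
      rw [map_add, map_mul, map_mul, h5, mul_zero, zero_add, mul_comm]
    · rintro ⟨t, ht⟩
      obtain ⟨w, hw⟩ := hker u (σ.symm f * t) (by
        rw [← hidem, ← hθ, ht, map_mul, map_mul, hθ f, hidem])
      refine ⟨w, σ t, ?_⟩
      rw [hw, map_mul, AlgEquiv.apply_symm_apply]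
      ring
  rw [heq]
  exact hprime.comap θ

end PlaneSection

section PlaneSection

variable {k : Type} [Field k]

theorem exists_dotProduct_eq_zero (a b w : Fin 4 → k) :
    ∃ x, a ⬝ᵥ x = 0 ∧ b ⬝ᵥ x = 0 ∧ ∀ t : k, x ≠ t • w := by
  let L := (Matrix.of ![a, b]).mulVecLin
  have h1 := L.finrank_range_add_finrank_ker
  have h2 : Module.finrank k (LinearMap.range L) ≤ 2 := by
    simpa using Submodule.finrank_le (LinearMap.range L)
  have h3 : ¬ LinearMap.ker L ≤ Submodule.span k {w} := fun hle => by
    have h4 := Submodule.finrank_mono hle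
    have h5 := finrank_span_le_card (R := k) ({w} : Set (Fin 4 → k))
    rw [Module.finrank_fin_fun] at h1
    rw [Set.toFinset_singleton, Finset.card_singleton] at h5
    omega
  obtain ⟨x, hx, hxw⟩ := SetLike.not_le_iff_exists.1 h3
  refine ⟨x, by simpa [L] using congrFun (LinearMap.mem_ker.1 hx) 0,
    by simpa [L] using congrFun (LinearMap.mem_ker.1 hx) 1, fun t ht => hxw ?_⟩
  rw [ht]
  exact Submodule.smul_mem _ _ (Submodule.mem_span_singleton_self w)

/-- The polynomial whose value at `r` is the value of `f` at the intersection of the plane `l`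
with the line through `e` and `r`. -/
def projectAlong (f : R4 k) (l e : Fin 4 → k) : R4 k :=
  aeval (fun i => C (l ⬝ᵥ e) * X i - lin l * C (e i)) f

theorem eval_projectAlong (f : R4 k) (l e r : Fin 4 → k) :
    eval r (projectAlong f l e) = eval ((l ⬝ᵥ e) • r - (l ⬝ᵥ r) • e) f := by
  have h : (((aeval r : R4 k →ₐ[k] k)).comp
      (aeval fun i => C (l ⬝ᵥ e) * X i - lin l * C (e i)) : R4 k →ₐ[k] k) =
      aeval ((l ⬝ᵥ e) • r - (l ⬝ᵥ r) • e) := by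
    ext1 i
    simp [eval_lin]
  have h2 := congrArg (fun φ => φ f) h
  rw [← coe_aeval_eq_eval, ← coe_aeval_eq_eval]
  exact h2

theorem projectAlong_ne_zero {f : R4 k} (hf : f.IsHomogeneous 3) (hirr : Irreducible f)
    {l e : Fin 4 → k} (hl : l ⬝ᵥ e ≠ 0) : projectAlong f l e ≠ 0 := by
  intro h
  have h1 : lin l ∣ C ((l ⬝ᵥ e) ^ 3) * f := by
    have h2 := aeval_smul_of_isHomogeneous hf (C (l ⬝ᵥ e) : R4 k) (X : Fin 4 → R4 k)
    rw [aeval_X_left_apply, ← C_pow] at h2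
    rw [← h2, ← Ideal.mem_span_singleton, ← Ideal.Quotient.eq_zero_iff_mem]
    have h3 : (Ideal.Quotient.mkₐ k (Ideal.span {lin l})).comp
        (aeval fun i => C (l ⬝ᵥ e) * X i - lin l * C (e i)) =
        (Ideal.Quotient.mkₐ k (Ideal.span {lin l})).comp (aeval ((C (l ⬝ᵥ e) : R4 k) • (X : Fin 4 → R4 k))) := by
      ext1 i
      simp only [AlgHom.comp_apply, aeval_X]
      rw [map_sub, map_mul _ (lin l)]
      have : Ideal.Quotient.mkₐ k (Ideal.span {lin l}) (lin l) = 0 :=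
        Ideal.Quotient.eq_zero_iff_mem.2 (Ideal.mem_span_singleton_self _)
      rw [this, zero_mul, sub_zero]
      rfl
    have h4 := congrArg (fun φ => φ f) h3
    simp only [AlgHom.comp_apply] at h4
    change Ideal.Quotient.mkₐ k _ _ = 0
    rw [← h4]
    change Ideal.Quotient.mkₐ k _ (projectAlong f l e) = 0
    rw [h, map_zero]
  have h2 : lin l ∣ f := by
    rwa [IsUnit.dvd_mul_left] at h1
    exact (IsUnit.mk0 _ (pow_ne_zero 3 hl)).map C
  have hl0 : lin l ≠ 0 := lin_ne_zero fun h0 => hl (by rw [h0, zero_dotProduct])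
  obtain ⟨q, hq, hfq⟩ := exists_form_of_dvd (d := 2) (lin_isHomogeneous l) hf h2
  have hunit : ∀ {d : ℕ} {q : R4 k}, 0 < d → q.IsHomogeneous d → ¬ IsUnit q := fun hd hq hu => by
    have h5 := eval_smul_of_isHomogeneous hq 0 (0 : Fin 4 → k)
    rw [zero_pow hd.ne', zero_mul] at h5
    exact (hu.map (eval _)).ne_zero h5
  exact (hirr.isUnit_or_isUnit hfq).elim (hunit one_pos (lin_isHomogeneous l)) (hunit two_pos hq)

theorem finite_eval_line {f : R4 k} {e : Fin 4 → k} (he : eval e f ≠ 0) (e' : Fin 4 → k) :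
    {s : k | eval (e + s • e') f = 0}.Finite := by
  let F : Polynomial k := aeval (fun i => Polynomial.C (e i) + Polynomial.X * Polynomial.C (e' i)) f
  have hF : ∀ s, F.eval s = eval (e + s • e') f := fun s => by
    have h : ((Polynomial.aeval s : Polynomial k →ₐ[k] k).comp
        (aeval fun i => Polynomial.C (e i) + Polynomial.X * Polynomial.C (e' i)) :
          R4 k →ₐ[k] k) = aeval (e + s • e') := by
      ext1 i
      simp
      ring
    have h2 := congrArg (fun φ => φ f) h
    rw [← Polynomial.coe_aeval_eq_eval, ← coe_aeval_eq_eval]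
    exact h2
  have hF0 : F ≠ 0 := fun h0 => he (by simpa [h0] using (hF 0).symm)
  refine (Polynomial.finite_setOfPred_isRoot hF0).subset fun s hs => ?_
  change F.eval s = 0
  rw [hF]
  exact hs

/-- The differential of a polynomial at a point. -/
def gradient (f : R4 k) (p : Fin 4 → k) : Fin 4 → k := fun i => eval p (pderiv i f)

theorem gradient_add_mul {f q' q : R4 k} {c m : Fin 4 → k} (hfq : f = lin c * q' + lin m * q)
    {p : Fin 4 → k} (hc : c ⬝ᵥ p = 0) (hm : m ⬝ᵥ p = 0) :
    gradient f p = eval p q' • c + eval p q • m := by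
  have hp : ∀ (c : Fin 4 → k) i, pderiv i (lin c) = C (c i) := fun c i => by
    simp [lin, Derivation.leibniz, pderiv_X, Pi.single_apply]
  ext i
  rw [gradient, hfq]
  simp only [map_add, Derivation.leibniz, smul_eq_mul, map_mul, eval_lin, hc, hm, hp, eval_C]
  simp

/-- A smooth cubic surface has an integral plane section avoiding a given finite set of points. -/
theorem exists_plane_section [Infinite k] {f : R4 k} (hf : f.IsHomogeneous 3)
    (hirr : Irreducible f) (hsm : ∀ v : Fin 4 → k, v ≠ 0 → eval v f = 0 → gradient f v ≠ 0)
    {Z : Finset (Fin 4 → k)} (hne : Z.Nonempty) (hZ : ∀ z ∈ Z, z ≠ 0 ∧ eval z f = 0) :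
    ∃ c : Fin 4 → k, (∀ z ∈ Z, c ⬝ᵥ z ≠ 0) ∧ (Ideal.span {lin c, f}).IsPrime := by
  obtain ⟨e, he⟩ := exists_eval_ne_zero hirr.ne_zero
  have he0 : e ≠ 0 := by
    rintro rfl
    have := eval_smul_of_isHomogeneous hf 0 (0 : Fin 4 → k)
    rw [zero_smul, zero_pow (by norm_num), zero_mul] at this
    exact he this
  obtain ⟨φ, hφe, hφZ⟩ : ∃ φ : Fin 4 → k, φ ⬝ᵥ e = 0 ∧ ∀ z ∈ Z, φ ⬝ᵥ z ≠ 0 := by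
    obtain ⟨i, hi⟩ := Function.ne_iff.1 he0
    obtain ⟨g, hg⟩ := exists_forall_eval_ne_zero Z (fun z => lin (e i • z - z i • e))
      fun z hz => lin_ne_zero fun h0 => by
        have h1 : z = (z i / e i) • e := by
          rw [div_eq_inv_mul, mul_smul, ← sub_eq_zero.1 h0, smul_smul, inv_mul_cancel₀ hi, one_smul]
        have h2 := (hZ z hz).2
        rw [h1, eval_smul_of_isHomogeneous hf, mul_eq_zero, or_iff_left he,
          pow_eq_zero_iff (by norm_num)] at h2
        exact (hZ z hz).1 (by rw [h1, h2, zero_smul])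
    refine ⟨e i • g - Pi.single i (g ⬝ᵥ e), ?_, fun z hz => ?_⟩
    · rw [sub_dotProduct, smul_dotProduct, single_dotProduct, smul_eq_mul]
      ring
    · convert hg z hz using 1
      rw [eval_lin, sub_dotProduct, smul_dotProduct, single_dotProduct, sub_dotProduct,
        smul_dotProduct, smul_dotProduct, dotProduct_comm z g, dotProduct_comm e g]
      simp only [smul_eq_mul]
      ring
  obtain ⟨e', hφe', -, he'⟩ := exists_dotProduct_eq_zero φ φ e
  obtain ⟨ψ, hψe, hψe', hψ⟩ := exists_dotProduct_eq_zero e e' φ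
  rw [dotProduct_comm] at hψe hψe'
  let T : Set (Fin 4 → k) := insert e' ((fun s : k => e + s • e') '' {s | eval (e + s • e') f = 0})
  have hT : T.Finite := ((finite_eval_line he e').image _).insert _
  classical
  let G : (Fin 4 → k) → R4 k := fun p =>
    if p = 0 ∨ eval p f ≠ 0 then 1 else
    if gradient f p ⬝ᵥ e = 0 then lin (gradient f p) else projectAlong f (gradient f p) e
  have hG : ∀ p, G p ≠ 0 := fun p => by
    simp only [G]
    split_ifs with h1 h2
    · exact one_ne_zero
    · rw [not_or, not_ne_iff] at h1
      exact lin_ne_zero (hsm p h1.1 h1.2)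
    · exact projectAlong_ne_zero hf hirr h2
  obtain ⟨r, hr⟩ := exists_eval_ne_zero (mul_ne_zero
    (Finset.prod_ne_zero_iff.2 fun z (hz : z ∈ Z) => lin_ne_zero (c := (φ ⬝ᵥ z) • ψ - (ψ ⬝ᵥ z) • φ)
      fun h0 => hψ ((ψ ⬝ᵥ z) / (φ ⬝ᵥ z)) (by
        rw [div_eq_inv_mul, mul_smul, ← sub_eq_zero.1 h0, smul_smul,
          inv_mul_cancel₀ (hφZ z hz), one_smul]))
    (Finset.prod_ne_zero_iff.2 fun p (_ : p ∈ hT.toFinset) => hG p))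
  rw [map_mul, map_prod, map_prod] at hr
  have hrZ := Finset.prod_ne_zero_iff.1 (left_ne_zero_of_mul hr)
  have hrT := Finset.prod_ne_zero_iff.1 (right_ne_zero_of_mul hr)
  let c := (ψ ⬝ᵥ r) • φ - (φ ⬝ᵥ r) • ψ
  have hcv : ∀ v, c ⬝ᵥ v = (ψ ⬝ᵥ r) * (φ ⬝ᵥ v) - (φ ⬝ᵥ r) * (ψ ⬝ᵥ v) := fun v => by
    simp only [c, sub_dotProduct, smul_dotProduct, smul_eq_mul]
  have hcZ : ∀ z ∈ Z, c ⬝ᵥ z ≠ 0 := fun z hz => by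
    convert hrZ z hz using 1
    rw [hcv, eval_lin, sub_dotProduct, smul_dotProduct, smul_dotProduct, smul_eq_mul, smul_eq_mul]
    ring
  have hc0 : c ≠ 0 := by
    obtain ⟨z, hz⟩ := hne
    intro h0
    exact hcZ z hz (by rw [h0, zero_dotProduct])
  have hce : c ⬝ᵥ e = 0 := by rw [hcv, hφe, hψe]; ring
  have hce' : c ⬝ᵥ e' = 0 := by rw [hcv, hφe', hψe']; ring
  have hcr : c ⬝ᵥ r = 0 := by rw [hcv]; ring
  refine ⟨c, hcZ, isPrime_span_pair hf hc0 fun m q' q hfq => ?_⟩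
  have hfv : ∀ v, c ⬝ᵥ v = 0 → eval v f = (m ⬝ᵥ v) * eval v q := fun v hv => by
    rw [hfq, map_add, map_mul, map_mul, eval_lin, eval_lin, hv, zero_mul, zero_add]
  have hme : m ⬝ᵥ e ≠ 0 := fun h0 => he (by rw [hfv e hce, h0, zero_mul])
  obtain ⟨p, hp0, hpT, hcp, hmp⟩ : ∃ p, p ≠ 0 ∧ p ∈ T ∧ c ⬝ᵥ p = 0 ∧ m ⬝ᵥ p = 0 := by
    by_cases h0 : m ⬝ᵥ e' = 0
    · exact ⟨e', fun h => he' 0 (by rw [h, zero_smul]), Set.mem_insert _ _, hce', h0⟩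
    · have h1 : c ⬝ᵥ (e + (-(m ⬝ᵥ e) / (m ⬝ᵥ e')) • e') = 0 := by
        rw [dotProduct_add, dotProduct_smul, hce, hce', smul_zero, add_zero]
      have h2 : m ⬝ᵥ (e + (-(m ⬝ᵥ e) / (m ⬝ᵥ e')) • e') = 0 := by
        rw [dotProduct_add, dotProduct_smul, smul_eq_mul, div_mul_cancel₀ _ h0, add_neg_cancel]
      refine ⟨_, fun h => ?_, Set.mem_insert_of_mem _ ⟨_, ?_, rfl⟩, h1, h2⟩
      · refine he' ((m ⬝ᵥ e') / (m ⬝ᵥ e)) ?_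
        have h3 := eq_neg_of_add_eq_zero_left h
        have h4 : ((m ⬝ᵥ e') / (m ⬝ᵥ e)) * -(-(m ⬝ᵥ e) / (m ⬝ᵥ e')) = 1 := by field_simp
        have h5 := congrArg (fun x => ((m ⬝ᵥ e') / (m ⬝ᵥ e)) • x) h3
        simp only [← neg_smul, smul_smul] at h5
        rw [h4, one_smul] at h5
        exact h5.symm
      · change eval _ f = 0
        rw [hfv _ h1, h2, zero_mul]
  have hfp : eval p f = 0 := by rw [hfv p hcp, hmp, zero_mul]
  have hg := gradient_add_mul hfq hcp hmp
  have hgv : ∀ v, c ⬝ᵥ v = 0 → gradient f p ⬝ᵥ v = eval p q * (m ⬝ᵥ v) := fun v hv => by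
    rw [hg, add_dotProduct, smul_dotProduct, smul_dotProduct, hv, smul_zero, zero_add, smul_eq_mul]
  have hrp := hrT p (hT.mem_toFinset.2 hpT)
  simp only [G] at hrp
  rw [if_neg (by simp [hp0, hfp])] at hrp
  split_ifs at hrp with h0
  · rw [hgv e hce, mul_eq_zero, or_iff_left hme] at h0
    rw [eval_lin, hgv r hcr, h0, zero_mul] at hrp
    exact hrp rfl
  · rw [eval_projectAlong] at hrp
    set w := (gradient f p ⬝ᵥ e) • r - (gradient f p ⬝ᵥ r) • e with hw
    have hcw : c ⬝ᵥ w = 0 := by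
      rw [hw, dotProduct_sub, dotProduct_smul, dotProduct_smul, hcr, hce, smul_zero, smul_zero,
        sub_zero]
    have hgw : gradient f p ⬝ᵥ w = 0 := by
      rw [hw, dotProduct_sub, dotProduct_smul, dotProduct_smul, smul_eq_mul, smul_eq_mul]
      ring
    rw [hgv w hcw, mul_eq_zero] at hgw
    rw [hgv e hce] at h0
    rw [hfv w hcw, hgw.resolve_left (left_ne_zero_of_mul h0), zero_mul] at hrp
    exact hrp rfl

end PlaneSection

section Step

variable {k : Type} [Field k]

theorem exists_dual_family {ι : Type*} (W : Submodule k (ι → k)) [FiniteDimensional k W] :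
    ∃ (P : Fin (Module.finrank k W) → ι) (w : Fin (Module.finrank k W) → ι → k), (∀ j, w j ∈ W) ∧
      (∀ i j, w j (P i) = if i = j then 1 else 0) ∧ ∀ x ∈ W, x = ∑ j, x (P j) • w j := by
  let ev : ι → Module.Dual k W := fun i => (LinearMap.proj i).comp W.subtype
  have hs : ⊤ ≤ Submodule.span k (Set.range ev) := by
    rw [← Subspace.dualCoannihilator_dualAnnihilator_eq (W := Submodule.span k (Set.range ev))]
    have h1 : (Submodule.span k (Set.range ev)).dualCoannihilator = ⊥ := by
      rw [eq_bot_iff]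
      intro x hx
      rw [Submodule.mem_bot]
      ext i
      exact (Submodule.mem_dualCoannihilator _).1 hx (ev i)
        (Submodule.subset_span (Set.mem_range_self i))
    rw [h1, Submodule.dualAnnihilator_bot]
  let b₀ := Module.Basis.ofSpan hs
  let b := b₀.reindex (b₀.indexEquiv (Module.finBasisOfFinrankEq k (Module.Dual k W)
    Subspace.dual_finrank_eq))
  have hb : ∀ i, b i ∈ Set.range ev := fun i => by
    rw [Module.Basis.reindex_apply]
    exact Module.Basis.ofSpan_subset hs (Set.mem_range_self _)
  choose P hP using hb
  let w : Fin (Module.finrank k W) → W := fun j => (Module.evalEquiv k W).symm (b.dualBasis j)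
  have hw : ∀ i j, b i (w j) = if i = j then 1 else 0 := fun i j => by
    rw [Module.apply_evalEquiv_symm_apply, Module.Basis.dualBasis_apply_self]
  refine ⟨P, fun j => w j, fun j => (w j).2, fun i j => ?_, fun x hx => ?_⟩
  · rw [← hw, ← hP]
    rfl
  · have h1 : (⟨x, hx⟩ : W) = ∑ j, x (P j) • w j := by
      refine (Module.evalEquiv k W).injective (b.ext fun i => ?_)
      rw [Module.evalEquiv_apply, Module.evalEquiv_apply, Module.Dual.eval_apply,
        Module.Dual.eval_apply, map_sum]
      simp only [map_smul, hw]
      simp [← hP, ev]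
    simpa using congrArg Subtype.val h1

/-- The linear forms `l` have no nontrivial relation modulo `f` with coefficients in `V`. -/
def LinInj (f : R4 k) (V : Submodule k (R4 k)) (l : Fin 4 → R4 k) : Prop :=
  ∀ g : Fin 4 → R4 k, (∀ i, g i ∈ V) → f ∣ ∑ i, l i * g i → ∀ i, f ∣ g i

theorem LinInj.change {f : R4 k} {V : Submodule k (R4 k)} {l : Fin 4 → R4 k} (h : LinInj f V l)
    {M N : Matrix (Fin 4) (Fin 4) k} (hMN : M * N = 1) :
    LinInj f V fun i => ∑ j, C (M i j) * l j := by
  intro g hg hfg i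
  have h1 : ∀ j, f ∣ ∑ i, C (M i j) * g i := by
    refine h _ (fun j => sum_mem fun i _ => ?_) ?_
    · rw [← smul_eq_C_mul]
      exact V.smul_mem _ (hg i)
    · convert hfg using 1
      simp only [Finset.mul_sum, Finset.sum_mul]
      rw [Finset.sum_comm]
      exact Finset.sum_congr rfl fun i _ => Finset.sum_congr rfl fun j _ => by ring
  have h2 : g i = ∑ j, C (N j i) * ∑ l, C (M l j) * g l := by
    have h3 : ∀ l, ∑ j, C (N j i) * C (M l j) = (if l = i then 1 else 0 : R4 k) := fun l => by
      have := congrFun (congrFun hMN l) i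
      rw [Matrix.mul_apply, Matrix.one_apply] at this
      simp only [← C_mul, ← map_sum]
      rw [Finset.sum_congr rfl fun j _ => mul_comm (N j i) (M l j), this]
      split_ifs <;> simp
    simp only [Finset.mul_sum, ← mul_assoc]
    rw [Finset.sum_comm]
    simp only [← Finset.sum_mul, h3]
    simp
  rw [h2]
  exact Finset.dvd_sum fun j _ => (h1 j).mul_left _

theorem finrank_map_of_ker_le {V W W' : Type*} [AddCommGroup V] [Module k V] [AddCommGroup W]
    [Module k W] [AddCommGroup W'] [Module k W'] (φ : V →ₗ[k] W) (ψ : V →ₗ[k] W')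
    (h : LinearMap.ker φ ≤ LinearMap.ker ψ) (U : Submodule k V) [FiniteDimensional k U] :
    Module.finrank k (U.map φ) =
      Module.finrank k (U.map ψ) + Module.finrank k ((U ⊓ LinearMap.ker ψ).map φ) := by
  have h1 := finrank_map_add_inf_ker φ U
  have h2 := finrank_map_add_inf_ker ψ U
  have h3 := finrank_map_add_inf_ker φ (U ⊓ LinearMap.ker ψ)
  rw [inf_assoc, inf_eq_right.2 h] at h3
  omega

theorem exists_of_mem_span_pair {f : R4 k} (hf : f.IsHomogeneous 3) {c : Fin 4 → k} {b : ℕ}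
    {q : R4 k} (hq : q ∈ Forms k (b + 1)) (hm : q ∈ Ideal.span {lin c, f}) :
    ∃ q' ∈ Forms k b, f ∣ q - lin c * q' := by
  obtain ⟨s, t, rfl⟩ := Ideal.mem_span_pair.1 hm
  refine ⟨homogeneousComponent b s, homogeneousComponent_isHomogeneous _ _, ?_⟩
  have h1 : homogeneousComponent (b + 1) (s * lin c + t * f) = s * lin c + t * f :=
    homogeneousComponent_of_mem hq |>.trans (if_pos rfl)
  rw [← h1, map_add, mul_comm s, add_comm b 1,
    homogeneousComponent_mul_left (lin_isHomogeneous c) b s, add_sub_cancel_left]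
  exact dvd_homogeneousComponent hf (dvd_mul_left f t) _

theorem exists_of_mem_vanForms {f : R4 k} (hf : f.IsHomogeneous 3) {c : Fin 4 → k}
    {Z : Set (Fin 4 → k)} (hZ : ∀ z ∈ Z, eval z f = 0) (hc : ∀ z ∈ Z, c ⬝ᵥ z ≠ 0) {b : ℕ}
    {q : R4 k} (hq : q ∈ vanForms Z (b + 1)) (hm : q ∈ Ideal.span {lin c, f}) :
    ∃ q' ∈ vanForms Z b, f ∣ q - lin c * q' := by
  obtain ⟨q', hq', t, ht⟩ := exists_of_mem_span_pair hf hq.1 hm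
  refine ⟨q', ⟨hq', fun z hz => ?_⟩, t, ht⟩
  have h1 := congrArg (eval z) ht
  rw [map_sub, map_mul, map_mul, eval_lin, hZ z hz, hq.2 z hz, zero_mul, zero_sub,
    neg_eq_zero] at h1
  exact (mul_eq_zero.1 h1).resolve_left (hc z hz)

theorem mkq_mul_mkq (f u w : R4 k) : mkq f u * mkq f w = mkq f (u * w) :=
  rfl

theorem map_vanForms_inf {f : R4 k} (hf : f.IsHomogeneous 3) {c : Fin 4 → k} {Z : Set (Fin 4 → k)}
    (hZ : ∀ z ∈ Z, eval z f = 0) (hc : ∀ z ∈ Z, c ⬝ᵥ z ≠ 0) (b : ℕ) :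
    (vanForms Z (b + 1) ⊓ (Ideal.span {lin c, f}).restrictScalars k).map (mkq f) =
      ((vanForms Z b).map (mkq f)).map (LinearMap.mulLeft k (mkq f (lin c))) := by
  apply le_antisymm
  · rintro _ ⟨q, ⟨hq, hqI⟩, rfl⟩
    obtain ⟨q', hq', h⟩ := exists_of_mem_vanForms hf hZ hc hq hqI
    exact ⟨mkq f q', ⟨q', hq', rfl⟩, (mkq_eq_mkq.2 h).symm⟩
  · rintro _ ⟨_, ⟨q, hq, rfl⟩, rfl⟩
    rw [LinearMap.mulLeft_apply, mkq_mul_mkq]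
    refine ⟨_, ⟨⟨?_, Ideal.mul_mem_left _ _ hq.2⟩, Ideal.mul_mem_right _ _
      (Ideal.subset_span (Set.mem_insert _ _))⟩, rfl⟩
    rw [add_comm]
    exact (lin_isHomogeneous c).mul hq.1

theorem finrank_map_vanForms_inf {f : R4 k} (hf : f.IsHomogeneous 3) (hf' : Prime f)
    {c : Fin 4 → k} (hc0 : c ≠ 0) {Z : Set (Fin 4 → k)} (hZ : ∀ z ∈ Z, eval z f = 0)
    (hc : ∀ z ∈ Z, c ⬝ᵥ z ≠ 0) (b : ℕ) :
    Module.finrank k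
      ((vanForms Z (b + 1) ⊓ (Ideal.span {lin c, f}).restrictScalars k).map (mkq f)) =
        Module.finrank k ((vanForms Z b).map (mkq f)) := by
  rw [map_vanForms_inf hf hZ hc]
  have : (Ideal.span {f}).IsPrime := (Ideal.span_singleton_prime hf'.ne_zero).2 hf'
  have h1 : mkq f (lin c) ≠ 0 := fun h => by
    exact lin_ne_zero hc0 (eq_zero_of_dvd hf (lin_isHomogeneous c) (by omega) (mkq_eq_zero.1 h))
  exact (Submodule.equivMapOfInjective (LinearMap.mulLeft k (mkq f (lin c)))
    (mul_right_injective₀ h1) _).symm.finrank_eq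

/-- Restriction of polynomials to the zero locus of an ideal. -/
def restrict (I : Ideal (R4 k)) : R4 k →ₐ[k] (zeroLocus k I → k) :=
  AlgHom.pi fun P => aeval P.1

theorem restrict_apply (I : Ideal (R4 k)) (q : R4 k) (P : zeroLocus k I) :
    restrict I q P = eval P.1 q := by
  rw [← coe_aeval_eq_eval]
  rfl

theorem restrict_eq_zero [IsAlgClosed k] {I : Ideal (R4 k)} (hI : I.IsPrime) {q : R4 k} :
    restrict I q = 0 ↔ q ∈ I := by
  rw [← IsPrime.vanishingIdeal_zeroLocus (K := k) I, mem_vanishingIdeal_iff, _root_.funext_iff]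
  rw [IsPrime.vanishingIdeal_zeroLocus (K := k) I]
  exact ⟨fun h x hx => h ⟨x, hx⟩, fun h x => h x.1 x.2⟩

theorem ker_restrict [IsAlgClosed k] {I : Ideal (R4 k)} (hI : I.IsPrime) :
    LinearMap.ker (restrict I).toLinearMap = I.restrictScalars k := by
  ext q
  exact restrict_eq_zero hI

theorem finrank_map_restrict [IsAlgClosed k] {f : R4 k} (hf : f.IsHomogeneous 3) (hf' : Prime f)
    {c : Fin 4 → k} (hc0 : c ≠ 0) (hI : (Ideal.span {lin c, f}).IsPrime) (b : ℕ) :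
    Module.finrank k ((Forms k (b + 1)).map (restrict (Ideal.span {lin c, f})).toLinearMap) =
      3 * b + 3 := by
  have hker : LinearMap.ker (mkq f) ≤
      LinearMap.ker (restrict (Ideal.span {lin c, f})).toLinearMap := by
    rw [ker_restrict hI, ker_mkq]
    exact Ideal.span_mono (Set.subset_insert _ _)
  have h0 : ∀ d, vanForms (∅ : Set (Fin 4 → k)) d = Forms k d := fun d =>
    inf_eq_left.2 fun q _ z hz => hz.elim
  have h1 := finrank_map_of_ker_le _ _ hker (Forms k (b + 1))
  rw [ker_restrict hI, ← h0, finrank_map_vanForms_inf hf hf' hc0 (by simp) (by simp) b, h0, h0]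
    at h1
  have h2 := finrank_forms_map_mkq hf hf'.ne_zero (b + 1)
  have h3 := finrank_forms_map_mkq hf hf'.ne_zero b
  have h4 : (b + 1).choose 3 = b.choose 2 + b.choose 3 := Nat.choose_succ_succ' b 2
  have h5 : (b + 1 + 3).choose 3 = (b + 3).choose 2 + (b + 3).choose 3 :=
    Nat.choose_succ_succ' (b + 3) 2
  have h6 : (b + 3).choose 2 = (b + 2) + ((b + 1) + (b + b.choose 2)) := by
    simp only [choose_two_succ]
  omega

end Step

section Step

variable {k : Type} [Field k]

theorem exists_finset_vanishing {ι : Type*} (W B : Submodule k (ι → k)) [FiniteDimensional k W]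
    [FiniteDimensional k B] (h : Module.finrank k B < Module.finrank k W) :
    ∃ (D : Finset ι) (w : ι → k), D.card < Module.finrank k W ∧ w ∈ W ∧ w ∉ B ∧
      (∀ i ∈ D, ∃ x ∈ W, x i ≠ 0) ∧
      ∀ x ∈ W, (∀ i ∈ D, x i = 0) → ∃ t : k, x = t • w := by
  classical
  obtain ⟨P, w, hw, hP, hx⟩ := exists_dual_family W
  obtain ⟨j, hj⟩ : ∃ j, w j ∉ B := by
    by_contra! hB
    refine absurd (Submodule.finrank_mono (show W ≤ B from fun x hxW => ?_)) (by omega)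
    rw [hx x hxW]
    exact sum_mem fun j _ => B.smul_mem _ (hB j)
  refine ⟨(Finset.univ.erase j).image P, w j, ?_, hw j, hj, fun i hi => ?_, fun x hxW h0 => ?_⟩
  · refine Finset.card_image_le.trans_lt ?_
    rw [Finset.card_erase_of_mem (Finset.mem_univ j), Finset.card_univ, Fintype.card_fin]
    have := j.pos
    omega
  · obtain ⟨i, -, rfl⟩ := Finset.mem_image.1 hi
    exact ⟨w i, hw i, by simp [hP]⟩
  · refine ⟨x (P j), (hx x hxW).trans (Finset.sum_eq_single j (fun i _ hij => ?_) (by simp))⟩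
    rw [h0 _ (Finset.mem_image_of_mem P (Finset.mem_erase.2 ⟨hij, Finset.mem_univ i⟩)), zero_smul]

theorem eq_zero_of_sum_smul_row {M N : Matrix (Fin 4) (Fin 4) k} (hMN : M * N = 1)
    {x : Fin 4 → k} (h : Matrix.vecMul x M = 0) : x = 0 := by
  rw [← Matrix.vecMul_one x, ← hMN, ← Matrix.vecMul_vecMul, h, Matrix.zero_vecMul]

theorem lin_sub_smul (m c : Fin 4 → k) (t : k) : lin (m - t • c) = lin m - lin c * C t := by
  rw [lin, lin, lin, Finset.sum_mul, ← Finset.sum_sub_distrib]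
  refine Finset.sum_congr rfl fun j _ => ?_
  rw [Pi.sub_apply, Pi.smul_apply, smul_eq_mul, C_sub, C_mul]
  ring

theorem exists_smul_of_lin_mem {f : R4 k} (hf : f.IsHomogeneous 3) {c m : Fin 4 → k}
    (h : lin m ∈ Ideal.span {lin c, f}) : ∃ t : k, m = t • c := by
  obtain ⟨q', hq', hd⟩ := exists_of_mem_span_pair (b := 0) hf (lin_isHomogeneous m) h
  obtain ⟨t, rfl⟩ : ∃ t, q' = C t := by
    have h0 : q'.totalDegree = 0 := Nat.le_zero.1 (IsHomogeneous.totalDegree_le hq')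
    exact ⟨_, totalDegree_eq_zero_iff_eq_C.1 h0⟩
  have h1 : (lin m - lin c * C t).IsHomogeneous 1 :=
    (lin_isHomogeneous m).sub ((lin_isHomogeneous c).mul hq')
  refine ⟨t, ?_⟩
  by_contra hne
  refine lin_ne_zero (sub_ne_zero.2 hne) ?_
  rw [lin_sub_smul]
  exact eq_zero_of_dvd hf h1 (by omega) hd

theorem linInj_step {f : R4 k} (hf : f.IsHomogeneous 3) (hf' : Prime f) {c : Fin 4 → k}
    (hc0 : c ≠ 0) (hI : (Ideal.span {lin c, f}).IsPrime) {Z : Set (Fin 4 → k)}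
    (hZ : ∀ z ∈ Z, eval z f = 0) (hc : ∀ z ∈ Z, c ⬝ᵥ z ≠ 0) {b : ℕ}
    (h : LinInj f (vanForms Z b) X) {M N : Matrix (Fin 4) (Fin 4) k} (hMN : M * N = 1)
    (hM : M 0 = c) {V : Submodule k (R4 k)} (hV : V ≤ vanForms Z (b + 1)) {u : R4 k}
    (hu : ∀ q ∈ V, ∃ t : k, q - C t * u ∈ Ideal.span {lin c, f})
    (hB : ∀ g : Fin 3 → R4 k, (∀ i, g i ∈ vanForms Z b) →
      u - ∑ i, lin (M i.succ) * g i ∉ Ideal.span {lin c, f}) :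
    LinInj f V X := by
  have hfI : f ∈ Ideal.span {lin c, f} := Ideal.subset_span (by simp)
  have hcI : lin c ∈ Ideal.span {lin c, f} := Ideal.subset_span (by simp)
  have hdI : ∀ {q}, f ∣ q → q ∈ Ideal.span {lin c, f} := fun hd =>
    Ideal.mem_of_dvd _ hd hfI
  have huI : u ∉ Ideal.span {lin c, f} := by
    simpa using hB 0 fun _ => zero_mem _
  have key : LinInj f V fun i => lin (M i) := by
    intro g hg hfg
    choose t ht using fun i => hu (g i) (hg i)
    replace hfg : f ∣ lin c * g 0 + ∑ i : Fin 3, lin (M i.succ) * g i.succ := by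
      rw [← hM]
      simpa only [Fin.sum_univ_succ (n := 3)] using hfg
    have hm : lin (∑ i : Fin 3, t i.succ • M i.succ) ∈ Ideal.span {lin c, f} := by
      refine (hI.mem_or_mem (?_ : _ * u ∈ _)).resolve_right huI
      have h1 : ∑ i : Fin 3, lin (M i.succ) * g i.succ ∈ Ideal.span {lin c, f} := by
        have := sub_mem (hdI hfg) (Ideal.mul_mem_right (g 0) _ hcI)
        rwa [add_sub_cancel_left] at this
      have h2 : ∑ i : Fin 3, lin (M i.succ) * (g i.succ - C (t i.succ) * u) ∈
          Ideal.span {lin c, f} := sum_mem fun i _ => Ideal.mul_mem_left _ _ (ht i.succ)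
      convert sub_mem h1 h2 using 1
      simp only [Fin.sum_univ_three, lin, Fin.sum_univ_four, Pi.add_apply, Pi.smul_apply,
        smul_eq_mul, map_add, map_mul]
      ring
    obtain ⟨s, hs⟩ := exists_smul_of_lin_mem hf hm
    have ht0 : (Fin.cons (-s) fun i : Fin 3 => t i.succ : Fin 4 → k) = 0 := by
      refine eq_zero_of_sum_smul_row hMN ?_
      rw [Matrix.vecMul_eq_sum, Fin.sum_univ_succ, Fin.cons_zero, hM]
      simp only [Fin.cons_succ]
      rw [hs, neg_smul, neg_add_cancel]
    have hgI : ∀ i : Fin 3, g i.succ ∈ Ideal.span {lin c, f} := fun i => by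
      have h1 := ht i.succ
      have h2 : t i.succ = 0 := by simpa using congrFun ht0 i.succ
      rwa [h2, map_zero, zero_mul, sub_zero] at h1
    choose g' hg' hd using fun i => exists_of_mem_vanForms hf hZ hc (hV (hg (Fin.succ i))) (hgI i)
    have h3 : f ∣ g 0 + ∑ i, lin (M i.succ) * g' i := by
      refine (hf'.dvd_or_dvd (?_ : f ∣ lin c * _)).resolve_left fun h0 => lin_ne_zero hc0
        (eq_zero_of_dvd hf (lin_isHomogeneous c) (by omega) h0)
      have h1 : f ∣ ∑ i : Fin 3, lin (M i.succ) * (g i.succ - lin c * g' i) :=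
        Finset.dvd_sum fun i _ => (hd i).mul_left _
      convert dvd_sub hfg h1 using 1
      simp only [Fin.sum_univ_three]
      ring
    have ht00 : t 0 = 0 := by
      by_contra h0
      refine hB (fun i => C (-(t 0)⁻¹) * g' i) (fun i => ?_) ?_
      · rw [← smul_eq_C_mul]
        exact Submodule.smul_mem _ _ (hg' i)
      · have h1 : C (t 0)⁻¹ * (g 0 + ∑ i, lin (M i.succ) * g' i) - C (t 0)⁻¹ * (g 0 - C (t 0) * u) ∈
            Ideal.span {lin c, f} :=
          sub_mem (Ideal.mul_mem_left _ _ (hdI h3)) (Ideal.mul_mem_left _ _ (ht 0))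
        convert h1 using 1
        have h2 : (C (t 0)⁻¹ * C (t 0) : R4 k) = 1 := by rw [← C_mul, inv_mul_cancel₀ h0, C_1]
        simp only [Fin.sum_univ_three, map_neg]
        linear_combination -u * h2
    obtain ⟨g₀, hg₀, hd₀⟩ := exists_of_mem_vanForms hf hZ hc (hV (hg 0)) (by
      simpa [ht00] using ht 0)
    have h4 := h.change hMN (Fin.cons g₀ g') (Fin.cases hg₀ hg') (by
      convert dvd_sub h3 hd₀ using 1
      rw [Fin.sum_univ_succ]
      simp only [Fin.cons_zero, Fin.cons_succ]
      rw [hM]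
      change lin c * g₀ + ∑ i : Fin 3, lin (M i.succ) * g' i = _
      ring)
    refine Fin.cases ?_ fun i => ?_
    · have h5 : f ∣ g₀ := h4 0
      simpa using dvd_add hd₀ (h5.mul_left (lin c))
    · have h5 : f ∣ g' i := by simpa using h4 i.succ
      simpa using dvd_add (hd i) (h5.mul_left (lin c))
  have hNM : N * M = 1 := mul_eq_one_comm.1 hMN
  convert key.change hNM using 1
  ext1 i
  simp only [lin, Finset.mul_sum, ← mul_assoc]
  rw [Finset.sum_comm]
  simp only [← Finset.sum_mul, ← C_mul, ← map_sum, ← Matrix.mul_apply, hNM]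
  simp [Matrix.one_apply]

theorem finrank_step [IsAlgClosed k] {f : R4 k} (hf : f.IsHomogeneous 3) (hf' : Prime f)
    {c : Fin 4 → k} (hc0 : c ≠ 0) (hI : (Ideal.span {lin c, f}).IsPrime) {Z : Set (Fin 4 → k)}
    (hZ : ∀ z ∈ Z, eval z f = 0) (hc : ∀ z ∈ Z, c ⬝ᵥ z ≠ 0) {b : ℕ} {V : Submodule k (R4 k)}
    (hV : V ≤ vanForms Z (b + 1)) {u : R4 k}
    (hu : ∀ q ∈ V, ∃ t : k, q - C t * u ∈ Ideal.span {lin c, f}) :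
    Module.finrank k (V.map (mkq f)) ≤ Module.finrank k ((vanForms Z b).map (mkq f)) + 1 := by
  have hker : LinearMap.ker (mkq f) ≤
      LinearMap.ker (restrict (Ideal.span {lin c, f})).toLinearMap := by
    rw [ker_restrict hI, ker_mkq]
    exact Ideal.span_mono (Set.subset_insert _ _)
  have : FiniteDimensional k V := Submodule.finiteDimensional_of_le (hV.trans inf_le_left)
  rw [finrank_map_of_ker_le _ _ hker V, ker_restrict hI, add_comm]
  refine add_le_add ?_ ?_
  · rw [← finrank_map_vanForms_inf hf hf' hc0 hZ hc b]
    exact Submodule.finrank_mono (Submodule.map_mono (inf_le_inf_right _ hV))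
  · refine (Submodule.finrank_mono (?_ : _ ≤ Submodule.span k
      {restrict (Ideal.span {lin c, f}) u})).trans ((finrank_span_le_card _).trans (by simp))
    rintro _ ⟨q, hq, rfl⟩
    obtain ⟨t, ht⟩ := hu q hq
    rw [Submodule.mem_span_singleton]
    refine ⟨t, ?_⟩
    have h1 := (restrict_eq_zero hI).2 ht
    rw [map_sub, sub_eq_zero, ← smul_eq_C_mul, map_smul] at h1
    exact h1.symm

end Step

section Step

variable {k : Type} [Field k]

theorem finrank_sup_three_le {V : Type*} [AddCommGroup V] [Module k V] (B : Fin 3 → Submodule k V)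
    [∀ i, FiniteDimensional k (B i)] {b : ℕ} (h : ∀ i, Module.finrank k (B i) ≤ b) :
    Module.finrank k (B 0 ⊔ B 1 ⊔ B 2 : Submodule k V) ≤ 3 * b := by
  have h1 := Submodule.finrank_add_le_finrank_add_finrank (B 0 ⊔ B 1) (B 2)
  have h2 := Submodule.finrank_add_le_finrank_add_finrank (B 0) (B 1)
  have h3 := h 0
  have h4 := h 1
  have h5 := h 2
  omega

theorem exists_step [IsAlgClosed k] {f : R4 k} (hf : f.IsHomogeneous 3) (hirr : Irreducible f)
    (hsm : ∀ v, v ≠ 0 → eval v f = 0 → gradient f v ≠ 0) {Z : Finset (Fin 4 → k)}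
    (hne : Z.Nonempty) (hZ : ∀ z ∈ Z, z ≠ 0 ∧ eval z f = 0) {b : ℕ}
    (h : LinInj f (vanForms (Z : Set (Fin 4 → k)) b) X)
    (hr : Module.finrank k ((vanForms (Z : Set (Fin 4 → k)) b).map (mkq f)) ≤ b) :
    ∃ D : Finset (Fin 4 → k), D.card ≤ 3 * b + 2 ∧ (∀ z ∈ D, z ≠ 0 ∧ eval z f = 0) ∧
      LinInj f (vanForms (Z ∪ D : Set (Fin 4 → k)) (b + 1)) X ∧
      Module.finrank k ((vanForms (Z ∪ D : Set (Fin 4 → k)) (b + 1)).map (mkq f)) ≤ b + 1 := by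
  classical
  have hf' : Prime f := hirr.prime
  obtain ⟨c, hc, hI⟩ := exists_plane_section hf hirr hsm hne hZ
  have hc0 : c ≠ 0 := by
    obtain ⟨z, hz⟩ := hne
    rintro rfl
    exact hc z hz (zero_dotProduct z)
  obtain ⟨M, N, hMN, hM⟩ := exists_matrix_row hc0 0
  let ψ := (restrict (Ideal.span {lin c, f})).toLinearMap
  let V := vanForms (Z : Set (Fin 4 → k)) b
  let B : Fin 3 → Submodule k (zeroLocus k (Ideal.span {lin c, f}) → k) := fun i =>
    (V.map ψ).map (LinearMap.mulLeft k (ψ (lin (M i.succ))))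
  have hVfin : FiniteDimensional k V := Submodule.finiteDimensional_of_le inf_le_left
  have hB : ∀ i, Module.finrank k (B i) ≤ b := fun i => by
    refine (Submodule.finrank_map_le _ _).trans (le_trans ?_ hr)
    have hker : LinearMap.ker (mkq f) ≤ LinearMap.ker ψ := by
      rw [ker_restrict hI, ker_mkq]
      exact Ideal.span_mono (Set.subset_insert _ _)
    rw [finrank_map_of_ker_le _ _ hker V]
    exact Nat.le_add_right _ _
  have hmem : ∀ g : Fin 3 → R4 k, (∀ i, g i ∈ V) →
      ψ (∑ i, lin (M i.succ) * g i) ∈ B 0 ⊔ B 1 ⊔ B 2 := fun g hg => by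
    have h1 : ∀ i, ψ (lin (M i.succ) * g i) ∈ B i := fun i =>
      ⟨ψ (g i), ⟨g i, hg i, rfl⟩, (map_mul (restrict _) _ _).symm⟩
    rw [Fin.sum_univ_three, map_add, map_add]
    exact Submodule.add_mem_sup (Submodule.add_mem_sup (h1 0) (h1 1)) (h1 2)
  have hW := finrank_map_restrict hf hf' hc0 hI b
  obtain ⟨D, w, hD, ⟨u, hu, rfl⟩, hw, hD0, hx⟩ := exists_finset_vanishing
    ((Forms k (b + 1)).map ψ) (B 0 ⊔ B 1 ⊔ B 2) (by
      rw [hW]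
      have := finrank_sup_three_le B hB
      omega)
  have hZ' : ∀ z ∈ (Z : Set (Fin 4 → k)), eval z f = 0 := fun z hz => (hZ z hz).2
  have hVle : vanForms (Z ∪ (D.image Subtype.val : Finset (Fin 4 → k)) : Set (Fin 4 → k)) (b + 1) ≤
      vanForms (Z : Set (Fin 4 → k)) (b + 1) :=
    inf_le_inf_left _ fun q hq z hz => hq z (Or.inl hz)
  have hu' : ∀ q ∈ vanForms (Z ∪ (D.image Subtype.val : Finset (Fin 4 → k)) : Set (Fin 4 → k))
      (b + 1), ∃ t : k, q - C t * u ∈ Ideal.span {lin c, f} := fun q hq => by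
    obtain ⟨t, ht⟩ := hx (ψ q) ⟨q, hq.1, rfl⟩ fun i hi =>
      (restrict_apply _ _ _).trans (hq.2 _ (Or.inr (Finset.mem_coe.2
        (Finset.mem_image_of_mem _ hi))))
    refine ⟨t, (restrict_eq_zero hI).1 ?_⟩
    rw [map_sub, ← smul_eq_C_mul, map_smul, sub_eq_zero]
    exact ht
  refine ⟨D.image Subtype.val, ?_, fun z hz => ?_, ?_, ?_⟩
  · have h1 := Finset.card_image_le (s := D) (f := Subtype.val)
    have h2 := hD.trans_eq hW
    omega
  · obtain ⟨P, hP, rfl⟩ := Finset.mem_image.1 hz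
    obtain ⟨_, ⟨q, hq, rfl⟩, hqP⟩ := hD0 P hP
    refine ⟨fun h0 => hqP ?_, ?_⟩
    · have h1 := eval_smul_of_isHomogeneous hq 0 P.1
      rw [zero_smul, zero_pow (Nat.succ_ne_zero b), zero_mul, ← h0] at h1
      exact (restrict_apply _ _ _).trans h1
    · rw [← coe_aeval_eq_eval]
      exact P.2 f (Ideal.subset_span (by simp))
  · refine linInj_step hf hf' hc0 hI hZ' hc h hMN hM hVle hu' fun g hg hm => hw ?_
    have h1 := (restrict_eq_zero hI).2 hm
    rw [map_sub, sub_eq_zero] at h1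
    change restrict _ u ∈ _
    rw [h1]
    exact hmem g hg
  · exact (finrank_step hf hf' hc0 hI hZ' hc hVle hu').trans (Nat.succ_le_succ hr)

theorem exists_zero [IsAlgClosed k] {f : R4 k} (hf : f.IsHomogeneous 3)
    (hf' : Prime f) : ∃ v : Fin 4 → k, v ≠ 0 ∧ eval v f = 0 := by
  by_contra! h
  have hI : (Ideal.span {f}).IsPrime := (Ideal.span_singleton_prime hf'.ne_zero).2 hf'
  have h1 : (X 0 : R4 k) ∈ Ideal.span {f} := by
    refine (restrict_eq_zero hI).1 (funext fun P => ?_)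
    have h0 : P.1 = 0 := by
      by_contra h0
      refine h P.1 h0 ?_
      rw [← coe_aeval_eq_eval]
      exact P.2 f (Ideal.mem_span_singleton_self f)
    rw [restrict_apply, h0]
    simp
  exact X_ne_zero 0 (eq_zero_of_dvd hf (isHomogeneous_X k 0) (by omega)
    (Ideal.mem_span_singleton.1 h1))

theorem exists_special_points [IsAlgClosed k] {f : R4 k} (hf : f.IsHomogeneous 3)
    (hirr : Irreducible f) (hsm : ∀ v, v ≠ 0 → eval v f = 0 → gradient f v ≠ 0) (a : ℕ) :
    ∃ Z : Finset (Fin 4 → k), Z.Nonempty ∧ (∀ z ∈ Z, z ≠ 0 ∧ eval z f = 0) ∧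
      Z.card ≤ 3 * a.choose 2 + 2 * a + 1 ∧ LinInj f (vanForms (Z : Set (Fin 4 → k)) a) X ∧
      Module.finrank k ((vanForms (Z : Set (Fin 4 → k)) a).map (mkq f)) ≤ a := by
  classical
  induction a with
  | zero =>
    obtain ⟨v, hv0, hv⟩ := exists_zero hf hirr.prime
    have h1 : vanForms (({v} : Finset (Fin 4 → k)) : Set (Fin 4 → k)) 0 = ⊥ := by
      rw [eq_bot_iff]
      rintro q ⟨hq, hqv⟩
      have h0 : q.totalDegree = 0 := Nat.le_zero.1 (IsHomogeneous.totalDegree_le hq)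
      rw [totalDegree_eq_zero_iff_eq_C] at h0
      have h2 : eval v q = 0 := hqv v (by simp)
      rw [h0, eval_C] at h2
      rw [Submodule.mem_bot, h0, h2, map_zero]
    refine ⟨{v}, Finset.singleton_nonempty v, by simpa using ⟨hv0, hv⟩, by simp, ?_, ?_⟩
    · intro g hg _ i
      rw [h1] at hg
      rw [(Submodule.mem_bot k).1 (hg i)]
      exact dvd_zero f
    · rw [h1, Submodule.map_bot, finrank_bot]
  | succ b ih =>
    obtain ⟨Z, hne, hZ, hcard, h, hr⟩ := ih
    obtain ⟨D, hDcard, hD, h', hr'⟩ := exists_step hf hirr hsm hne hZ h hr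
    rw [← Finset.coe_union] at h' hr'
    refine ⟨Z ∪ D, hne.mono Finset.subset_union_left, fun z hz => ?_, ?_, h', hr'⟩
    · rcases Finset.mem_union.1 hz with hz | hz
      exacts [hZ z hz, hD z hz]
    · have h1 := Finset.card_union_le Z D
      rw [choose_two_succ]
      omega

end Step

section Generic

variable {k : Type} [Field k]

theorem exists_surjective_family [IsAlgClosed k] {f : R4 k} (hf : f.IsHomogeneous 3)
    (hirr : Irreducible f) (hsm : ∀ v, v ≠ 0 → eval v f = 0 → gradient f v ≠ 0) {a p : ℕ}
    (hp : p = 3 * a.choose 2 + 2 * a + 1) :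
    ∃ v : Fin p → Fin 4 → k, (∀ i, v i ≠ 0 ∧ eval (v i) f = 0) ∧
      LinInj f (vanForms (Set.range v) a) X ∧
      ∀ c : Fin p → k, ∃ q ∈ Forms k a, ∀ i, eval (v i) q = c i := by
  obtain ⟨Z, -, hZ, hcard, h, hr⟩ := exists_special_points hf hirr hsm a
  let ev : R4 k →ₗ[k] (Z → k) := LinearMap.pi fun z => (aeval z.1).toLinearMap
  have hev : ∀ q z, ev q z = eval z.1 q := fun q z => by
    rw [← coe_aeval_eq_eval]
    rfl
  have hker : LinearMap.ker ev = (van (Z : Set (Fin 4 → k))).restrictScalars k := by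
    ext q
    rw [LinearMap.mem_ker, _root_.funext_iff]
    exact ⟨fun h z hz => (hev q ⟨z, hz⟩).symm.trans (h ⟨z, hz⟩),
      fun h z => (hev q z).trans (h z.1 z.2)⟩
  have h1 := finrank_map_add_inf_ker ev (Forms k a)
  rw [hker, finrank_forms, ← finrank_vanForms_map_mkq hf hirr.ne_zero fun z hz => (hZ z hz).2] at h1
  have h2 := Submodule.finrank_le ((Forms k a).map ev)
  rw [Module.finrank_fintype_fun_eq_card, Fintype.card_coe] at h2
  have h3 : (a + 3).choose 3 = a.choose 3 + 3 * a.choose 2 + 3 * a + 1 := by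
    have h4 : ∀ m : ℕ, (m + 1).choose 3 = m.choose 2 + m.choose 3 := fun m =>
      Nat.choose_succ_succ' m 2
    rw [h4 (a + 2), h4 (a + 1), h4 a]
    simp only [choose_two_succ]
    omega
  have hZp : Z.card = p := by omega
  have htop : (Forms k a).map ev = ⊤ := by
    refine Submodule.eq_top_of_finrank_eq ?_
    rw [Module.finrank_fintype_fun_eq_card, Fintype.card_coe]
    omega
  let e : Z ≃ Fin p := Z.equivFinOfCardEq hZp
  refine ⟨fun i => (e.symm i).1, fun i => hZ _ (e.symm i).2, ?_, fun c => ?_⟩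
  · convert h using 2
    ext z
    exact ⟨fun ⟨i, hi⟩ => hi ▸ (e.symm i).2, fun hz => ⟨e ⟨z, hz⟩, by simp⟩⟩
  · obtain ⟨q, hq, hqc⟩ : (fun z => c (e z)) ∈ (Forms k a).map ev := htop ▸ Submodule.mem_top
    exact ⟨q, hq, fun i => by
      rw [← hev, hqc]
      exact congrArg c (e.apply_symm_apply i)⟩

theorem exists_poly_injective {ι : Type*} [Fintype ι] [DecidableEq ι] {p : ℕ}
    (U : Submodule k (ι → R4 k)) [FiniteDimensional k U] {v₀ : Fin p → Fin 4 → k}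
    (h : ∀ u ∈ U, (∀ i j, eval (v₀ i) (u j) = 0) → u = 0) :
    ∃ g : MvPolynomial (Fin p × Fin 4) k, eval (fun q => v₀ q.1 q.2) g ≠ 0 ∧
      ∀ v : Fin p → Fin 4 → k, eval (fun q => v q.1 q.2) g ≠ 0 →
        ∀ u ∈ U, (∀ i j, eval (v i) (u j) = 0) → u = 0 := by
  let ev : (Fin p → Fin 4 → k) → U →ₗ[k] (Fin p × ι → k) := fun v =>
    LinearMap.pi fun q => (aeval (v q.1)).toLinearMap ∘ₗ LinearMap.proj q.2 ∘ₗ U.subtype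
  have hev : ∀ v u q, ev v u q = eval (v q.1) (u.1 q.2) := fun v u q => by
    rw [← coe_aeval_eq_eval]
    rfl
  obtain ⟨β, hβ⟩ := LinearMap.exists_leftInverse_of_injective (ev v₀) (by
    rw [eq_bot_iff]
    intro u hu
    rw [Submodule.mem_bot]
    refine Subtype.ext (h u.1 u.2 fun i j => ?_)
    rw [← hev v₀ u (i, j), LinearMap.mem_ker.1 hu, Pi.zero_apply])
  let b := Module.finBasis k U
  let E : Matrix (Fin (Module.finrank k U)) (Fin (Module.finrank k U))
      (MvPolynomial (Fin p × Fin 4) k) := Matrix.of fun l' l =>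
    ∑ q : Fin p × ι, C (b.repr (β (Pi.single q 1)) l') * rename (Prod.mk q.1) ((b l).1 q.2)
  have hE : ∀ v : Fin p → Fin 4 → k,
      eval (fun q => v q.1 q.2) E.det = LinearMap.det (β ∘ₗ ev v) := fun v => by
    rw [RingHom.map_det, ← LinearMap.det_toMatrix b]
    congr 1
    ext l' l
    rw [LinearMap.toMatrix_apply, LinearMap.comp_apply, pi_eq_sum_univ' (ev v (b l))]
    simp only [E, RingHom.mapMatrix_apply, Matrix.map_apply, Matrix.of_apply, map_sum, map_mul,
      eval_C, eval_rename, map_smul, Finsupp.coe_finsetSum, Finset.sum_apply, Finsupp.smul_apply,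
      smul_eq_mul, hev]
    refine Finset.sum_congr rfl fun q _ => ?_
    rw [mul_comm]
    rfl
  refine ⟨E.det, ?_, fun v hv u hu h0 => ?_⟩
  · rw [hE, hβ, LinearMap.det_id]
    exact one_ne_zero
  · rw [hE] at hv
    have h1 : (⟨u, hu⟩ : U) = 0 := by
      refine (LinearMap.equivOfDetNeZero _ hv).injective ?_
      rw [map_zero]
      change β (ev v ⟨u, hu⟩) = 0
      rw [show ev v ⟨u, hu⟩ = 0 from funext fun q => (hev _ _ _).trans (h0 _ _), map_zero]
    exact congrArg Subtype.val h1

theorem exists_poly_surjective {p a : ℕ} {v₀ : Fin p → Fin 4 → k}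
    (h : ∀ c : Fin p → k, ∃ q ∈ Forms k a, ∀ i, eval (v₀ i) q = c i) :
    ∃ g : MvPolynomial (Fin p × Fin 4) k, eval (fun q => v₀ q.1 q.2) g ≠ 0 ∧
      ∀ v : Fin p → Fin 4 → k, eval (fun q => v q.1 q.2) g ≠ 0 →
        ∀ c : Fin p → k, ∃ q ∈ Forms k a, ∀ i, eval (v i) q = c i := by
  choose r hr hrv using fun j : Fin p => h (Pi.single j 1)
  let E : Matrix (Fin p) (Fin p) (MvPolynomial (Fin p × Fin 4) k) :=
    Matrix.of fun i j => rename (Prod.mk i) (r j)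
  have hE : ∀ v : Fin p → Fin 4 → k, eval (fun q => v q.1 q.2) E.det =
      (Matrix.of fun i j => eval (v i) (r j)).det := fun v => by
    rw [RingHom.map_det]
    congr 1
    ext i j
    simp only [E, RingHom.mapMatrix_apply, Matrix.map_apply, Matrix.of_apply, eval_rename]
    rfl
  refine ⟨E.det, ?_, fun v hv c => ?_⟩
  · have h1 : (Matrix.of fun i j => eval (v₀ i) (r j)) = (1 : Matrix (Fin p) (Fin p) k) := by
      ext i j
      rw [Matrix.of_apply, hrv, Matrix.one_apply, Pi.single_apply]
    rw [hE, h1, Matrix.det_one]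
    exact one_ne_zero
  · rw [hE] at hv
    obtain ⟨x, hx⟩ := Matrix.mulVec_surjective_iff_isUnit.2
      ((Matrix.isUnit_iff_isUnit_det _).2 hv.isUnit) c
    refine ⟨∑ j, C (x j) * r j, sum_mem fun j _ => ?_, fun i => ?_⟩
    · rw [← smul_eq_C_mul]
      exact Submodule.smul_mem _ _ (hr j)
    · rw [← hx, map_sum, Matrix.mulVec, dotProduct]
      exact Finset.sum_congr rfl fun j _ => by rw [map_mul, eval_C, mul_comm, Matrix.of_apply]

theorem exists_poly_linInj {f : R4 k} {p a : ℕ} {v₀ : Fin p → Fin 4 → k}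
    (h : LinInj f (vanForms (Set.range v₀) a) X) :
    ∃ g : MvPolynomial (Fin p × Fin 4) k, eval (fun q => v₀ q.1 q.2) g ≠ 0 ∧
      ∀ v : Fin p → Fin 4 → k, (∀ i, eval (v i) f = 0) → eval (fun q => v q.1 q.2) g ≠ 0 →
        LinInj f (vanForms (Set.range v) a) X := by
  let K : Submodule k (Fin 4 → R4 k) := Submodule.pi Set.univ fun _ => LinearMap.ker (mkq f)
  let F : Submodule k (Fin 4 → R4 k) := Submodule.pi Set.univ fun _ => Forms k a
  let σ : (Fin 4 → R4 k) →ₗ[k] R4 k :=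
    ∑ i, LinearMap.mulLeft k (X i) ∘ₗ LinearMap.proj i
  have hσ : ∀ g, σ g = ∑ i, X i * g i := fun g => by simp [σ, LinearMap.sum_apply]
  let H : Submodule k (Fin 4 → R4 k) := F ⊓ (LinearMap.ker (mkq f)).comap σ
  have hK : ∀ {g}, g ∈ K ↔ ∀ i, f ∣ g i := fun {g} => by
    simp only [K, Submodule.mem_pi, Set.mem_univ, true_implies, LinearMap.mem_ker, mkq_eq_zero]
  have hH : ∀ {g}, g ∈ H ↔ (∀ i, g i ∈ Forms k a) ∧ f ∣ ∑ i, X i * g i := fun {g} => by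
    rw [← hσ, ← mkq_eq_zero]
    simp only [H, F, Submodule.mem_inf, Submodule.mem_pi, Set.mem_univ, true_implies,
      Submodule.mem_comap, LinearMap.mem_ker]
  have hFfin : FiniteDimensional k F :=
    Module.Finite.of_injective (LinearMap.pi fun i => (LinearMap.proj i ∘ₗ F.subtype).codRestrict
      (Forms k a) fun g => g.2 i (Set.mem_univ i)) fun g g' h => Subtype.ext (funext fun i =>
        congrArg Subtype.val (congrFun h i))
  obtain ⟨U, hUK, hUH⟩ : ∃ U : Submodule k (Fin 4 → R4 k), Disjoint U K ∧ U ≤ H ∧ H ≤ U ⊔ K := by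
    obtain ⟨U, hd, hs⟩ := IsModularLattice.exists_disjoint_and_sup_eq (inf_le_left : H ⊓ K ≤ H)
    have hUH : U ≤ H := le_sup_right.trans hs.le
    refine ⟨U, Submodule.disjoint_def.2 fun u hu huK =>
      Submodule.disjoint_def.1 hd u ⟨hUH hu, huK⟩ hu, hUH, ?_⟩
    rw [← hs, sup_comm]
    exact sup_le_sup_left inf_le_right U
  have hUfin : FiniteDimensional k U :=
    Submodule.finiteDimensional_of_le (hUH.1.trans inf_le_left)
  obtain ⟨g, hg₀, hg⟩ := exists_poly_injective U (v₀ := v₀) fun u hu h0 => by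
    have h1 := hH.1 (hUH.1 hu)
    refine Submodule.disjoint_def.1 hUK u hu (hK.2 (h u (fun i => ⟨h1.1 i, ?_⟩) h1.2))
    rintro _ ⟨j, rfl⟩
    exact h0 j i
  refine ⟨g, hg₀, fun v hv hgv w hw hfw => ?_⟩
  obtain ⟨u, hu, q, hq, rfl⟩ := Submodule.mem_sup.1 (hUH.2 (hH.2 ⟨fun i => (hw i).1, hfw⟩))
  have hu0 : u = 0 := hg v hgv u hu fun i j => by
    have h1 : eval (v i) ((u + q) j) = 0 := (hw j).2 _ (Set.mem_range_self i)
    obtain ⟨t, ht⟩ := hK.1 hq j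
    rwa [Pi.add_apply, ht, map_add, map_mul, hv, zero_mul, add_zero] at h1
  rw [hu0, zero_add]
  exact hK.1 hq

theorem generalPoints_hasMinFreeRes [IsAlgClosed k] (S : SmoothCubicSurface k) {a p : ℕ}
    (ha : 1 ≤ a) (hp : p = 3 * (a * (a - 1) / 2) + 2 * a + 1) :
    GeneralPointsSatisfy k S p fun Z =>
      HasMinFreeRes3 k (Ideal.span {S.f}) (pointsIdeal k (Set.range Z)) (genDegrees a)
        (fun _ : Fin (3 * a + 3) => a + 2) (fun _ : Fin (2 * a) => a + 3) := by
  classical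
  have hf' := S.irred.prime
  obtain ⟨v₀, hv₀, hinj, hsurj⟩ := exists_surjective_family S.homog S.irred
    (fun v hv hvf h0 => (S.smooth v hv hvf).elim fun i hi => hi (congrFun h0 i))
    (hp.trans (by rw [Nat.choose_two_right]))
  obtain ⟨g₁, hg₁, h₁⟩ := exists_poly_linInj hinj
  obtain ⟨g₂, hg₂, h₂⟩ := exists_poly_surjective hsurj
  refine ⟨g₁ * g₂, ⟨fun i => Projectivization.mk k (v₀ i) (hv₀ i).1, ⟨fun i j hij => ?_,
    fun i v hv hvi => ?_⟩, v₀, fun i => ⟨(hv₀ i).1, rfl⟩, ?_⟩, fun Z hZ => ?_⟩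
  · by_contra hne
    obtain ⟨c, hc⟩ := (Projectivization.mk_eq_mk_iff' k _ _ _ _).1 hij
    obtain ⟨q, hq, hqv⟩ := hsurj (Pi.single i 1)
    have h3 := eval_smul_of_isHomogeneous hq c (v₀ j)
    rw [hc, hqv, hqv, Pi.single_eq_same, Pi.single_eq_of_ne (Ne.symm hne), mul_zero] at h3
    exact one_ne_zero h3
  · obtain ⟨c, rfl⟩ := (Projectivization.mk_eq_mk_iff' k _ _ _ _).1 hvi
    rw [eval_smul_of_isHomogeneous S.homog, (hv₀ i).2, mul_zero]
  · rw [map_mul]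
    exact mul_ne_zero hg₁ hg₂
  · rintro ⟨v, hvZ, hg⟩
    rw [map_mul] at hg
    choose hv0 hvZ using hvZ
    have hvf : ∀ i, eval (v i) S.f = 0 := fun i => hZ.2 i (v i) (hv0 i) (hvZ i)
    obtain ⟨y, hy, hy0⟩ := exists_isGoodSeq S.homog hf'.ne_zero (Finset.univ.image v)
      fun z hz => by
        obtain ⟨i, -, rfl⟩ := Finset.mem_image.1 hz
        exact ⟨hv0 i, hvf i⟩
    have hgen : IsGenericConfig S.f y v a :=
      { homog := S.homog
        prime := hf'
        good := hy
        on := hvf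
        y0 := fun i => hy0 _ (Finset.mem_image_of_mem v (Finset.mem_univ i))
        surj := h₂ v (right_ne_zero_of_mul hg)
        inj := h₁ v hvf (left_ne_zero_of_mul hg) }
    obtain rfl : (fun i => Projectivization.mk k (v i) (hv0 i)) = Z := funext hvZ
    exact hgen.hasMinFreeRes ha hp hv0

end Generic

end

end CubicPoints

/-- Third link.  If a general set of `o(a)` points on `X` has
`0 → R(-a-3)^a → R(-a-1)^(3a-3) ⊕ R(-a-2)^3 → R(-a)^(2a) → I_(Z,X) → 0` as graded minimal
free resolution over `R`, then a general set of `p(a)` points on `X` has graded minimal free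
resolution `0 → R(-a-3)^(2a) → R(-a-2)^(3a+3) → R(-a)^a ⊕ R(-a-1)^3 → I_(Z,X) → 0`. -/
theorem third_link (k : Type) [Field k] [IsAlgClosed k]
    (S : SmoothCubicSurface k) (a : ℕ) (ha : 1 ≤ a)
    (hyp : GeneralPointsSatisfy k S (3 * (a * (a - 1) / 2) + a + 1) (fun Z =>
      HasMinFreeRes3 k (Ideal.span {S.f}) (pointsIdeal k (Set.range Z))
        (fun _ : Fin (2 * a) => a)
        (Fin.append (fun _ : Fin (3 * a - 3) => a + 1) (fun _ : Fin (3) => a + 2))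
        (fun _ : Fin (a) => a + 3))) :
    GeneralPointsSatisfy k S (3 * (a * (a - 1) / 2) + 2 * a + 1) (fun Z =>
      HasMinFreeRes3 k (Ideal.span {S.f}) (pointsIdeal k (Set.range Z))
        (Fin.append (fun _ : Fin (a) => a) (fun _ : Fin (3) => a + 1))
        (fun _ : Fin (3 * a + 3) => a + 2)
        (fun _ : Fin (2 * a) => a + 3)) := by
  exact CubicPoints.generalPoints_hasMinFreeRes S ha rfl
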